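/- Fix b>0 and a smooth cutoff χ on [-b,0] with χ(0)=1, χ≡0 near x₃=-b. For every σ>0 and M>0 there exist T>0 and C>0, both independent of κ, such that for every κ∈(0,1] and every T₀∈(0,T] the following holds. Suppose (v,F₁,F₂,F₃,q,ψ) are smooth on [0,T₀]×Ω (ℤ²-periodic in x̄), φ(t,x)=x₃+χ(x₃)ψ(t,x̄) satisfies ∂₃φ≥1/2, and they solve the κ-regularized flattened elastodynamic system: D_t^φ v + ∇^φ q = Σ_{k=1}^3 (F_k·∇^φ)F_k and ∇^φ·v = 0 and D_t^φ F_j = (F_j·∇^φ)v and ∇^φ·F_j = 0 in Ω; ∂ₜψ = v·N, q = -σ ∇̄·(∇̄ψ/√(1+|∇̄ψ|²)) + κ(1-Δ̄)²ψ + κ(1-Δ̄)∂ₜψ, and F_j·N = 0 on Σ; v₃ = F_{3j} = 0 on Σ_b. Define the energy E₄^κ(t) = Σ_{l=0}^4 ( ‖∂ₜ^l v(t)‖²_{H^{4-l}(Ω)} + Σ_{k=1}^3 ‖∂ₜ^l F_k(t)‖²_{H^{4-l}(Ω)} + σ|∂ₜ^l ψ(t)|²_{H^{5-l}(Σ)}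 + κ|∂ₜ^l ψ(t)|²_{H^{6-l}(Σ)} + κ∫₀ᵗ |∂ₜ^{l+1}ψ(s)|²_{H^{5-l}(Σ)} ds ). If E₄^κ(0) ≤ M, then E₄^κ(t) ≤ C for all t∈[0,T₀]. -/

import Mathlib

noncomputable section

/-- Scalar functions of `(t, x₁, x₂, x₃)`. -/
abbrev Fn4 : Type := ℝ → ℝ → ℝ → ℝ → ℝ

/-- Scalar functions of `(t, x₁, x₂)` on the boundary. -/
abbrev FnB : Type := ℝ → ℝ → ℝ → ℝ

/-- Scalar functions of `(x₁, x₂, x₃)` (time slices). -/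
abbrev Fn3 : Type := ℝ → ℝ → ℝ → ℝ

/-- Scalar functions of `(x₁, x₂)` (boundary time slices). -/
abbrev Fn2 : Type := ℝ → ℝ → ℝ

/-- Time derivative `∂ₜ`. -/
def pt (f : Fn4) : Fn4 := fun t x1 x2 x3 => deriv (fun s => f s x1 x2 x3) t

/-- Partial derivative `∂₁`. -/
def p1 (f : Fn4) : Fn4 := fun t x1 x2 x3 => deriv (fun y => f t y x2 x3) x1

/-- Partial derivative `∂₂`. -/
def p2 (f : Fn4) : Fn4 := fun t x1 x2 x3 => deriv (fun y => f t x1 y x3) x2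

/-- Partial derivative `∂₃`. -/
def p3 (f : Fn4) : Fn4 := fun t x1 x2 x3 => deriv (fun y => f t x1 x2 y) x3

/-- Boundary time derivative. -/
def bt (f : FnB) : FnB := fun t x1 x2 => deriv (fun s => f s x1 x2) t

/-- Boundary derivative `∂₁`. -/
def b1 (f : FnB) : FnB := fun t x1 x2 => deriv (fun y => f t y x2) x1

/-- Boundary derivative `∂₂`. -/
def b2 (f : FnB) : FnB := fun t x1 x2 => deriv (fun y => f t x1 y) x2

/-- Spatial derivative `∂₁` of a time slice. -/
def s1 (f : Fn3) : Fn3 := fun x1 x2 x3 => deriv (fun y => f y x2 x3) x1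

/-- Spatial derivative `∂₂` of a time slice. -/
def s2 (f : Fn3) : Fn3 := fun x1 x2 x3 => deriv (fun y => f x1 y x3) x2

/-- Spatial derivative `∂₃` of a time slice. -/
def s3 (f : Fn3) : Fn3 := fun x1 x2 x3 => deriv (fun y => f x1 x2 y) x3

/-- Iterated spatial derivative `∂^α = ∂₁^{α₁}∂₂^{α₂}∂₃^{α₃}`. -/
def sD (a : ℕ × ℕ × ℕ) (f : Fn3) : Fn3 := s1^[a.1] (s2^[a.2.1] (s3^[a.2.2] f))

/-- Horizontal derivative `∂₁` of a boundary time slice. -/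
def d1 (g : Fn2) : Fn2 := fun x1 x2 => deriv (fun y => g y x2) x1

/-- Horizontal derivative `∂₂` of a boundary time slice. -/
def d2 (g : Fn2) : Fn2 := fun x1 x2 => deriv (fun y => g x1 y) x2

/-- Iterated horizontal derivative `∂̄^β = ∂₁^{β₁}∂₂^{β₂}`. -/
def dD (a : ℕ × ℕ) (g : Fn2) : Fn2 := d1^[a.1] (d2^[a.2] g)

/-- Integral over one periodic cell of `Ω = 𝕋² × (-b, 0)`. -/
def intOmega (b : ℝ) (g : Fn3) : ℝ :=
  ∫ x1 in (0:ℝ)..1, ∫ x2 in (0:ℝ)..1, ∫ x3 in (-b)..(0:ℝ), g x1 x2 x3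

/-- Integral over one periodic cell of `Σ = 𝕋² × {0}`. -/
def intSurf (g : Fn2) : ℝ := ∫ x1 in (0:ℝ)..1, ∫ x2 in (0:ℝ)..1, g x1 x2

/-- Squared Sobolev norm `‖f‖²_{H^m(Ω)} = Σ_{|α|≤m} ‖∂^α f‖²_{L²(Ω)}`. -/
def HsqOmega (b : ℝ) (m : ℕ) (f : Fn3) : ℝ :=
  ∑ a ∈ (Finset.range (m + 1) ×ˢ Finset.range (m + 1) ×ˢ Finset.range (m + 1)).filter
      (fun a => a.1 + a.2.1 + a.2.2 ≤ m),
    intOmega b (fun x1 x2 x3 => (sD a f x1 x2 x3) ^ 2)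

/-- Squared Sobolev norm `|g|²_{H^m(Σ)} = Σ_{|β|≤m} ‖∂̄^β g‖²_{L²(𝕋²)}`. -/
def HsqSurf (m : ℕ) (g : Fn2) : ℝ :=
  ∑ a ∈ (Finset.range (m + 1) ×ˢ Finset.range (m + 1)).filter
      (fun a => a.1 + a.2 ≤ m),
    intSurf (fun x1 x2 => (dD a g x1 x2) ^ 2)

/-- The flattened derivatives `∂₁^φ, ∂₂^φ, ∂₃^φ`. -/
def fd (φ : Fn4) : Fin 3 → Fn4 → Fn4 :=
  ![fun f t x1 x2 x3 =>
      p1 f t x1 x2 x3 - p1 φ t x1 x2 x3 / p3 φ t x1 x2 x3 * p3 f t x1 x2 x3,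
    fun f t x1 x2 x3 =>
      p2 f t x1 x2 x3 - p2 φ t x1 x2 x3 / p3 φ t x1 x2 x3 * p3 f t x1 x2 x3,
    fun f t x1 x2 x3 => p3 f t x1 x2 x3 / p3 φ t x1 x2 x3]

/-- Directional derivative `(X·∇^φ)f`. -/
def dirD (φ : Fn4) (X : Fin 3 → Fn4) (f : Fn4) : Fn4 := fun t x1 x2 x3 =>
  ∑ i : Fin 3, X i t x1 x2 x3 * fd φ i f t x1 x2 x3

/-- The material derivative `D_t^φ f = ∂ₜf + v̄·∂̄f + (1/∂₃φ)(v·𝐍 − ∂ₜφ)∂₃f`. -/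
def matD (φ : Fn4) (v : Fin 3 → Fn4) (f : Fn4) : Fn4 := fun t x1 x2 x3 =>
  pt f t x1 x2 x3 + v 0 t x1 x2 x3 * p1 f t x1 x2 x3 + v 1 t x1 x2 x3 * p2 f t x1 x2 x3 +
  1 / p3 φ t x1 x2 x3 *
    (v 0 t x1 x2 x3 * (-(p1 φ t x1 x2 x3)) + v 1 t x1 x2 x3 * (-(p2 φ t x1 x2 x3)) +
      v 2 t x1 x2 x3 - pt φ t x1 x2 x3) * p3 f t x1 x2 x3

/-- Smoothness of a function of `(t, x₁, x₂, x₃)`. -/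
def Smooth4 (f : Fn4) : Prop :=
  ContDiff ℝ (⊤ : ℕ∞) (fun p : ℝ × ℝ × ℝ × ℝ => f p.1 p.2.1 p.2.2.1 p.2.2.2)

/-- `ℤ²`-periodicity in the horizontal variables. -/
def Periodic4 (f : Fn4) : Prop :=
  (∀ t x1 x2 x3 : ℝ, f t (x1 + 1) x2 x3 = f t x1 x2 x3) ∧
  (∀ t x1 x2 x3 : ℝ, f t x1 (x2 + 1) x3 = f t x1 x2 x3)

/-- Horizontal Laplacian `Δ̄` on the boundary. -/
def lapB (ψ : FnB) : FnB := fun t x1 x2 => b1 (b1 ψ) t x1 x2 + b2 (b2 ψ) t x1 x2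

/-- `(1 − Δ̄)ψ`. -/
def oneMinusLap (ψ : FnB) : FnB := fun t x1 x2 => ψ t x1 x2 - lapB ψ t x1 x2

/-- The mean-curvature operator `∇̄·(∇̄ψ/√(1+|∇̄ψ|²))`. -/
def meanCurvOp (ψ : FnB) : FnB := fun t x1 x2 =>
  b1 (fun s y1 y2 =>
    b1 ψ s y1 y2 / Real.sqrt (1 + (b1 ψ s y1 y2) ^ 2 + (b2 ψ s y1 y2) ^ 2)) t x1 x2 +
  b2 (fun s y1 y2 =>
    b2 ψ s y1 y2 / Real.sqrt (1 + (b1 ψ s y1 y2) ^ 2 + (b2 ψ s y1 y2) ^ 2)) t x1 x2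

/-- The higher-order energy functional
`E₄^κ(t) = Σ_{l=0}^4 ( ‖∂ₜ^l v‖²_{H^{4-l}} + Σₖ ‖∂ₜ^l Fₖ‖²_{H^{4-l}} + σ|∂ₜ^l ψ|²_{H^{5-l}}
 + κ|∂ₜ^l ψ|²_{H^{6-l}} + κ∫₀ᵗ |∂ₜ^{l+1}ψ|²_{H^{5-l}} )`. -/
def energy4 (b σ κ : ℝ) (ψ : FnB) (v : Fin 3 → Fn4) (F : Fin 3 → Fin 3 → Fn4)
    (t : ℝ) : ℝ :=
  ∑ l ∈ Finset.range 5,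
    ((∑ i : Fin 3, HsqOmega b (4 - l) (fun x1 x2 x3 => (pt^[l]) (v i) t x1 x2 x3)) +
      (∑ j : Fin 3, ∑ i : Fin 3,
        HsqOmega b (4 - l) (fun x1 x2 x3 => (pt^[l]) (F j i) t x1 x2 x3)) +
      σ * HsqSurf (5 - l) (fun x1 x2 => (bt^[l]) ψ t x1 x2) +
      κ * HsqSurf (6 - l) (fun x1 x2 => (bt^[l]) ψ t x1 x2) +
      κ * ∫ s in (0:ℝ)..t, HsqSurf (5 - l) (fun x1 x2 => (bt^[l + 1]) ψ s x1 x2))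

namespace EE
open scoped ContDiff
open MeasureTheory Set Filter Topology

/-- Space-time points. -/
abbrev Pt : Type := ℝ × ℝ × ℝ × ℝ

/-- Coordinate directions. -/
def ee : Fin 4 → Pt := ![(1,0,0,0),(0,1,0,0),(0,0,1,0),(0,0,0,1)]

/-- Smooth, horizontally periodic functions. -/
structure Sm (f : Pt → ℝ) : Prop where
  smooth : ContDiff ℝ ∞ f
  per1 : ∀ p, f (p + ee 1) = f p
  per2 : ∀ p, f (p + ee 2) = f p

/-- Partial derivative. -/
def dd (i : Fin 4) (f : Pt → ℝ) (p : Pt) : ℝ := fderiv ℝ f p (ee i)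

lemma Sm.diff {f : Pt → ℝ} (hf : Sm f) : Differentiable ℝ f :=
  hf.smooth.differentiable (by simp)

lemma Sm.cont {f : Pt → ℝ} (hf : Sm f) : Continuous f := hf.smooth.continuous

lemma Sm.add {f g : Pt → ℝ} (hf : Sm f) (hg : Sm g) : Sm (f + g) :=
  ⟨hf.smooth.add hg.smooth, fun p => by simp [hf.per1, hg.per1],
    fun p => by simp [hf.per2, hg.per2]⟩

lemma Sm.mul {f g : Pt → ℝ} (hf : Sm f) (hg : Sm g) : Sm (f * g) :=
  ⟨hf.smooth.mul hg.smooth, fun p => by simp [hf.per1, hg.per1],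
    fun p => by simp [hf.per2, hg.per2]⟩

lemma Sm.const (c : ℝ) : Sm (fun _ => c) := ⟨contDiff_const, fun _ => rfl, fun _ => rfl⟩

lemma Sm.comp {f : Pt → ℝ} (hf : Sm f) {g : ℝ → ℝ} (hg : ContDiff ℝ ∞ g) :
    Sm (fun p => g (f p)) :=
  ⟨hg.comp hf.smooth, fun p => by simp [hf.per1], fun p => by simp [hf.per2]⟩

lemma Sm.dd {f : Pt → ℝ} (hf : Sm f) (i : Fin 4) : Sm (dd i f) := by
  refine ⟨?_, fun p => ?_, fun p => ?_⟩
  · have h : ContDiff ℝ ∞ (fderiv ℝ f) := hf.smooth.fderiv_right (by simp)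
    exact h.clm_apply contDiff_const
  · have : f = fun q => f (q + ee 1) := by funext q; exact (hf.per1 q).symm
    unfold EE.dd
    conv_rhs => rw [this]
    rw [fderiv_comp_add_right]
  · have : f = fun q => f (q + ee 2) := by funext q; exact (hf.per2 q).symm
    unfold EE.dd
    conv_rhs => rw [this]
    rw [fderiv_comp_add_right]

lemma dd_add {f g : Pt → ℝ} (hf : Sm f) (hg : Sm g) (i : Fin 4) :
    dd i (f + g) = dd i f + dd i g := by
  funext p
  simp [dd, fderiv_add (hf.diff p) (hg.diff p)]

lemma dd_mul {f g : Pt → ℝ} (hf : Sm f) (hg : Sm g) (i : Fin 4) :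
    dd i (f * g) = f * dd i g + g * dd i f := by
  funext p
  simp [dd, fderiv_mul (hf.diff p) (hg.diff p)]

lemma dd_const (c : ℝ) (i : Fin 4) : dd i (fun _ => c) = 0 := by
  funext p; simp [dd]

lemma dd_comm {f : Pt → ℝ} (hf : Sm f) (i j : Fin 4) : dd i (dd j f) = dd j (dd i f) := by
  funext p
  have h2 : IsSymmSndFDerivAt ℝ f p := by
    apply ContDiffAt.isSymmSndFDerivAt (n := ∞) hf.smooth.contDiffAt
    simp only [minSmoothness_of_isRCLikeNormedField]
    exact WithTop.coe_le_coe.2 (le_top : (2 : ℕ∞) ≤ ⊤)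
  have hd : Differentiable ℝ (fderiv ℝ f) :=
    (hf.smooth.fderiv_right (m := ∞) (by simp)).differentiable (by simp)
  have key : ∀ a c : Fin 4, dd a (dd c f) p = fderiv ℝ (fderiv ℝ f) p (ee a) (ee c) := by
    intro a c
    have : dd c f = fun q => fderiv ℝ f q (ee c) := rfl
    rw [dd, this, fderiv_clm_apply (hd p) (differentiableAt_const _)]
    simp
  rw [key, key]
  exact h2 _ _

/-- The setting: an index type of solutions, each with its time of existence. -/
structure Ctx where
  S : Type
  T : S → ℝ
  hT : ∀ s, 0 < T s
  b : ℝ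
  hb : 0 < b
  E : S → ℝ → ℝ
  hE : ∀ s, ∀ t ∈ Icc 0 (T s), 0 ≤ E s t
  M : ℝ

variable (X : Ctx)

/-- The algebra of families of smooth periodic functions. -/
def A : Subalgebra ℝ (X.S → Pt → ℝ) where
  carrier := {f | ∀ s, Sm (f s)}
  mul_mem' := fun hf hg s => (hf s).mul (hg s)
  add_mem' := fun hf hg s => (hf s).add (hg s)
  algebraMap_mem' := fun c _ => Sm.const c

/-- The space-time box of a solution. -/
def Box (s : X.S) : Set Pt := {p | p.1 ∈ Icc 0 (X.T s) ∧ p.2.2.2 ∈ Icc (-X.b) 0}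

/-- Families vanishing on the box. -/
def Iz : Ideal (A X) where
  carrier := {f | ∀ s, ∀ p ∈ Box X s, f.1 s p = 0}
  add_mem' := fun {f g} hf hg s p hp => by
    change f.1 s p + g.1 s p = 0
    rw [hf s p hp, hg s p hp, add_zero]
  zero_mem' := fun s p _ => rfl
  smul_mem' := fun c f hf s p hp => by
    change c.1 s p * f.1 s p = 0
    rw [hf s p hp, mul_zero]

/-- The ring of fields on the boxes. -/
def Q : Type := A X ⧸ Iz X

instance : CommRing (Q X) := inferInstanceAs (CommRing (A X ⧸ Iz X))
instance : Algebra ℝ (Q X) := inferInstanceAs (Algebra ℝ (A X ⧸ Iz X))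

variable {X}

/-- Class of a family. -/
def mk (f : A X) : Q X := Ideal.Quotient.mk (Iz X) f

lemma mk_surj (f : Q X) : ∃ g, mk g = f := Ideal.Quotient.mk_surjective f

lemma mk_eq_iff {f g : A X} : mk f = mk g ↔ ∀ s, ∀ p ∈ Box X s, f.1 s p = g.1 s p := by
  refine Iff.trans (Ideal.Quotient.eq (I := Iz X)) ?_
  constructor
  · intro h s p hp
    have := h s p hp
    exact sub_eq_zero.1 this
  · intro h s p hp
    exact sub_eq_zero.2 (h s p hp)

lemma mk_add (f g : A X) : mk (f + g) = mk f + mk g := rfl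
lemma mk_mul (f g : A X) : mk (f * g) = mk f * mk g := rfl
lemma mk_smul (c : ℝ) (f : A X) : mk (c • f) = c • mk f := rfl

/-- Representative. -/
def rep (f : Q X) : A X := (mk_surj f).choose
lemma mk_rep (f : Q X) : mk (rep f) = f := (mk_surj f).choose_spec

/-- Evaluation. -/
def ev (f : Q X) (s : X.S) (p : Pt) : ℝ := (rep f).1 s p

lemma ev_mk (f : A X) {s : X.S} {p : Pt} (hp : p ∈ Box X s) : ev (mk f) s p = f.1 s p :=
  mk_eq_iff.1 (mk_rep (mk f)) s p hp

lemma ev_add (f g : Q X) {s : X.S} {p : Pt} (hp : p ∈ Box X s) :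
    ev (f + g) s p = ev f s p + ev g s p := by
  obtain ⟨f, rfl⟩ := mk_surj f; obtain ⟨g, rfl⟩ := mk_surj g
  rw [← mk_add, ev_mk _ hp, ev_mk _ hp, ev_mk _ hp]; rfl

lemma ev_mul (f g : Q X) {s : X.S} {p : Pt} (hp : p ∈ Box X s) :
    ev (f * g) s p = ev f s p * ev g s p := by
  obtain ⟨f, rfl⟩ := mk_surj f; obtain ⟨g, rfl⟩ := mk_surj g
  rw [← mk_mul, ev_mk _ hp, ev_mk _ hp, ev_mk _ hp]; rfl

lemma ev_smul (c : ℝ) (f : Q X) {s : X.S} {p : Pt} (hp : p ∈ Box X s) :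
    ev (c • f) s p = c * ev f s p := by
  obtain ⟨f, rfl⟩ := mk_surj f
  rw [← mk_smul, ev_mk _ hp, ev_mk _ hp]; rfl

lemma ev_neg (f : Q X) {s : X.S} {p : Pt} (hp : p ∈ Box X s) : ev (-f) s p = - ev f s p := by
  have := ev_smul (-1) f hp
  simpa using this

lemma ev_sub (f g : Q X) {s : X.S} {p : Pt} (hp : p ∈ Box X s) :
    ev (f - g) s p = ev f s p - ev g s p := by
  rw [sub_eq_add_neg, ev_add _ _ hp, ev_neg _ hp]; ring

lemma ev_one {s : X.S} {p : Pt} (hp : p ∈ Box X s) : ev (1 : Q X) s p = 1 := by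
  have : (1 : Q X) = mk 1 := rfl
  rw [this, ev_mk _ hp]; rfl

lemma ev_zero {s : X.S} {p : Pt} (hp : p ∈ Box X s) : ev (0 : Q X) s p = 0 := by
  have : (0 : Q X) = mk 0 := rfl
  rw [this, ev_mk _ hp]; rfl

lemma ev_pow (f : Q X) (n : ℕ) {s : X.S} {p : Pt} (hp : p ∈ Box X s) :
    ev (f ^ n) s p = (ev f s p) ^ n := by
  induction n with
  | zero => simp [ev_one hp]
  | succ n ih => rw [pow_succ, ev_mul _ _ hp, ih, pow_succ]

lemma ev_sum {ι : Type*} (t : Finset ι) (f : ι → Q X) {s : X.S} {p : Pt} (hp : p ∈ Box X s) :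
    ev (∑ i ∈ t, f i) s p = ∑ i ∈ t, ev (f i) s p := by
  classical
  induction t using Finset.induction_on with
  | empty => simp [ev_zero hp]
  | insert a t ha ih => rw [Finset.sum_insert ha, Finset.sum_insert ha, ev_add _ _ hp, ih]

lemma Q_ext {f g : Q X} (h : ∀ s, ∀ p ∈ Box X s, ev f s p = ev g s p) : f = g := by
  rw [← mk_rep f, ← mk_rep g, mk_eq_iff]
  exact h

lemma Box_closure (s : X.S) : Box X s ⊆ closure (interior (Box X s)) := by
  have : Box X s = (Icc 0 (X.T s)) ×ˢ ((univ : Set ℝ) ×ˢ ((univ : Set ℝ) ×ˢ (Icc (-X.b) 0))) := by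
    ext p; simp [Box]
  rw [this]
  simp only [interior_prod_eq, interior_univ, interior_Icc, closure_prod_eq, closure_univ]
  rw [closure_Ioo (X.hT s).ne, closure_Ioo (by linarith [X.hb])]

lemma dd_vanish {s : X.S} {f : Pt → ℝ} (hf : Sm f) (h : ∀ p ∈ Box X s, f p = 0) (i : Fin 4) :
    ∀ p ∈ Box X s, dd i f p = 0 := by
  intro p hp
  have hcl : IsClosed {p | dd i f p = 0} := isClosed_eq (hf.dd i).cont continuous_const
  have hsub : interior (Box X s) ⊆ {p | dd i f p = 0} := by
    intro p hp
    have : f =ᶠ[𝓝 p] fun _ => 0 := by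
      filter_upwards [isOpen_interior.mem_nhds hp] with q hq
      exact h q (interior_subset hq)
    simp [dd, this.fderiv_eq]
  exact (closure_minimal hsub hcl) (Box_closure s hp)

/-- Derivative on families. -/
def DA (i : Fin 4) : A X →ₗ[ℝ] A X where
  toFun f := ⟨fun s => dd i (f.1 s), fun s => (f.2 s).dd i⟩
  map_add' f g := by
    ext s p
    exact congrFun (dd_add (f.2 s) (g.2 s) i) p
  map_smul' c f := by
    ext s p
    have h := dd_mul (Sm.const c) (f.2 s) i
    have h2 := congrFun h p
    simp [dd_const] at h2
    exact h2

/-- Derivations of fields. -/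
def D (i : Fin 4) : Q X →ₗ[ℝ] Q X where
  toFun f := mk (DA i (rep f))
  map_add' f g := by
    rw [← mk_add, ← map_add, mk_eq_iff]
    intro s p hp
    have := dd_vanish ((rep (f+g) - (rep f + rep g)).2 s) (X := X) (s := s) ?_ i p hp
    · have h2 : DA i (rep (f+g) - (rep f + rep g)) = DA i (rep (f+g)) - DA i (rep f + rep g) :=
        map_sub _ _ _
      have h3 : (DA i (rep (f+g)) - DA i (rep f + rep g)).1 s p = 0 := by rw [← h2]; exact this
      exact sub_eq_zero.1 h3
    · intro p hp
      have h := mk_eq_iff.1 (show mk (rep (f+g)) = mk (rep f + rep g) by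
        rw [mk_add, mk_rep, mk_rep, mk_rep]) s p hp
      exact sub_eq_zero.2 h
  map_smul' c f := by
    simp only [RingHom.id_apply]
    rw [← mk_smul, ← map_smul, mk_eq_iff]
    intro s p hp
    have := dd_vanish ((rep (c • f) - c • rep f).2 s) (X := X) (s := s) ?_ i p hp
    · have h2 : DA i (rep (c • f) - c • rep f) = DA i (rep (c • f)) - DA i (c • rep f) :=
        map_sub _ _ _
      have h3 : (DA i (rep (c • f)) - DA i (c • rep f)).1 s p = 0 := by rw [← h2]; exact this
      exact sub_eq_zero.1 h3
    · intro p hp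
      have h := mk_eq_iff.1 (show mk (rep (c • f)) = mk (c • rep f) by
        rw [mk_smul, mk_rep, mk_rep]) s p hp
      exact sub_eq_zero.2 h

lemma D_mk (i : Fin 4) (f : A X) : D i (mk f) = mk (DA i f) := by
  change mk (DA i (rep (mk f))) = _
  rw [mk_eq_iff]
  intro s p hp
  have := dd_vanish ((rep (mk f) - f).2 s) (X := X) (s := s) ?_ i p hp
  · have h2 : DA i (rep (mk f) - f) = DA i (rep (mk f)) - DA i f := map_sub _ _ _
    have h3 : (DA i (rep (mk f)) - DA i f).1 s p = 0 := by rw [← h2]; exact this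
    exact sub_eq_zero.1 h3
  · intro p hp
    exact sub_eq_zero.2 (mk_eq_iff.1 (mk_rep (mk f)) s p hp)

lemma D_mul (i : Fin 4) (f g : Q X) : D i (f * g) = f * D i g + g * D i f := by
  obtain ⟨f, rfl⟩ := mk_surj f; obtain ⟨g, rfl⟩ := mk_surj g
  rw [← mk_mul, D_mk, D_mk, D_mk, ← mk_mul, ← mk_mul, ← mk_add]
  congr 1
  ext s p
  exact congrFun (dd_mul (f.2 s) (g.2 s) i) p

lemma D_comm (i j : Fin 4) (f : Q X) : D i (D j f) = D j (D i f) := by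
  obtain ⟨f, rfl⟩ := mk_surj f
  rw [D_mk, D_mk, D_mk, D_mk]
  congr 1
  ext s p
  exact congrFun (dd_comm (f.2 s) i j) p

lemma D_one (i : Fin 4) : D i (1 : Q X) = 0 := by
  have h := D_mul i (1 : Q X) 1
  simpa using h

lemma D_pow (i : Fin 4) (f : Q X) (n : ℕ) : D i (f ^ (n+1)) = (n+1) * f ^ n * D i f := by
  induction n with
  | zero => simp
  | succ n ih => rw [pow_succ, D_mul, ih]; push_cast; ring

end EE

namespace EE
open scoped ContDiff
open MeasureTheory Set Filter Topology

/-- Restricted Lebesgue measure on one cell of `Ω`. -/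
def mu (b : ℝ) : Measure (ℝ × ℝ × ℝ) :=
  (volume.restrict (Icc (0:ℝ) 1)).prod
    ((volume.restrict (Icc (0:ℝ) 1)).prod (volume.restrict (Icc (-b) 0)))

lemma mu_eq (b : ℝ) : mu b = volume.restrict (Icc (0:ℝ) 1 ×ˢ (Icc (0:ℝ) 1 ×ˢ Icc (-b) 0)) := by
  unfold mu
  rw [Measure.prod_restrict, Measure.prod_restrict]
  rfl

instance (b : ℝ) : IsFiniteMeasure (mu b) := by unfold mu; infer_instance

lemma box_compact (b : ℝ) : IsCompact (Icc (0:ℝ) 1 ×ˢ (Icc (0:ℝ) 1 ×ˢ Icc (-b) 0)) :=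
  isCompact_Icc.prod (isCompact_Icc.prod isCompact_Icc)

lemma box_meas (b : ℝ) : MeasurableSet (Icc (0:ℝ) 1 ×ˢ (Icc (0:ℝ) 1 ×ˢ Icc (-b) 0)) :=
  measurableSet_Icc.prod (measurableSet_Icc.prod measurableSet_Icc)

lemma mu_ae (b : ℝ) : ∀ᵐ x ∂mu b, x ∈ (Icc (0:ℝ) 1 ×ˢ (Icc (0:ℝ) 1 ×ˢ Icc (-b) 0)) := by
  rw [mu_eq]; exact ae_restrict_mem (box_meas b)

lemma integrable_mu (b : ℝ) {g : ℝ × ℝ × ℝ → ℝ} (hg : Continuous g) : Integrable g (mu b) := by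
  rw [mu_eq]; exact hg.continuousOn.integrableOn_compact (box_compact b)

/-- Spatial integral of a function at time `t`. -/
def IA (b : ℝ) (f : Pt → ℝ) (t : ℝ) : ℝ := ∫ x, f (t, x) ∂mu b

lemma Icc_to_interval {a c : ℝ} (h : a ≤ c) (g : ℝ → ℝ) :
    ∫ x in Icc a c, g x = ∫ x in a..c, g x := by
  rw [intervalIntegral.integral_of_le h, integral_Icc_eq_integral_Ioc]

lemma IA_eq {b : ℝ} (hb : 0 < b) {f : Pt → ℝ} (hf : Continuous f) (t : ℝ) :
    IA b f t = ∫ x1 in (0:ℝ)..1, ∫ x2 in (0:ℝ)..1, ∫ x3 in (-b)..(0:ℝ), f (t, x1, x2, x3) := by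
  have h0 : Integrable (fun x : ℝ × ℝ × ℝ => f (t, x)) (mu b) := integrable_mu b (by fun_prop)
  unfold IA
  unfold mu at h0 ⊢
  rw [integral_prod _ h0, Icc_to_interval zero_le_one]
  congr 1; funext x1
  have h1 : Integrable (fun x : ℝ × ℝ => f (t, x1, x)) ((volume.restrict (Icc (0:ℝ) 1)).prod
      (volume.restrict (Icc (-b) 0))) := by
    rw [Measure.prod_restrict]
    exact (Continuous.continuousOn (by fun_prop)).integrableOn_compact
      (isCompact_Icc.prod isCompact_Icc)
  rw [integral_prod _ h1, Icc_to_interval zero_le_one]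
  congr 1; funext x2
  rw [Icc_to_interval (by linarith)]

lemma pt_eq (t x1 x2 x3 : ℝ) (f : Pt → ℝ) (hf : Sm f) :
    HasDerivAt (fun y => f (y, x1, x2, x3)) (dd 0 f (t, x1, x2, x3)) t ∧
    HasDerivAt (fun y => f (t, y, x2, x3)) (dd 1 f (t, x1, x2, x3)) x1 ∧
    HasDerivAt (fun y => f (t, x1, y, x3)) (dd 2 f (t, x1, x2, x3)) x2 ∧
    HasDerivAt (fun y => f (t, x1, x2, y)) (dd 3 f (t, x1, x2, x3)) x3 := by
  have h := (hf.diff (t, x1, x2, x3)).hasFDerivAt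
  refine ⟨?_, ?_, ?_, ?_⟩
  · exact h.comp_hasDerivAt t (f := fun y => (y, x1, x2, x3)) (f' := ee 0)
      ((hasDerivAt_id t).prodMk (hasDerivAt_const t (x1, x2, x3)))
  · exact h.comp_hasDerivAt x1 (f := fun y => (t, y, x2, x3)) (f' := ee 1)
      ((hasDerivAt_const _ t).prodMk ((hasDerivAt_id x1).prodMk (hasDerivAt_const _ (x2, x3))))
  · exact h.comp_hasDerivAt x2 (f := fun y => (t, x1, y, x3)) (f' := ee 2)
      ((hasDerivAt_const _ t).prodMk ((hasDerivAt_const _ x1).prodMk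
        ((hasDerivAt_id x2).prodMk (hasDerivAt_const _ x3))))
  · exact h.comp_hasDerivAt x3 (f := fun y => (t, x1, x2, y)) (f' := ee 3)
      ((hasDerivAt_const _ t).prodMk ((hasDerivAt_const _ x1).prodMk
        ((hasDerivAt_const _ x2).prodMk (hasDerivAt_id x3))))

lemma per1' {f : Pt → ℝ} (hf : Sm f) (t x1 x2 x3 : ℝ) : f (t, x1 + 1, x2, x3) = f (t, x1, x2, x3) := by
  have := hf.per1 (t, x1, x2, x3)
  simpa [ee] using this
lemma per2' {f : Pt → ℝ} (hf : Sm f) (t x1 x2 x3 : ℝ) : f (t, x1, x2 + 1, x3) = f (t, x1, x2, x3) := by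
  have := hf.per2 (t, x1, x2, x3)
  simpa [ee] using this

lemma IA_dd1 (b : ℝ) {f : Pt → ℝ} (hf : Sm f) (t : ℝ) : IA b (dd 1 f) t = 0 := by
  have hc := (hf.dd 1).cont
  have h0 : Integrable (fun x : ℝ × ℝ × ℝ => dd 1 f (t, x)) (mu b) := integrable_mu b (by fun_prop)
  unfold IA
  unfold mu at h0 ⊢
  rw [integral_prod_symm _ h0]
  have : ∀ y : ℝ × ℝ, ∫ x in Icc (0:ℝ) 1, dd 1 f (t, x, y) = 0 := by
    intro y
    rw [Icc_to_interval zero_le_one]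
    rw [intervalIntegral.integral_eq_sub_of_hasDerivAt
      (fun x _ => (pt_eq t x y.1 y.2 f hf).2.1)
      (Continuous.intervalIntegrable (by fun_prop) _ _)]
    have := per1' hf t 0 y.1 y.2
    rw [zero_add] at this
    rw [this, sub_self]
  simp [this]

lemma IA_dd2 (b : ℝ) {f : Pt → ℝ} (hf : Sm f) (t : ℝ) : IA b (dd 2 f) t = 0 := by
  have hc := (hf.dd 2).cont
  have h0 : Integrable (fun x : ℝ × ℝ × ℝ => dd 2 f (t, x)) (mu b) := integrable_mu b (by fun_prop)
  unfold IA
  unfold mu at h0 ⊢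
  rw [integral_prod _ h0]
  have : ∀ x1 : ℝ, ∫ y, dd 2 f (t, x1, y) ∂((volume.restrict (Icc (0:ℝ) 1)).prod
      (volume.restrict (Icc (-b) 0))) = 0 := by
    intro x1
    have h1 : Integrable (fun x : ℝ × ℝ => dd 2 f (t, x1, x)) ((volume.restrict (Icc (0:ℝ) 1)).prod
        (volume.restrict (Icc (-b) 0))) := by
      rw [Measure.prod_restrict]
      exact (Continuous.continuousOn (by fun_prop)).integrableOn_compact
        (isCompact_Icc.prod isCompact_Icc)
    rw [integral_prod_symm _ h1]
    have : ∀ y : ℝ, ∫ x in Icc (0:ℝ) 1, dd 2 f (t, x1, x, y) = 0 := by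
      intro y
      rw [Icc_to_interval zero_le_one]
      rw [intervalIntegral.integral_eq_sub_of_hasDerivAt
        (fun x _ => (pt_eq t x1 x y f hf).2.2.1)
        (Continuous.intervalIntegrable (by fun_prop) _ _)]
      have := per2' hf t x1 0 y
      rw [zero_add] at this
      rw [this, sub_self]
    simp [this]
  simp [this]

/-- Trace at height `c`, extended constantly. -/
def tf (c : ℝ) (f : Pt → ℝ) : Pt → ℝ := fun p => f (p.1, p.2.1, p.2.2.1, c)

lemma Sm.tf {f : Pt → ℝ} (hf : Sm f) (c : ℝ) : Sm (tf c f) := by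
  refine ⟨?_, fun p => ?_, fun p => ?_⟩
  · exact hf.smooth.comp (by fun_prop)
  · have := per1' hf p.1 p.2.1 p.2.2.1 c
    simpa [EE.tf, ee] using this
  · have := per2' hf p.1 p.2.1 p.2.2.1 c
    simpa [EE.tf, ee] using this

lemma dd_tf {f : Pt → ℝ} (hf : Sm f) (c : ℝ) :
    dd 0 (tf c f) = tf c (dd 0 f) ∧ dd 1 (tf c f) = tf c (dd 1 f) ∧
    dd 2 (tf c f) = tf c (dd 2 f) ∧ dd 3 (tf c f) = 0 := by
  refine ⟨?_, ?_, ?_, ?_⟩ <;> funext p <;> obtain ⟨t, x1, x2, x3⟩ := p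
  · exact (pt_eq t x1 x2 x3 _ (hf.tf c)).1.unique (pt_eq t x1 x2 c f hf).1
  · exact (pt_eq t x1 x2 x3 _ (hf.tf c)).2.1.unique (pt_eq t x1 x2 c f hf).2.1
  · exact (pt_eq t x1 x2 x3 _ (hf.tf c)).2.2.1.unique (pt_eq t x1 x2 c f hf).2.2.1
  · exact (pt_eq t x1 x2 x3 _ (hf.tf c)).2.2.2.unique
      (show HasDerivAt (fun _ : ℝ => f (t, x1, x2, c)) 0 x3 from hasDerivAt_const _ _)

lemma IA_tf {b : ℝ} (hb : 0 < b) {f : Pt → ℝ} (hf : Sm f) (c t : ℝ) :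
    IA b (tf c f) t = b * ∫ x1 in (0:ℝ)..1, ∫ x2 in (0:ℝ)..1, f (t, x1, x2, c) := by
  rw [IA_eq hb (hf.tf c).cont]
  simp [tf, intervalIntegral.integral_const_mul]

lemma cont_inner {f : Pt → ℝ} (hf : Continuous f) (t c : ℝ) :
    Continuous fun x1 => ∫ x2 in (0:ℝ)..1, f (t, x1, x2, c) := by
  apply intervalIntegral.continuous_parametric_intervalIntegral_of_continuous'
  fun_prop

lemma IA_dd3 {b : ℝ} (hb : 0 < b) {f : Pt → ℝ} (hf : Sm f) (t : ℝ) :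
    b * IA b (dd 3 f) t = IA b (tf 0 f) t - IA b (tf (-b) f) t := by
  rw [IA_eq hb (hf.dd 3).cont, IA_tf hb hf, IA_tf hb hf, ← mul_sub]
  congr 1
  have hc := hf.cont
  rw [← intervalIntegral.integral_sub ((cont_inner hc t 0).intervalIntegrable _ _)
    ((cont_inner hc t (-b)).intervalIntegrable _ _)]
  congr 1; funext x1
  rw [← intervalIntegral.integral_sub (Continuous.intervalIntegrable (by fun_prop) _ _)
    (Continuous.intervalIntegrable (by fun_prop) _ _)]
  congr 1; funext x2
  have hc3 := (hf.dd 3).cont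
  rw [intervalIntegral.integral_eq_sub_of_hasDerivAt
      (fun x _ => (pt_eq t x1 x2 x f hf).2.2.2)
      (Continuous.intervalIntegrable (by fun_prop) _ _)]

lemma IA_hasDeriv (b : ℝ) {f : Pt → ℝ} (hf : Sm f) (t : ℝ) :
    HasDerivAt (IA b f) (IA b (dd 0 f) t) t := by
  have hc := hf.cont
  have hc0 := (hf.dd 0).cont
  obtain ⟨C, hC⟩ := ((isCompact_Icc (a := t - 1) (b := t + 1)).prod (box_compact b)).exists_bound_of_continuousOn
    (f := dd 0 f) hc0.continuousOn
  refine (hasDerivAt_integral_of_dominated_loc_of_deriv_le (μ := mu b) (s := Ioo (t-1) (t+1))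
    (bound := fun _ => C) (F := fun s x => f (s, x)) (F' := fun s x => dd 0 f (s, x))
    (Ioo_mem_nhds (by linarith) (by linarith)) ?_ ?_ ?_ ?_ ?_ ?_).2
  · exact Eventually.of_forall fun s => (Continuous.aestronglyMeasurable (by fun_prop))
  · exact integrable_mu b (by fun_prop)
  · exact (Continuous.aestronglyMeasurable (by fun_prop))
  · filter_upwards [mu_ae b] with x hx s hs
    exact hC (s, x) ⟨Ioo_subset_Icc_self hs, hx⟩
  · exact integrable_const _
  · exact Eventually.of_forall fun x s _ => (pt_eq s x.1 x.2.1 x.2.2 f hf).1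

end EE

namespace EE
open scoped ContDiff
open MeasureTheory Set Filter Topology

variable {X : Ctx}

/-- Spatially and temporally constant field. -/
def cst (c : X.S → ℝ) : Q X := mk ⟨fun s _ => c s, fun s => Sm.const (c s)⟩

lemma ev_cst (c : X.S → ℝ) {s : X.S} {p : Pt} (hp : p ∈ Box X s) : ev (cst c) s p = c s :=
  ev_mk _ hp

lemma D_cst (i : Fin 4) (c : X.S → ℝ) : D i (cst c) = 0 := by
  unfold cst
  rw [D_mk]
  change _ = mk 0
  congr 1
  ext s p
  exact congrFun (dd_const (c s) i) p

lemma smul_eq_cst (c : ℝ) (f : Q X) : c • f = cst (fun _ => c) * f := by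
  apply Q_ext
  intro s p hp
  rw [ev_smul _ _ hp, ev_mul _ _ hp, ev_cst _ hp]

/-- Spatial integral. -/
def I (f : Q X) (s : X.S) (t : ℝ) : ℝ := IA X.b ((rep f).1 s) t

/-- The time interval of a solution. -/
abbrev Tm (s : X.S) : Set ℝ := Icc 0 (X.T s)

lemma zero_Tm (s : X.S) : (0:ℝ) ∈ Tm s := ⟨le_rfl, (X.hT s).le⟩

lemma IA_congr {s : X.S} {t : ℝ} (ht : t ∈ Tm s) {f g : Pt → ℝ}
    (h : ∀ p ∈ Box X s, f p = g p) : IA X.b f t = IA X.b g t := by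
  unfold IA
  apply integral_congr_ae
  filter_upwards [mu_ae X.b] with x hx
  exact h _ ⟨ht, hx.2.2⟩

lemma I_mk (f : A X) {s : X.S} {t : ℝ} (ht : t ∈ Tm s) : I (mk f) s t = IA X.b (f.1 s) t :=
  IA_congr ht (mk_eq_iff.1 (mk_rep (mk f)) s)

lemma I_integrable (f : Q X) (s : X.S) (t : ℝ) :
    Integrable (fun x => (rep f).1 s (t, x)) (mu X.b) :=
  integrable_mu _ (((rep f).2 s).cont.comp (by fun_prop))

lemma I_add (f g : Q X) {s : X.S} {t : ℝ} (ht : t ∈ Tm s) : I (f + g) s t = I f s t + I g s t := by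
  have h : I (f + g) s t = IA X.b ((rep f).1 s + (rep g).1 s) t :=
    IA_congr ht (fun p hp => ev_add f g hp)
  rw [h]
  exact integral_add (I_integrable f s t) (I_integrable g s t)

lemma I_cmul (c : X.S → ℝ) (f : Q X) {s : X.S} {t : ℝ} (ht : t ∈ Tm s) :
    I (cst c * f) s t = c s * I f s t := by
  have h : I (cst c * f) s t = IA X.b (fun p => c s * (rep f).1 s p) t :=
    IA_congr ht (fun p hp => by
      have := ev_mul (cst c) f hp
      rw [ev_cst _ hp] at this
      exact this)
  rw [h]
  exact integral_const_mul _ _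

lemma I_smul (c : ℝ) (f : Q X) {s : X.S} {t : ℝ} (ht : t ∈ Tm s) :
    I (c • f) s t = c * I f s t := by
  rw [smul_eq_cst, I_cmul _ _ ht]

lemma I_neg (f : Q X) {s : X.S} {t : ℝ} (ht : t ∈ Tm s) : I (-f) s t = - I f s t := by
  have := I_smul (-1) f ht
  simpa using this

lemma I_sub (f g : Q X) {s : X.S} {t : ℝ} (ht : t ∈ Tm s) : I (f - g) s t = I f s t - I g s t := by
  rw [sub_eq_add_neg, I_add _ _ ht, I_neg _ ht]; ring

lemma I_zero {s : X.S} {t : ℝ} (ht : t ∈ Tm s) : I (0 : Q X) s t = 0 := by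
  have := I_smul 0 (0 : Q X) ht
  simpa using this

lemma I_sum {ι : Type*} (u : Finset ι) (f : ι → Q X) {s : X.S} {t : ℝ} (ht : t ∈ Tm s) :
    I (∑ i ∈ u, f i) s t = ∑ i ∈ u, I (f i) s t := by
  classical
  induction u using Finset.induction_on with
  | empty => simp [I_zero ht]
  | insert a u ha ih => rw [Finset.sum_insert ha, Finset.sum_insert ha, I_add _ _ ht, ih]

lemma I_mono {f g : Q X} {s : X.S} {t : ℝ} (ht : t ∈ Tm s)
    (h : ∀ x : ℝ × ℝ × ℝ, x.2.2 ∈ Icc (-X.b) 0 → ev f s (t, x) ≤ ev g s (t, x)) :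
    I f s t ≤ I g s t := by
  apply integral_mono_ae (I_integrable f s t) (I_integrable g s t)
  filter_upwards [mu_ae X.b] with x hx
  exact h x hx.2.2

lemma I_nonneg {f : Q X} {s : X.S} {t : ℝ} (ht : t ∈ Tm s)
    (h : ∀ x : ℝ × ℝ × ℝ, x.2.2 ∈ Icc (-X.b) 0 → 0 ≤ ev f s (t, x)) :
    0 ≤ I f s t := by
  rw [← I_zero ht]
  exact I_mono ht (fun x hx => by rw [ev_zero (show (t,x) ∈ Box X s from ⟨ht, hx⟩)]; exact h x hx)

lemma I_sq_nonneg (f : Q X) {s : X.S} {t : ℝ} (ht : t ∈ Tm s) : 0 ≤ I (f * f) s t :=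
  I_nonneg ht (fun x hx => by
    rw [ev_mul _ _ (show (t,x) ∈ Box X s from ⟨ht, hx⟩)]; exact mul_self_nonneg _)

/-- Volume of one cell. -/
lemma I_one {s : X.S} {t : ℝ} (ht : t ∈ Tm s) : I (1 : Q X) s t = X.b := by
  have h : I (1 : Q X) s t = IA X.b (fun _ => 1) t := IA_congr ht (fun p hp => ev_one hp)
  rw [h, IA_eq X.hb continuous_const]
  simp

lemma I_D1 (f : Q X) {s : X.S} {t : ℝ} (ht : t ∈ Tm s) : I (D 1 f) s t = 0 := by
  change I (mk (DA 1 (rep f))) s t = 0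
  rw [I_mk _ ht]; exact IA_dd1 _ ((rep f).2 s) t

lemma I_D2 (f : Q X) {s : X.S} {t : ℝ} (ht : t ∈ Tm s) : I (D 2 f) s t = 0 := by
  change I (mk (DA 2 (rep f))) s t = 0
  rw [I_mk _ ht]; exact IA_dd2 _ ((rep f).2 s) t

/-- Trace at height `c ∈ [-b,0]`. -/
def trc (c : ℝ) (hc : c ∈ Icc (-X.b) 0) : Q X →+* Q X where
  toFun f := mk ⟨fun s => tf c ((rep f).1 s), fun s => ((rep f).2 s).tf c⟩
  map_zero' := by
    change _ = mk 0
    rw [mk_eq_iff]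
    intro s p hp
    exact ev_zero (X := X) (s := s) (p := (p.1, p.2.1, p.2.2.1, c)) ⟨hp.1, hc⟩
  map_one' := by
    change _ = mk 1
    rw [mk_eq_iff]
    intro s p hp
    exact ev_one (X := X) (s := s) (p := (p.1, p.2.1, p.2.2.1, c)) ⟨hp.1, hc⟩
  map_add' f g := by
    rw [← mk_add, mk_eq_iff]
    intro s p hp
    exact ev_add (X := X) (s := s) f g (p := (p.1, p.2.1, p.2.2.1, c)) ⟨hp.1, hc⟩
  map_mul' f g := by
    rw [← mk_mul, mk_eq_iff]
    intro s p hp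
    exact ev_mul (X := X) (s := s) f g (p := (p.1, p.2.1, p.2.2.1, c)) ⟨hp.1, hc⟩

lemma trc_mk (c : ℝ) (hc : c ∈ Icc (-X.b) 0) (f : A X) :
    trc c hc (mk f) = mk ⟨fun s => tf c (f.1 s), fun s => (f.2 s).tf c⟩ := by
  change mk _ = mk _
  rw [mk_eq_iff]
  intro s p hp
  exact mk_eq_iff.1 (mk_rep (mk f)) s (p.1, p.2.1, p.2.2.1, c) ⟨hp.1, hc⟩

lemma ev_trc (c : ℝ) (hc : c ∈ Icc (-X.b) 0) (f : Q X) {s : X.S} {p : Pt} (hp : p ∈ Box X s) :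
    ev (trc c hc f) s p = ev f s (p.1, p.2.1, p.2.2.1, c) := by
  change ev (mk _) s p = _
  rw [ev_mk _ hp]; rfl

lemma D_trc (c : ℝ) (hc : c ∈ Icc (-X.b) 0) (f : Q X) :
    D 0 (trc c hc f) = trc c hc (D 0 f) ∧ D 1 (trc c hc f) = trc c hc (D 1 f) ∧
    D 2 (trc c hc f) = trc c hc (D 2 f) ∧ D 3 (trc c hc f) = 0 := by
  obtain ⟨f, rfl⟩ := mk_surj f
  simp only [trc_mk, D_mk]
  refine ⟨?_, ?_, ?_, ?_⟩
  · congr 1; ext s p; exact congrFun (dd_tf (f.2 s) c).1 p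
  · congr 1; ext s p; exact congrFun (dd_tf (f.2 s) c).2.1 p
  · congr 1; ext s p; exact congrFun (dd_tf (f.2 s) c).2.2.1 p
  · change _ = mk 0
    congr 1; ext s p; exact congrFun (dd_tf (f.2 s) c).2.2.2 p

/-- Trace on `Σ`. -/
def tr : Q X →+* Q X := trc 0 ⟨by linarith [X.hb], le_rfl⟩
/-- Trace on the bottom. -/
def trb : Q X →+* Q X := trc (-X.b) ⟨le_rfl, by linarith [X.hb]⟩

/-- The constant `b`. -/
def bb : Q X := cst (fun _ => X.b)

lemma I_D3 (f : Q X) {s : X.S} {t : ℝ} (ht : t ∈ Tm s) :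
    I (bb * D 3 f) s t = I (tr f) s t - I (trb f) s t := by
  unfold bb
  rw [I_cmul _ _ ht]
  have h := IA_dd3 X.hb ((rep f).2 s) t
  have h1 : I (D 3 f) s t = IA X.b (dd 3 ((rep f).1 s)) t := by
    change I (mk (DA 3 (rep f))) s t = _
    rw [I_mk _ ht]; rfl
  have h2 : I (tr f) s t = IA X.b (tf 0 ((rep f).1 s)) t := by
    change I (mk _) s t = _
    rw [I_mk _ ht]
  have h3 : I (trb f) s t = IA X.b (tf (-X.b) ((rep f).1 s)) t := by
    change I (mk _) s t = _
    rw [I_mk _ ht]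
  rw [h1, h2, h3]; exact h

lemma I_cont (f : Q X) (s : X.S) : Continuous (I f s) :=
  continuous_iff_continuousAt.2 fun t => (IA_hasDeriv X.b ((rep f).2 s) t).continuousAt

lemma I_deriv (f : Q X) {s : X.S} {t : ℝ} (ht : t ∈ Tm s) : HasDerivAt (I f s) (I (D 0 f) s t) t := by
  have h1 : I (D 0 f) s t = IA X.b (dd 0 ((rep f).1 s)) t := by
    change I (mk (DA 0 (rep f))) s t = _
    rw [I_mk _ ht]; rfl
  rw [h1]; exact IA_hasDeriv X.b ((rep f).2 s) t

lemma I_growth {e g : Q X} {C : ℝ} {s : X.S} {t : ℝ} (ht : t ∈ Tm s)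
    (h : ∀ r ∈ Icc 0 t, I (D 0 e) s r + I g s r ≤ C) :
    I e s t + ∫ r in (0:ℝ)..t, I g s r ≤ I e s 0 + C * t := by
  have hsub : ∀ r ∈ Icc 0 t, r ∈ Tm s := fun r hr => ⟨hr.1, hr.2.trans ht.2⟩
  have h1 : ∫ r in (0:ℝ)..t, I (D 0 e) s r = I e s t - I e s 0 := by
    apply intervalIntegral.integral_eq_sub_of_hasDerivAt
    · intro r hr
      rw [uIcc_of_le ht.1] at hr
      exact I_deriv e (hsub r hr)
    · exact (I_cont _ s).intervalIntegrable _ _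
  have h2 : ∫ r in (0:ℝ)..t, (I (D 0 e) s r + I g s r) ≤ ∫ r in (0:ℝ)..t, C := by
    apply intervalIntegral.integral_mono_on ht.1
    · exact ((I_cont _ s).add (I_cont _ s)).intervalIntegrable _ _
    · exact continuous_const.intervalIntegrable _ _
    · exact h
  rw [intervalIntegral.integral_add ((I_cont _ s).intervalIntegrable _ _)
    ((I_cont _ s).intervalIntegrable _ _), h1] at h2
  simp at h2
  linarith

end EE

namespace EE
open scoped ContDiff
open MeasureTheory Set Filter Topology

variable {X : Ctx}

/-- Fields whose integral is bounded in terms of the energy. -/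
def LB : Submodule ℝ (Q X) where
  carrier := {f | ∀ K, ∃ C, ∀ s, ∀ t ∈ Tm s, X.E s t ≤ K → |I f s t| ≤ C}
  add_mem' := by
    intro f g hf hg K
    obtain ⟨C, hC⟩ := hf K
    obtain ⟨C', hC'⟩ := hg K
    refine ⟨C + C', fun s t ht hE => ?_⟩
    rw [I_add _ _ ht]
    exact (abs_add_le _ _).trans (add_le_add (hC s t ht hE) (hC' s t ht hE))
  zero_mem' := by
    intro K
    exact ⟨0, fun s t ht _ => by rw [I_zero ht]; simp⟩
  smul_mem' := by
    intro c f hf K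
    obtain ⟨C, hC⟩ := hf K
    refine ⟨|c| * C, fun s t ht hE => ?_⟩
    rw [I_smul _ _ ht, abs_mul]
    exact mul_le_mul_of_nonneg_left (hC s t ht hE) (abs_nonneg _)

lemma ev_box {s : X.S} {t : ℝ} (ht : t ∈ Tm s) {x : ℝ × ℝ × ℝ} (hx : x.2.2 ∈ Icc (-X.b) 0) :
    (t, x) ∈ Box X s := ⟨ht, hx⟩

/-- Comparison of integrals of products. -/
lemma I_young (f g : Q X) {s : X.S} {t : ℝ} (ht : t ∈ Tm s) {r : ℝ} (hr : 0 < r) :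
    2 * |I (f * g) s t| ≤ r * I (f * f) s t + r⁻¹ * I (g * g) s t := by
  have key : ∀ c : ℝ, c ^ 2 = 1 → 0 ≤ r * I (f * f) s t + r⁻¹ * I (g * g) s t + 2 * c * I (f * g) s t := by
    intro c hc
    have := I_sq_nonneg (cst (fun _ => Real.sqrt r) * f + cst (fun _ => c * (Real.sqrt r)⁻¹) * g) ht
    have e : (cst (fun _ => Real.sqrt r) * f + cst (fun _ => c * (Real.sqrt r)⁻¹) * g) *
        (cst (fun _ => Real.sqrt r) * f + cst (fun _ => c * (Real.sqrt r)⁻¹) * g) =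
        cst (fun _ => r) * (f * f) + cst (fun _ => r⁻¹) * (g * g) + cst (fun _ => 2 * c) * (f * g) := by
      apply Q_ext
      intro s p hp
      simp only [ev_add _ _ hp, ev_mul _ _ hp, ev_cst _ hp]
      have h1 : Real.sqrt r * Real.sqrt r = r := Real.mul_self_sqrt hr.le
      have h3 : Real.sqrt r ≠ 0 := (Real.sqrt_pos.2 hr).ne'
      have h2 : (Real.sqrt r)⁻¹ * (Real.sqrt r)⁻¹ = r⁻¹ := by rw [← mul_inv, h1]
      have h4 : Real.sqrt r * (Real.sqrt r)⁻¹ = 1 := mul_inv_cancel₀ h3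
      linear_combination (ev f s p)^2 * h1 + c^2 * (ev g s p)^2 * h2 + 2 * c * ev f s p * ev g s p * h4
        + r⁻¹ * (ev g s p)^2 * hc
    rw [e, I_add _ _ ht, I_add _ _ ht, I_cmul _ _ ht, I_cmul _ _ ht, I_cmul _ _ ht] at this
    exact this
  have h1 := key 1 (by norm_num)
  have h2 := key (-1) (by norm_num)
  rcases abs_cases (I (f * g) s t) with h | h <;> rw [h.1] <;> linarith

lemma I_add_sq (f g : Q X) {s : X.S} {t : ℝ} (ht : t ∈ Tm s) :
    I ((f + g) * (f + g)) s t ≤ 2 * I (f * f) s t + 2 * I (g * g) s t := by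
  have e : (f + g) * (f + g) = f * f + g * g + (2:ℝ) • (f * g) := by
    rw [two_smul]; ring
  rw [e, I_add _ _ ht, I_add _ _ ht, I_smul _ _ ht]
  have := I_young f g ht one_pos
  have := le_abs_self (I (f * g) s t)
  simp at *; linarith

/-- Bounded in `L²`. -/
def L2 : Submodule ℝ (Q X) where
  carrier := {f | f * f ∈ LB}
  add_mem' := by
    intro f g hf hg K
    obtain ⟨C, hC⟩ := hf K
    obtain ⟨C', hC'⟩ := hg K
    refine ⟨2 * C + 2 * C', fun s t ht hE => ?_⟩
    rw [abs_of_nonneg (I_sq_nonneg _ ht)]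
    have h1 := (le_abs_self _).trans (hC s t ht hE)
    have h2 := (le_abs_self _).trans (hC' s t ht hE)
    have := I_add_sq f g ht
    linarith
  zero_mem' := by simp
  smul_mem' := by
    intro c f hf
    have : c • f * c • f = (c * c) • (f * f) := by
      simp [mul_smul]
    change c • f * c • f ∈ LB
    rw [this]; exact LB.smul_mem _ hf

lemma mem_L2 {f : Q X} : f ∈ L2 ↔ f * f ∈ LB := Iff.rfl

lemma mul_LB {f g : Q X} (hf : f ∈ L2) (hg : g ∈ L2) : f * g ∈ LB := by
  intro K
  obtain ⟨C, hC⟩ := hf K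
  obtain ⟨C', hC'⟩ := hg K
  refine ⟨C + C', fun s t ht hE => ?_⟩
  have h1 := (le_abs_self _).trans (hC s t ht hE)
  have h2 := (le_abs_self _).trans (hC' s t ht hE)
  have h3 := I_young f g ht one_pos
  have := I_sq_nonneg f ht
  have := I_sq_nonneg g ht
  simp at h3; linarith

/-- Bounded in `L^∞`. -/
def Li : Subalgebra ℝ (Q X) where
  carrier := {f | ∀ K, ∃ C, ∀ s, ∀ t ∈ Tm s, X.E s t ≤ K →
    ∀ x : ℝ × ℝ × ℝ, x.2.2 ∈ Icc (-X.b) 0 → |ev f s (t, x)| ≤ C}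
  add_mem' := by
    intro f g hf hg K
    obtain ⟨C, hC⟩ := hf K
    obtain ⟨C', hC'⟩ := hg K
    refine ⟨C + C', fun s t ht hE x hx => ?_⟩
    rw [ev_add _ _ (ev_box ht hx)]
    exact (abs_add_le _ _).trans (add_le_add (hC s t ht hE x hx) (hC' s t ht hE x hx))
  mul_mem' := by
    intro f g hf hg K
    obtain ⟨C, hC⟩ := hf K
    obtain ⟨C', hC'⟩ := hg K
    refine ⟨C * C', fun s t ht hE x hx => ?_⟩
    rw [ev_mul _ _ (ev_box ht hx), abs_mul]
    exact mul_le_mul (hC s t ht hE x hx) (hC' s t ht hE x hx) (abs_nonneg _)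
      ((abs_nonneg _).trans (hC s t ht hE x hx))
  algebraMap_mem' := by
    intro c K
    refine ⟨|c|, fun s t ht hE x hx => ?_⟩
    rw [Algebra.algebraMap_eq_smul_one, ev_smul _ _ (ev_box ht hx), ev_one (ev_box ht hx)]
    simp

lemma I_mul_le {a f : Q X} {s : X.S} {t : ℝ} (ht : t ∈ Tm s) {C : ℝ}
    (h : ∀ x : ℝ × ℝ × ℝ, x.2.2 ∈ Icc (-X.b) 0 → |ev a s (t, x)| ≤ C) :
    I (a * f * (a * f)) s t ≤ C ^ 2 * I (f * f) s t := by
  rw [← I_cmul (fun _ => C ^ 2) (f * f) ht]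
  apply I_mono ht
  intro x hx
  have hp := ev_box ht hx
  simp only [ev_mul _ _ hp, ev_cst _ hp]
  have := sq_le_sq' (abs_le.1 (h x hx)).1 (abs_le.1 (h x hx)).2
  nlinarith [mul_le_mul_of_nonneg_right this (sq_nonneg (ev f s (t, x)))]

lemma Li_L2 {a f : Q X} (ha : a ∈ Li) (hf : f ∈ L2) : a * f ∈ L2 := by
  intro K
  obtain ⟨C, hC⟩ := ha K
  obtain ⟨C', hC'⟩ := hf K
  refine ⟨C ^ 2 * C', fun s t ht hE => ?_⟩
  rw [abs_of_nonneg (I_sq_nonneg _ ht)]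
  refine (I_mul_le ht (hC s t ht hE)).trans ?_
  exact mul_le_mul_of_nonneg_left ((le_abs_self _).trans (hC' s t ht hE)) (sq_nonneg _)

lemma L2_Li {a f : Q X} (hf : f ∈ L2) (ha : a ∈ Li) : f * a ∈ L2 := by
  rw [mul_comm]; exact Li_L2 ha hf

lemma one_L2 : (1 : Q X) ∈ L2 := by
  intro K
  refine ⟨X.b, fun s t ht hE => ?_⟩
  rw [mul_one, I_one ht, abs_of_pos X.hb]

lemma Li_le {a : Q X} (ha : a ∈ Li) : a ∈ L2 := by
  have := Li_L2 ha one_L2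
  rwa [mul_one] at this

/-- The standing bootstrap assumption. -/
def Ok (K τ : ℝ) (s : X.S) : Prop := X.T s ≤ τ ∧ X.E s 0 ≤ X.M ∧ ∀ t ∈ Tm s, X.E s t ≤ K

/-- Weight. -/
def wt (s : X.S) (t : ℝ) : ℝ := Real.sqrt (1 + X.E s t)

lemma one_le_wt {s : X.S} {t : ℝ} (ht : t ∈ Tm s) : 1 ≤ wt s t :=
  Real.one_le_sqrt.2 (by linarith [X.hE s t ht])

/-- Fields with good bounds, relative to the weight to the power `i`. -/
def GB (i : ℕ) : Submodule ℝ (Q X) where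
  carrier := {f | ∃ C, ∀ K, ∃ τ > 0, ∀ s, Ok K τ s → ∀ t ∈ Tm s, |I f s t| ≤ C * wt s t ^ i}
  add_mem' := by
    rintro f g ⟨C, hC⟩ ⟨C', hC'⟩
    refine ⟨C + C', fun K => ?_⟩
    obtain ⟨τ, hτ, h⟩ := hC K
    obtain ⟨τ', hτ', h'⟩ := hC' K
    refine ⟨min τ τ', lt_min hτ hτ', fun s hs t ht => ?_⟩
    rw [I_add _ _ ht, add_mul]
    exact (abs_add_le _ _).trans (add_le_add
      (h s ⟨hs.1.trans (min_le_left _ _), hs.2⟩ t ht)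
      (h' s ⟨hs.1.trans (min_le_right _ _), hs.2⟩ t ht))
  zero_mem' := ⟨0, fun K => ⟨1, one_pos, fun s _ t ht => by rw [I_zero ht]; simp⟩⟩
  smul_mem' := by
    rintro c f ⟨C, hC⟩
    refine ⟨|c| * C, fun K => ?_⟩
    obtain ⟨τ, hτ, h⟩ := hC K
    refine ⟨τ, hτ, fun s hs t ht => ?_⟩
    rw [I_smul _ _ ht, abs_mul, mul_assoc]
    exact mul_le_mul_of_nonneg_left (h s hs t ht) (abs_nonneg _)

lemma GB_mono {i j : ℕ} (hij : i ≤ j) {f : Q X} (hf : f ∈ GB i) : f ∈ GB j := by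
  obtain ⟨C, hC⟩ := hf
  refine ⟨|C|, fun K => ?_⟩
  obtain ⟨τ, hτ, h⟩ := hC K
  refine ⟨τ, hτ, fun s hs t ht => (h s hs t ht).trans ?_⟩
  exact mul_le_mul (le_abs_self _) (pow_le_pow_right₀ (one_le_wt ht) hij)
    (pow_nonneg (zero_le_one.trans (one_le_wt ht)) _) (abs_nonneg _)

/-- Good `L²` fields. -/
def L2w (i : ℕ) : Submodule ℝ (Q X) where
  carrier := {f | f * f ∈ GB i}
  add_mem' := by
    rintro f g ⟨C, hC⟩ ⟨C', hC'⟩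
    refine ⟨2 * C + 2 * C', fun K => ?_⟩
    obtain ⟨τ, hτ, h⟩ := hC K
    obtain ⟨τ', hτ', h'⟩ := hC' K
    refine ⟨min τ τ', lt_min hτ hτ', fun s hs t ht => ?_⟩
    rw [abs_of_nonneg (I_sq_nonneg _ ht)]
    have h1 := (le_abs_self _).trans (h s ⟨hs.1.trans (min_le_left _ _), hs.2⟩ t ht)
    have h2 := (le_abs_self _).trans (h' s ⟨hs.1.trans (min_le_right _ _), hs.2⟩ t ht)
    have := I_add_sq f g ht
    linarith
  zero_mem' := by simp
  smul_mem' := by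
    intro c f hf
    have : c • f * c • f = (c * c) • (f * f) := by
      simp [mul_smul]
    change c • f * c • f ∈ GB i
    rw [this]; exact (GB i).smul_mem _ hf

lemma L2w_mono {i j : ℕ} (hij : i ≤ j) {f : Q X} (hf : f ∈ L2w i) : f ∈ L2w j :=
  GB_mono hij hf

lemma mul_GB {f g : Q X} (hf : f ∈ L2w 0) (hg : g ∈ L2w 2) : f * g ∈ GB 1 := by
  obtain ⟨C, hC⟩ := hf
  obtain ⟨C', hC'⟩ := hg
  refine ⟨C + C', fun K => ?_⟩
  obtain ⟨τ, hτ, h⟩ := hC K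
  obtain ⟨τ', hτ', h'⟩ := hC' K
  refine ⟨min τ τ', lt_min hτ hτ', fun s hs t ht => ?_⟩
  have h1 := (le_abs_self _).trans (h s ⟨hs.1.trans (min_le_left _ _), hs.2⟩ t ht)
  have h2 := (le_abs_self _).trans (h' s ⟨hs.1.trans (min_le_right _ _), hs.2⟩ t ht)
  have hw := one_le_wt ht
  have hw0 : 0 < wt s t := by linarith
  have h3 := I_young f g ht hw0
  have h4 : wt s t * I (f * f) s t ≤ wt s t * C := by
    apply mul_le_mul_of_nonneg_left _ hw0.le
    simpa using h1
  have h5 : (wt s t)⁻¹ * I (g * g) s t ≤ C' * wt s t := by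
    rw [inv_mul_le_iff₀ hw0]
    calc _ ≤ _ := h2
      _ = _ := by ring
  have := abs_nonneg (I (f * g) s t)
  rw [pow_one]
  nlinarith

/-- Good bounded fields. -/
def GLi : Subalgebra ℝ (Q X) where
  carrier := {f | ∃ C, ∀ K, ∃ τ > 0, ∀ s, Ok K τ s → ∀ t ∈ Tm s,
    ∀ x : ℝ × ℝ × ℝ, x.2.2 ∈ Icc (-X.b) 0 → |ev f s (t, x)| ≤ C}
  add_mem' := by
    rintro f g ⟨C, hC⟩ ⟨C', hC'⟩
    refine ⟨C + C', fun K => ?_⟩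
    obtain ⟨τ, hτ, h⟩ := hC K
    obtain ⟨τ', hτ', h'⟩ := hC' K
    refine ⟨min τ τ', lt_min hτ hτ', fun s hs t ht x hx => ?_⟩
    rw [ev_add _ _ (ev_box ht hx)]
    exact (abs_add_le _ _).trans (add_le_add
      (h s ⟨hs.1.trans (min_le_left _ _), hs.2⟩ t ht x hx)
      (h' s ⟨hs.1.trans (min_le_right _ _), hs.2⟩ t ht x hx))
  mul_mem' := by
    rintro f g ⟨C, hC⟩ ⟨C', hC'⟩
    refine ⟨C * C', fun K => ?_⟩
    obtain ⟨τ, hτ, h⟩ := hC K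
    obtain ⟨τ', hτ', h'⟩ := hC' K
    refine ⟨min τ τ', lt_min hτ hτ', fun s hs t ht x hx => ?_⟩
    rw [ev_mul _ _ (ev_box ht hx), abs_mul]
    have h1 := h s ⟨hs.1.trans (min_le_left _ _), hs.2⟩ t ht x hx
    exact mul_le_mul h1 (h' s ⟨hs.1.trans (min_le_right _ _), hs.2⟩ t ht x hx) (abs_nonneg _)
      ((abs_nonneg _).trans h1)
  algebraMap_mem' := by
    intro c
    refine ⟨|c|, fun K => ⟨1, one_pos, fun s _ t ht x hx => ?_⟩⟩
    rw [Algebra.algebraMap_eq_smul_one, ev_smul _ _ (ev_box ht hx), ev_one (ev_box ht hx)]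
    simp

lemma GLi_L2w {i : ℕ} {a f : Q X} (ha : a ∈ GLi) (hf : f ∈ L2w i) : a * f ∈ L2w i := by
  obtain ⟨C, hC⟩ := ha
  obtain ⟨C', hC'⟩ := hf
  refine ⟨C ^ 2 * C', fun K => ?_⟩
  obtain ⟨τ, hτ, h⟩ := hC K
  obtain ⟨τ', hτ', h'⟩ := hC' K
  refine ⟨min τ τ', lt_min hτ hτ', fun s hs t ht => ?_⟩
  rw [abs_of_nonneg (I_sq_nonneg _ ht), mul_assoc (C ^ 2)]
  refine (I_mul_le ht (h s ⟨hs.1.trans (min_le_left _ _), hs.2⟩ t ht)).trans ?_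
  exact mul_le_mul_of_nonneg_left ((le_abs_self _).trans
    (h' s ⟨hs.1.trans (min_le_right _ _), hs.2⟩ t ht)) (sq_nonneg _)

/-- Fields with vanishing integral. -/
def Null : Submodule ℝ (Q X) where
  carrier := {f | ∀ s, ∀ t ∈ Tm s, I f s t = 0}
  add_mem' := by
    intro f g hf hg s t ht
    rw [I_add _ _ ht, hf s t ht, hg s t ht, add_zero]
  zero_mem' := fun s t ht => I_zero ht
  smul_mem' := by
    intro c f hf s t ht
    rw [I_smul _ _ ht, hf s t ht, mul_zero]

lemma Null_cmul (c : X.S → ℝ) {f : Q X} (hf : f ∈ Null) : cst c * f ∈ Null := by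
  intro s t ht
  rw [I_cmul _ _ ht, hf s t ht, mul_zero]

lemma Null_LB {f : Q X} (hf : f ∈ Null) : f ∈ LB :=
  fun _ => ⟨0, fun s t ht _ => by rw [hf s t ht]; simp⟩

lemma D1_Null (f : Q X) : D 1 f ∈ Null := fun _ _ ht => I_D1 f ht
lemma D2_Null (f : Q X) : D 2 f ∈ Null := fun _ _ ht => I_D2 f ht
lemma D3_Null (f : Q X) : bb * D 3 f - tr f + trb f ∈ Null := fun _ _ ht => by
  rw [I_add _ _ ht, I_sub _ _ ht, I_D3 _ ht]; ring

/-- The growth principle. -/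
lemma growth {e g q : Q X} (he : e ∈ LB) (h : D 0 e + g + q ∈ LB)
    (hq : ∀ s, ∀ t ∈ Tm s, 0 ≤ I q s t) :
    ∃ C, ∀ K, ∃ τ > 0, ∀ s, Ok K τ s → ∀ t ∈ Tm s,
      I e s t + ∫ r in (0:ℝ)..t, I g s r ≤ C := by
  obtain ⟨C0, hC0⟩ := he X.M
  refine ⟨C0 + 1, fun K => ?_⟩
  obtain ⟨C, hC⟩ := h K
  refine ⟨1 / (|C| + 1), by positivity, fun s hs t ht => ?_⟩
  have h1 := I_growth (e := e) (g := g) (C := |C|) ht (fun r hr => by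
    have hr' : r ∈ Tm s := ⟨hr.1, hr.2.trans ht.2⟩
    have h2 := (le_abs_self _).trans (hC s r hr' (hs.2.2 r hr'))
    rw [I_add _ _ hr', I_add _ _ hr'] at h2
    have := hq s r hr'
    have := le_abs_self C
    linarith)
  have h3 := (le_abs_self _).trans (hC0 s 0 (zero_Tm s) hs.2.1)
  have h4 : |C| * t ≤ 1 := by
    have : t ≤ 1 / (|C| + 1) := ht.2.trans hs.1
    rw [le_div_iff₀ (by positivity)] at this
    nlinarith [abs_nonneg C, ht.1]
  linarith

lemma L2w_of {f : Q X} (hf : f ∈ L2) (h0 : D 0 f ∈ L2) : f ∈ L2w 0 := by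
  have h : D 0 (f * f) + 0 + 0 ∈ LB := by
    have e : D 0 (f * f) + 0 + 0 = f * D 0 f + f * D 0 f := by rw [D_mul]; ring
    rw [e]; exact LB.add_mem (mul_LB hf h0) (mul_LB hf h0)
  obtain ⟨C, hC⟩ := growth (e := f * f) (g := 0) (q := 0) hf h (fun s t ht => (I_zero ht).ge)
  refine ⟨C, fun K => ?_⟩
  obtain ⟨τ, hτ, h⟩ := hC K
  refine ⟨τ, hτ, fun s hs t ht => ?_⟩
  have := h s hs t ht
  have h0 : ∫ r in (0:ℝ)..t, I (0 : Q X) s r = 0 := by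
    rw [intervalIntegral.integral_congr (g := fun _ => 0)]
    · simp
    · intro r hr
      rw [uIcc_of_le ht.1] at hr
      exact I_zero ⟨hr.1, hr.2.trans ht.2⟩
  rw [abs_of_nonneg (I_sq_nonneg _ ht)]
  simp; linarith

lemma ev_hasDeriv (f : Q X) {s : X.S} {t : ℝ} (ht : t ∈ Tm s) {x : ℝ × ℝ × ℝ}
    (hx : x.2.2 ∈ Icc (-X.b) 0) :
    HasDerivAt (fun r => ev f s (r, x)) (ev (D 0 f) s (t, x)) t := by
  have h1 : ev (D 0 f) s (t, x) = dd 0 ((rep f).1 s) (t, x) := by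
    change ev (mk (DA 0 (rep f))) s (t, x) = _
    rw [ev_mk _ (ev_box ht hx)]; rfl
  rw [h1]
  exact (pt_eq t x.1 x.2.1 x.2.2 _ ((rep f).2 s)).1

lemma GLi_of {f : Q X} (hf : f ∈ Li) (h0 : D 0 f ∈ Li) : f ∈ GLi := by
  obtain ⟨C0, hC0⟩ := hf X.M
  refine ⟨C0 + 1, fun K => ?_⟩
  obtain ⟨C, hC⟩ := h0 K
  refine ⟨1 / (|C| + 1), by positivity, fun s hs t ht x hx => ?_⟩
  have h1 : ‖ev f s (t, x) - ev f s (0, x)‖ ≤ |C| * (t - 0) := by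
    refine norm_image_sub_le_of_norm_deriv_le_segment' (f := fun r => ev f s (r, x))
      (f' := fun r => ev (D 0 f) s (r, x)) (C := |C|) (a := 0) (b := t) ?_ ?_ t ⟨ht.1, le_rfl⟩
    · intro r hr
      exact (ev_hasDeriv f (s := s) ⟨hr.1, hr.2.trans ht.2⟩ hx).hasDerivWithinAt
    · intro r hr
      have hr' : r ∈ Tm s := ⟨hr.1, hr.2.le.trans ht.2⟩
      exact (hC s r hr' (hs.2.2 r hr') x hx).trans (le_abs_self _)
  have h3 := hC0 s 0 (zero_Tm s) hs.2.1 x hx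
  have h4 : |C| * t ≤ 1 := by
    have : t ≤ 1 / (|C| + 1) := ht.2.trans hs.1
    rw [le_div_iff₀ (by positivity)] at this
    nlinarith [abs_nonneg C, ht.1]
  rw [Real.norm_eq_abs] at h1
  have := abs_sub_abs_le_abs_sub (ev f s (t, x)) (ev f s (0, x))
  linarith

lemma one_L2w : (1 : Q X) ∈ L2w 0 := by
  refine L2w_of one_L2 ?_
  rw [D_one]; exact L2.zero_mem

lemma GLi_le {a : Q X} (ha : a ∈ GLi) (i : ℕ) : a ∈ L2w i := by
  have := GLi_L2w ha one_L2w
  rw [mul_one] at this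
  exact L2w_mono (Nat.zero_le _) this

lemma cst_Li {c : X.S → ℝ} {C : ℝ} (h : ∀ s, |c s| ≤ C) : cst c ∈ Li :=
  fun _ => ⟨C, fun s t ht _ x hx => by rw [ev_cst _ (ev_box ht hx)]; exact h s⟩

lemma cst_GLi {c : X.S → ℝ} {C : ℝ} (h : ∀ s, |c s| ≤ C) : cst c ∈ GLi :=
  ⟨C, fun _ => ⟨1, one_pos, fun s _ t ht x hx => by rw [ev_cst _ (ev_box ht hx)]; exact h s⟩⟩

lemma bb_Li : (bb : Q X) ∈ Li := cst_Li (C := X.b) fun _ => (abs_of_pos X.hb).le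

lemma mul_cst_LB {c : X.S → ℝ} {C : ℝ} (h : ∀ s, |c s| ≤ C) {f : Q X} (hf : f ∈ LB) :
    cst c * f ∈ LB := by
  intro K
  obtain ⟨C', hC'⟩ := hf K
  refine ⟨C * C', fun s t ht hE => ?_⟩
  rw [I_cmul _ _ ht, abs_mul]
  exact mul_le_mul (h s) (hC' s t ht hE) (abs_nonneg _) ((abs_nonneg _).trans (h s))

end EE

namespace EE
open scoped ContDiff
open MeasureTheory Set Filter Topology

lemma cs1 {δ : ℝ} (hδ : 0 < δ) {u : ℝ → ℝ} (hu : Continuous u) :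
    (∫ r in (0:ℝ)..δ, u r) ^ 2 ≤ δ * ∫ r in (0:ℝ)..δ, u r ^ 2 := by
  set m := (∫ r in (0:ℝ)..δ, u r) with hm
  have h : 0 ≤ ∫ r in (0:ℝ)..δ, (δ * u r - m) ^ 2 :=
    intervalIntegral.integral_nonneg hδ.le (fun r _ => sq_nonneg _)
  have e : ∀ r, (δ * u r - m) ^ 2 = δ ^ 2 * u r ^ 2 - 2 * δ * m * u r + m ^ 2 := fun r => by ring
  simp only [e] at h
  rw [intervalIntegral.integral_add (Continuous.intervalIntegrable (by fun_prop) _ _)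
    (Continuous.intervalIntegrable (by fun_prop) _ _),
    intervalIntegral.integral_sub (Continuous.intervalIntegrable (by fun_prop) _ _)
    (Continuous.intervalIntegrable (by fun_prop) _ _), intervalIntegral.integral_const_mul,
    intervalIntegral.integral_const_mul, ← hm] at h
  simp at h
  have : 0 ≤ δ * (δ * ∫ r in (0:ℝ)..δ, u r ^ 2) - δ * m ^ 2 := by linarith
  have : 0 ≤ δ * ((δ * ∫ r in (0:ℝ)..δ, u r ^ 2) - m ^ 2) := by linarith
  have := nonneg_of_mul_nonneg_right this hδ
  linarith

lemma sob1 {δ : ℝ} (hδ : 0 < δ) : ∃ C, 0 ≤ C ∧ ∀ g g1 g2 : ℝ → ℝ, (∀ r, HasDerivAt g (g1 r) r) →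
    (∀ r, HasDerivAt g1 (g2 r) r) → Continuous g2 →
    g 0 ^ 2 ≤ C * ∫ r in (0:ℝ)..δ, r ^ 2 * (g r ^ 2 + g1 r ^ 2 + g2 r ^ 2) := by
  set c : ℝ := 2 / δ ^ 2 + 4 / δ + 1 with hc
  have hc0 : 0 < c := by positivity
  refine ⟨δ * (3 * c ^ 2), by positivity, fun g g1 g2 h1 h2 hg2 => ?_⟩
  have hg : Continuous g := continuous_iff_continuousAt.2 fun r => (h1 r).continuousAt
  have hg1 : Continuous g1 := continuous_iff_continuousAt.2 fun r => (h2 r).continuousAt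
  set k : ℝ → ℝ := fun r => 2 / δ ^ 2 * g r - 4 / δ * (1 - r / δ) * g1 r + (1 - r / δ) ^ 2 * g2 r with hk
  have hkc : Continuous k := by rw [hk]; fun_prop
  have hlin : ∀ r, HasDerivAt (fun r : ℝ => 1 - r / δ) (-(1 / δ)) r := fun r => by
    have := ((hasDerivAt_id r).div_const δ).const_sub 1
    simpa using this
  have hInt0 : ∫ r in (0:ℝ)..δ, r * k r = g 0 := by
    have hd : ∀ r, HasDerivAt (fun r => r * (2 * (1 - r / δ) * (-(1 / δ)) * g r + (1 - r / δ) ^ 2 * g1 r)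
        - (1 - r / δ) ^ 2 * g r) (r * k r) r := by
      intro r
      have a1 := (hlin r)
      have a2 := ((hlin r).pow 2)
      have b1 := (((a1.const_mul 2).mul_const (-(1/δ))).mul (h1 r)).add (a2.mul (h2 r))
      have b2 := ((hasDerivAt_id r).mul b1).sub (a2.mul (h1 r))
      refine b2.congr_deriv ?_
      simp only [hk, id, Pi.mul_apply, Pi.pow_apply, Pi.add_apply]
      push_cast
      simp only [show (2:ℕ) - 1 = 1 from rfl, pow_one]
      ring
    rw [intervalIntegral.integral_eq_sub_of_hasDerivAt (fun r _ => hd r)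
      (Continuous.intervalIntegrable (by fun_prop) _ _)]
    simp [hδ.ne']
  rw [← hInt0]
  refine (cs1 hδ (by fun_prop)).trans ?_
  rw [mul_assoc]
  apply mul_le_mul_of_nonneg_left _ hδ.le
  rw [← intervalIntegral.integral_const_mul]
  apply intervalIntegral.integral_mono_on hδ.le
  · exact Continuous.intervalIntegrable (by fun_prop) _ _
  · exact Continuous.intervalIntegrable (by fun_prop) _ _
  intro r hr
  have hr1 : 0 ≤ r / δ := div_nonneg hr.1 hδ.le
  have hr2 : r / δ ≤ 1 := (div_le_one hδ).2 hr.2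
  have e1 : |2 / δ ^ 2 * g r| ≤ c * |g r| := by
    rw [abs_mul, abs_of_pos (by positivity)]
    apply mul_le_mul_of_nonneg_right _ (abs_nonneg _)
    rw [hc]; have : 0 < 4 / δ := by positivity
    linarith
  have e2 : |4 / δ * (1 - r / δ) * g1 r| ≤ c * |g1 r| := by
    rw [abs_mul]
    apply mul_le_mul_of_nonneg_right _ (abs_nonneg _)
    have p1 : 0 < 4 / δ := by positivity
    have p2 : 0 < 2 / δ ^ 2 := by positivity
    rw [abs_of_nonneg (mul_nonneg p1.le (by linarith))]
    nlinarith
  have e3 : |(1 - r / δ) ^ 2 * g2 r| ≤ c * |g2 r| := by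
    rw [abs_mul]
    apply mul_le_mul_of_nonneg_right _ (abs_nonneg _)
    have p1 : 0 < 4 / δ := by positivity
    have p2 : 0 < 2 / δ ^ 2 := by positivity
    rw [abs_of_nonneg (sq_nonneg _)]
    nlinarith
  have e4 : |k r| ≤ c * (|g r| + |g1 r| + |g2 r|) := by
    have : k r = 2 / δ ^ 2 * g r - 4 / δ * (1 - r / δ) * g1 r + (1 - r / δ) ^ 2 * g2 r := rfl
    rw [this]
    refine (abs_add_le _ _).trans ?_
    have := abs_sub (2 / δ ^ 2 * g r) (4 / δ * (1 - r / δ) * g1 r)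
    linarith
  have e5 : k r ^ 2 ≤ (c * (|g r| + |g1 r| + |g2 r|)) ^ 2 := by
    rw [← sq_abs (k r)]
    exact pow_le_pow_left₀ (abs_nonneg _) e4 2
  have e6 : (|g r| + |g1 r| + |g2 r|) ^ 2 ≤ 3 * (g r ^ 2 + g1 r ^ 2 + g2 r ^ 2) := by
    rw [← sq_abs (g r), ← sq_abs (g1 r), ← sq_abs (g2 r)]
    nlinarith [sq_nonneg (|g r| - |g1 r|), sq_nonneg (|g r| - |g2 r|), sq_nonneg (|g1 r| - |g2 r|)]
  calc (r * k r) ^ 2 = r ^ 2 * k r ^ 2 := by ring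
    _ ≤ r ^ 2 * (c ^ 2 * (3 * (g r ^ 2 + g1 r ^ 2 + g2 r ^ 2))) := by
      apply mul_le_mul_of_nonneg_left _ (sq_nonneg _)
      rw [mul_pow] at e5
      exact e5.trans (mul_le_mul_of_nonneg_left e6 (sq_nonneg _))
    _ = _ := by ring

lemma per_int {g : ℝ → ℝ} (hg : Continuous g) (h0 : ∀ x, 0 ≤ g x) (hp : ∀ x, g (x + 1) = g x)
    (x : ℝ) {r : ℝ} (hr : r ∈ Icc (0:ℝ) 1) :
    r * ∫ w in (0:ℝ)..1, g (x + r * w) ≤ ∫ w in (0:ℝ)..1, g w := by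
  rw [intervalIntegral.mul_integral_comp_add_mul]
  have h1 : ∫ w in x..x + 1, g w = ∫ w in (0:ℝ)..0 + 1, g w :=
    Function.Periodic.intervalIntegral_add_eq (f := g) (T := 1) hp x 0
  rw [zero_add] at h1
  rw [← h1, mul_zero, add_zero, mul_one]
  apply intervalIntegral.integral_mono_interval le_rfl (by linarith [hr.1]) (by linarith [hr.2])
  · exact Eventually.of_forall h0
  · exact hg.intervalIntegrable _ _

lemma swapc {F : ℝ → ℝ → ℝ} (hF : Continuous (Function.uncurry F)) (a b c d : ℝ) :
    ∫ x in a..b, ∫ y in c..d, F x y = ∫ y in c..d, ∫ x in a..b, F x y := by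
  apply intervalIntegral_intervalIntegral_swap
  refine IntegrableOn.mono_set (t := uIcc a b ×ˢ uIcc c d) ?_
    (prod_mono uIoc_subset_uIcc uIoc_subset_uIcc)
  exact hF.continuousOn.integrableOn_compact (isCompact_uIcc.prod isCompact_uIcc)

lemma cint {Y : Type*} [TopologicalSpace Y] [FirstCountableTopology Y] {F : Y → ℝ → ℝ}
    (hF : Continuous (Function.uncurry F)) (a b : ℝ) :
    Continuous fun y => ∫ w in a..b, F y w :=
  intervalIntegral.continuous_parametric_intervalIntegral_of_continuous' hF a b

/-- Sum of squares of spatial derivatives up to order two. -/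
def GG (f : Pt → ℝ) : Pt → ℝ := fun p => f p ^ 2 + ∑ i : Fin 3, dd i.succ f p ^ 2 +
  ∑ i : Fin 3, ∑ j : Fin 3, dd i.succ (dd j.succ f) p ^ 2

lemma line_deriv {f : Pt → ℝ} (hf : Sm f) (t x1 x2 x3 w1 w2 w3 r : ℝ) :
    HasDerivAt (fun r => f (t, x1 + r * w1, x2 + r * w2, x3 + r * w3))
      (w1 * dd 1 f (t, x1 + r * w1, x2 + r * w2, x3 + r * w3) +
       w2 * dd 2 f (t, x1 + r * w1, x2 + r * w2, x3 + r * w3) +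
       w3 * dd 3 f (t, x1 + r * w1, x2 + r * w2, x3 + r * w3)) r := by
  have h := (hf.diff (t, x1 + r * w1, x2 + r * w2, x3 + r * w3)).hasFDerivAt
  have hl : ∀ x w : ℝ, HasDerivAt (fun r : ℝ => x + r * w) w r := fun x w => by
    simpa using ((hasDerivAt_id r).mul_const w).const_add x
  have h2 := h.comp_hasDerivAt r (f := fun r => (t, x1 + r * w1, x2 + r * w2, x3 + r * w3))
    (f' := (0, w1, w2, w3))
    ((hasDerivAt_const _ t).prodMk ((hl x1 w1).prodMk ((hl x2 w2).prodMk (hl x3 w3))))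
  refine h2.congr_deriv ?_
  have e : ((0, w1, w2, w3) : Pt) = w1 • ee 1 + w2 • ee 2 + w3 • ee 3 := by
    simp [ee]
  rw [e, map_add, map_add, map_smul, map_smul, map_smul]
  rfl

lemma three_sq {w1 w2 w3 a1 a2 a3 : ℝ} (h1 : w1 ^ 2 ≤ 1) (h2 : w2 ^ 2 ≤ 1) (h3 : w3 ^ 2 ≤ 1) :
    (w1 * a1 + w2 * a2 + w3 * a3) ^ 2 ≤ 3 * (a1 ^ 2 + a2 ^ 2 + a3 ^ 2) := by
  have : (w1 * a1 + w2 * a2 + w3 * a3) ^ 2 ≤ 3 * ((w1 * a1) ^ 2 + (w2 * a2) ^ 2 + (w3 * a3) ^ 2) := by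
    nlinarith [sq_nonneg (w1 * a1 - w2 * a2), sq_nonneg (w1 * a1 - w3 * a3),
      sq_nonneg (w2 * a2 - w3 * a3)]
  nlinarith [mul_le_mul_of_nonneg_right h1 (sq_nonneg a1), mul_le_mul_of_nonneg_right h2 (sq_nonneg a2),
    mul_le_mul_of_nonneg_right h3 (sq_nonneg a3)]

lemma GG_cont {f : Pt → ℝ} (hf : Sm f) : Continuous (GG f) := by
  have h0 := hf.cont
  have h1 := fun i => (hf.dd i).cont
  have h2 := fun i j => ((hf.dd j).dd i).cont
  unfold GG
  fun_prop

lemma GG_nonneg (f : Pt → ℝ) (p : Pt) : 0 ≤ GG f p := by unfold GG; positivity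

lemma GG_per {f : Pt → ℝ} (hf : Sm f) (t x1 x2 x3 : ℝ) :
    GG f (t, x1 + 1, x2, x3) = GG f (t, x1, x2, x3) ∧
    GG f (t, x1, x2 + 1, x3) = GG f (t, x1, x2, x3) := by
  unfold GG
  constructor
  · simp only [per1' hf, fun i => per1' (hf.dd i), fun i j => per1' ((hf.dd j).dd i)]
  · simp only [per2' hf, fun i => per2' (hf.dd i), fun i j => per2' ((hf.dd j).dd i)]

lemma sob_line {δ : ℝ} (hδ : 0 < δ) : ∃ C, 0 ≤ C ∧ ∀ f, Sm f → ∀ t x1 x2 x3 w1 w2 w3 : ℝ,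
    w1 ^ 2 ≤ 1 → w2 ^ 2 ≤ 1 → w3 ^ 2 ≤ 1 →
    f (t, x1, x2, x3) ^ 2 ≤
      C * ∫ r in (0:ℝ)..δ, r ^ 2 * GG f (t, x1 + r * w1, x2 + r * w2, x3 + r * w3) := by
  obtain ⟨C, hC0, hC⟩ := sob1 hδ
  refine ⟨9 * C, by positivity, fun f hf t x1 x2 x3 w1 w2 w3 h1 h2 h3 => ?_⟩
  set ℓ : ℝ → Pt := fun r => (t, x1 + r * w1, x2 + r * w2, x3 + r * w3) with hℓ
  have hℓc : Continuous ℓ := by rw [hℓ]; fun_prop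
  have hd : ∀ g, Sm g → ∀ r, HasDerivAt (fun r => g (ℓ r))
      (w1 * dd 1 g (ℓ r) + w2 * dd 2 g (ℓ r) + w3 * dd 3 g (ℓ r)) r :=
    fun g hg r => line_deriv hg t x1 x2 x3 w1 w2 w3 r
  set g1 : ℝ → ℝ := fun r => w1 * dd 1 f (ℓ r) + w2 * dd 2 f (ℓ r) + w3 * dd 3 f (ℓ r) with hg1
  set g2 : ℝ → ℝ := fun r =>
    w1 * (w1 * dd 1 (dd 1 f) (ℓ r) + w2 * dd 2 (dd 1 f) (ℓ r) + w3 * dd 3 (dd 1 f) (ℓ r)) +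
    w2 * (w1 * dd 1 (dd 2 f) (ℓ r) + w2 * dd 2 (dd 2 f) (ℓ r) + w3 * dd 3 (dd 2 f) (ℓ r)) +
    w3 * (w1 * dd 1 (dd 3 f) (ℓ r) + w2 * dd 2 (dd 3 f) (ℓ r) + w3 * dd 3 (dd 3 f) (ℓ r)) with hg2
  have c1 := fun i => (hf.dd i).cont
  have c2 := fun i j => ((hf.dd j).dd i).cont
  have hg2c : Continuous g2 := by rw [hg2]; fun_prop
  have hg1c : Continuous g1 := by rw [hg1]; fun_prop
  have h := hC (fun r => f (ℓ r)) g1 g2 (fun r => hd f hf r) (fun r => by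
    have := (((hd _ (hf.dd 1) r).const_mul w1).add ((hd _ (hf.dd 2) r).const_mul w2)).add
      ((hd _ (hf.dd 3) r).const_mul w3)
    exact this) hg2c
  have h0 : ℓ 0 = (t, x1, x2, x3) := by simp [hℓ]
  simp only [h0] at h
  refine h.trans ?_
  rw [mul_comm 9 C, mul_assoc]
  apply mul_le_mul_of_nonneg_left _ hC0
  rw [← intervalIntegral.integral_const_mul]
  have fc := hf.cont
  have gc := GG_cont hf
  apply intervalIntegral.integral_mono_on hδ.le
  · exact Continuous.intervalIntegrable (by fun_prop) _ _
  · exact Continuous.intervalIntegrable (by fun_prop) _ _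
  intro r hr
  have e1 : g1 r ^ 2 ≤ 3 * (dd 1 f (ℓ r) ^ 2 + dd 2 f (ℓ r) ^ 2 + dd 3 f (ℓ r) ^ 2) :=
    three_sq h1 h2 h3
  have e2 := three_sq (a1 := w1 * dd 1 (dd 1 f) (ℓ r) + w2 * dd 2 (dd 1 f) (ℓ r) + w3 * dd 3 (dd 1 f) (ℓ r))
    (a2 := w1 * dd 1 (dd 2 f) (ℓ r) + w2 * dd 2 (dd 2 f) (ℓ r) + w3 * dd 3 (dd 2 f) (ℓ r))
    (a3 := w1 * dd 1 (dd 3 f) (ℓ r) + w2 * dd 2 (dd 3 f) (ℓ r) + w3 * dd 3 (dd 3 f) (ℓ r)) h1 h2 h3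
  have e3 := fun j => three_sq (a1 := dd 1 (dd j f) (ℓ r)) (a2 := dd 2 (dd j f) (ℓ r))
    (a3 := dd 3 (dd j f) (ℓ r)) h1 h2 h3
  have e4 : g2 r ^ 2 ≤ 9 * ∑ i : Fin 3, ∑ j : Fin 3, dd i.succ (dd j.succ f) (ℓ r) ^ 2 := by
    simp only [Fin.sum_univ_three]
    have a := e3 1
    have b := e3 2
    have c := e3 3
    change _ ≤ 9 * ((dd 1 (dd 1 f) (ℓ r) ^ 2 + dd 1 (dd 2 f) (ℓ r) ^ 2 + dd 1 (dd 3 f) (ℓ r) ^ 2) +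
      (dd 2 (dd 1 f) (ℓ r) ^ 2 + dd 2 (dd 2 f) (ℓ r) ^ 2 + dd 2 (dd 3 f) (ℓ r) ^ 2) +
      (dd 3 (dd 1 f) (ℓ r) ^ 2 + dd 3 (dd 2 f) (ℓ r) ^ 2 + dd 3 (dd 3 f) (ℓ r) ^ 2))
    linarith
  have e5 : ∑ i : Fin 3, dd i.succ f (ℓ r) ^ 2 =
      dd 1 f (ℓ r) ^ 2 + dd 2 f (ℓ r) ^ 2 + dd 3 f (ℓ r) ^ 2 := by
    rw [Fin.sum_univ_three]; rfl
  have e6 : GG f (ℓ r) = f (ℓ r) ^ 2 + ∑ i : Fin 3, dd i.succ f (ℓ r) ^ 2 +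
    ∑ i : Fin 3, ∑ j : Fin 3, dd i.succ (dd j.succ f) (ℓ r) ^ 2 := rfl
  have e7 : f (ℓ r) ^ 2 + g1 r ^ 2 + g2 r ^ 2 ≤ 9 * GG f (ℓ r) := by
    rw [e6, e5]
    nlinarith [sq_nonneg (f (ℓ r)), sq_nonneg (dd 1 f (ℓ r)), sq_nonneg (dd 2 f (ℓ r)),
      sq_nonneg (dd 3 f (ℓ r))]
  calc _ ≤ r ^ 2 * (9 * GG f (ℓ r)) := mul_le_mul_of_nonneg_left e7 (sq_nonneg _)
    _ = _ := by ring

lemma sobA {b : ℝ} (hb : 0 < b) : ∃ C, 0 ≤ C ∧ ∀ f, Sm f → ∀ t x1 x2 x3 : ℝ, x3 ∈ Icc (-b) 0 →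
    f (t, x1, x2, x3) ^ 2 ≤ C * IA b (GG f) t := by
  set δ : ℝ := min (b / 2) 1 with hδ
  have hδ0 : 0 < δ := lt_min (by linarith) one_pos
  have hδ1 : δ ≤ 1 := min_le_right _ _
  have hδb : δ ≤ b / 2 := min_le_left _ _
  obtain ⟨C, hC0, hC⟩ := sob_line hδ0
  refine ⟨C, hC0, fun f hf t x1 x2 x3 hx3 => ?_⟩
  have gc := GG_cont hf
  set H : ℝ → ℝ := fun z => ∫ y1 in (0:ℝ)..1, ∫ y2 in (0:ℝ)..1, GG f (t, y1, y2, z) with hH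
  have hHc : Continuous H := by
    apply cint
    apply cint (Y := ℝ × ℝ) (F := fun q w => GG f (t, q.2, w, q.1))
    unfold Function.uncurry; fun_prop
  have hH0 : ∀ z, 0 ≤ H z := fun z => intervalIntegral.integral_nonneg zero_le_one fun y1 _ =>
    intervalIntegral.integral_nonneg zero_le_one fun y2 _ => GG_nonneg _ _
  have hIA : IA b (GG f) t = ∫ z in (-b)..(0:ℝ), H z := by
    rw [IA_eq hb gc, hH]
    rw [swapc (F := fun z y1 => ∫ y2 in (0:ℝ)..1, GG f (t, y1, y2, z))]
    · congr 1; funext y1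
      rw [swapc (F := fun y2 z => GG f (t, y1, y2, z))]
      unfold Function.uncurry; fun_prop
    · apply cint (Y := ℝ × ℝ) (F := fun q w => GG f (t, q.2, w, q.1))
      unfold Function.uncurry; fun_prop
  -- slice bound
  have slice : ∀ r ∈ Icc (0:ℝ) 1, ∀ z, ∫ w1 in (0:ℝ)..1, ∫ w2 in (0:ℝ)..1,
      r ^ 2 * GG f (t, x1 + r * w1, x2 + r * w2, z) ≤ H z := by
    intro r hr z
    have h1 : ∀ y1, r * ∫ w2 in (0:ℝ)..1, GG f (t, y1, x2 + r * w2, z) ≤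
        ∫ y2 in (0:ℝ)..1, GG f (t, y1, y2, z) := fun y1 =>
      per_int (g := fun y2 => GG f (t, y1, y2, z)) (by fun_prop) (fun _ => GG_nonneg _ _)
        (fun y => (GG_per hf t y1 y z).2) x2 hr
    have h2 : r * ∫ w1 in (0:ℝ)..1, (∫ y2 in (0:ℝ)..1, GG f (t, x1 + r * w1, y2, z)) ≤ H z :=
      per_int (g := fun y1 => ∫ y2 in (0:ℝ)..1, GG f (t, y1, y2, z))
        (by apply cint; unfold Function.uncurry; fun_prop)
        (fun y1 => intervalIntegral.integral_nonneg zero_le_one fun y2 _ => GG_nonneg _ _)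
        (fun y => by simp only [fun y2 => (GG_per hf t y y2 z).1]) x1 hr
    refine le_trans ?_ h2
    rw [← intervalIntegral.integral_const_mul]
    apply intervalIntegral.integral_mono_on zero_le_one
    · apply Continuous.intervalIntegrable
      apply cint; unfold Function.uncurry; fun_prop
    · apply Continuous.intervalIntegrable
      apply Continuous.mul continuous_const
      apply cint; unfold Function.uncurry; fun_prop
    intro w1 _
    rw [intervalIntegral.integral_const_mul, pow_two, mul_assoc]
    exact mul_le_mul_of_nonneg_left (h1 _) hr.1
  -- main averaging
  have main : ∀ ε : ℝ, ε ^ 2 = 1 → f (t, x1, x2, x3) ^ 2 ≤ C * ∫ r in (0:ℝ)..δ, H (x3 + r * ε) := by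
    intro ε hε
    have h1 : ∫ w1 in (0:ℝ)..1, ∫ w2 in (0:ℝ)..1, f (t, x1, x2, x3) ^ 2 ≤
        ∫ w1 in (0:ℝ)..1, ∫ w2 in (0:ℝ)..1, C * ∫ r in (0:ℝ)..δ, r ^ 2 *
          GG f (t, x1 + r * w1, x2 + r * w2, x3 + r * ε) := by
      apply intervalIntegral.integral_mono_on zero_le_one
      · exact Continuous.intervalIntegrable (by fun_prop) _ _
      · apply Continuous.intervalIntegrable
        apply cint (Y := ℝ) (F := fun w1 w2 => C * ∫ r in (0:ℝ)..δ, r ^ 2 *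
          GG f (t, x1 + r * w1, x2 + r * w2, x3 + r * ε))
        apply Continuous.mul continuous_const
        apply cint (Y := ℝ × ℝ) (F := fun q r => r ^ 2 *
          GG f (t, x1 + r * q.1, x2 + r * q.2, x3 + r * ε))
        unfold Function.uncurry; fun_prop
      intro w1 hw1
      apply intervalIntegral.integral_mono_on zero_le_one
      · exact Continuous.intervalIntegrable (by fun_prop) _ _
      · apply Continuous.intervalIntegrable
        apply Continuous.mul continuous_const
        apply cint; unfold Function.uncurry; fun_prop
      intro w2 hw2
      exact hC f hf t x1 x2 x3 w1 w2 ε (by nlinarith [hw1.1, hw1.2]) (by nlinarith [hw2.1, hw2.2]) hε.le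
    simp only [intervalIntegral.integral_const, sub_zero, one_smul,
      intervalIntegral.integral_const_mul] at h1
    refine h1.trans (mul_le_mul_of_nonneg_left ?_ hC0)
    have h2 : ∫ w1 in (0:ℝ)..1, ∫ w2 in (0:ℝ)..1, ∫ r in (0:ℝ)..δ, r ^ 2 *
          GG f (t, x1 + r * w1, x2 + r * w2, x3 + r * ε) =
        ∫ r in (0:ℝ)..δ, ∫ w1 in (0:ℝ)..1, ∫ w2 in (0:ℝ)..1, r ^ 2 *
          GG f (t, x1 + r * w1, x2 + r * w2, x3 + r * ε) := by
      rw [swapc (F := fun r w1 => ∫ w2 in (0:ℝ)..1, r ^ 2 *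
          GG f (t, x1 + r * w1, x2 + r * w2, x3 + r * ε))]
      · congr 1; funext w1
        rw [swapc]
        unfold Function.uncurry; fun_prop
      · apply cint (Y := ℝ × ℝ) (F := fun q w2 => q.1 ^ 2 *
          GG f (t, x1 + q.1 * q.2, x2 + q.1 * w2, x3 + q.1 * ε))
        unfold Function.uncurry; fun_prop
    rw [h2]
    apply intervalIntegral.integral_mono_on hδ0.le
    · apply Continuous.intervalIntegrable
      apply cint (Y := ℝ) (F := fun r w1 => ∫ w2 in (0:ℝ)..1, r ^ 2 *
          GG f (t, x1 + r * w1, x2 + r * w2, x3 + r * ε))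
      apply cint (Y := ℝ × ℝ) (F := fun q w2 => q.1 ^ 2 *
          GG f (t, x1 + q.1 * q.2, x2 + q.1 * w2, x3 + q.1 * ε))
      unfold Function.uncurry; fun_prop
    · exact Continuous.intervalIntegrable (by fun_prop) _ _
    intro r hr
    exact slice r ⟨hr.1, hr.2.trans hδ1⟩ _
  rw [hIA]
  have mono : ∀ a c, -b ≤ a → a ≤ c → c ≤ 0 → ∫ z in a..c, H z ≤ ∫ z in (-b)..(0:ℝ), H z := by
    intro a c h1 h2 h3
    exact intervalIntegral.integral_mono_interval h1 h2 h3 (Eventually.of_forall hH0)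
      (hHc.intervalIntegrable _ _)
  by_cases hcase : x3 ≤ - (b / 2)
  · refine (main 1 (by norm_num)).trans (mul_le_mul_of_nonneg_left ?_ hC0)
    simp only [mul_one]
    rw [intervalIntegral.integral_comp_add_left (fun z => H z) x3]
    exact mono _ _ (by linarith [hx3.1]) (by linarith) (by linarith)
  · refine (main (-1) (by norm_num)).trans (mul_le_mul_of_nonneg_left ?_ hC0)
    push Not at hcase
    simp only [mul_neg, mul_one, ← sub_eq_add_neg]
    rw [intervalIntegral.integral_comp_sub_left (fun z => H z) x3]
    exact mono _ _ (by linarith) (by linarith) (by linarith [hx3.2])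

end EE

namespace EE
open scoped ContDiff
open MeasureTheory Set Filter Topology

variable {X : Ctx}

lemma ev_D (i : Fin 4) (f : Q X) {s : X.S} {p : Pt} (hp : p ∈ Box X s) :
    ev (D i f) s p = dd i ((rep f).1 s) p := by
  change ev (mk (DA i (rep f))) s p = _
  rw [ev_mk _ hp]; rfl

lemma ev_DD (i j : Fin 4) (f : Q X) {s : X.S} {p : Pt} (hp : p ∈ Box X s) :
    ev (D i (D j f)) s p = dd i (dd j ((rep f).1 s)) p := by
  change ev (D i (mk (DA j (rep f)))) s p = _
  rw [D_mk, ev_mk _ hp]; rfl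

/-- Sobolev embedding. -/
lemma Li_of_sob {f : Q X} (h0 : f ∈ L2) (h1 : ∀ i : Fin 3, D i.succ f ∈ L2)
    (h2 : ∀ i j : Fin 3, D i.succ (D j.succ f) ∈ L2) : f ∈ Li := by
  obtain ⟨C, hC0, hC⟩ := sobA X.hb
  set g : Q X := f * f + ∑ i : Fin 3, D i.succ f * D i.succ f +
    ∑ i : Fin 3, ∑ j : Fin 3, D i.succ (D j.succ f) * D i.succ (D j.succ f) with hg
  have hgLB : g ∈ LB := LB.add_mem (LB.add_mem h0 (LB.sum_mem fun i _ => h1 i))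
    (LB.sum_mem fun i _ => LB.sum_mem fun j _ => h2 i j)
  intro K
  obtain ⟨B, hB⟩ := hgLB K
  refine ⟨Real.sqrt (C * B), fun s t ht hE x hx => ?_⟩
  apply Real.abs_le_sqrt
  have h := hC ((rep f).1 s) ((rep f).2 s) t x.1 x.2.1 x.2.2 hx
  have e : IA X.b (GG ((rep f).1 s)) t = I g s t := by
    symm
    apply IA_congr ht
    intro p hp
    change ev g s p = _
    rw [hg]
    simp only [ev_add _ _ hp, ev_sum _ _ hp, ev_mul _ _ hp, ev_DD _ _ _ hp]
    simp only [ev_D _ _ hp, GG, pow_two]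
    rfl
  rw [e] at h
  exact h.trans (mul_le_mul_of_nonneg_left ((le_abs_self _).trans (hB s t ht hE)) hC0)

/-- Words of derivatives. -/
def Dw : List (Fin 4) → Q X →ₗ[ℝ] Q X
  | [] => LinearMap.id
  | i :: γ => (D i).comp (Dw γ)

@[simp] lemma Dw_nil (f : Q X) : Dw [] f = f := rfl
lemma Dw_cons (i : Fin 4) (γ : List (Fin 4)) (f : Q X) : Dw (i :: γ) f = D i (Dw γ f) := rfl
lemma Dw_D (γ : List (Fin 4)) (i : Fin 4) (f : Q X) : Dw γ (D i f) = D i (Dw γ f) := by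
  induction γ with
  | nil => rfl
  | cons j γ ih => rw [Dw_cons, ih, Dw_cons, D_comm]
lemma Dw_append (γ δ : List (Fin 4)) (f : Q X) : Dw (γ ++ δ) f = Dw γ (Dw δ f) := by
  induction γ with
  | nil => rfl
  | cons j γ ih => rw [List.cons_append, Dw_cons, ih, Dw_cons]
lemma Dw_perm {γ δ : List (Fin 4)} (h : γ.Perm δ) (f : Q X) : Dw γ f = Dw δ f := by
  induction h with
  | nil => rfl
  | cons i _ ih => rw [Dw_cons, Dw_cons, ih]
  | swap i j l => simp only [Dw_cons]; rw [D_comm]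
  | trans _ _ h1 h2 => rw [h1, h2]
lemma Dw_Dw (γ δ : List (Fin 4)) (f : Q X) : Dw γ (Dw δ f) = Dw δ (Dw γ f) := by
  rw [← Dw_append, ← Dw_append, Dw_perm List.perm_append_comm]

/-- Span of products of derivatives of total order `n`, each of order at least `m`. -/
def Sp (m n : ℕ) (f g : Q X) : Submodule ℝ (Q X) :=
  Submodule.span ℝ {h | ∃ a b : List (Fin 4), m ≤ a.length ∧ m ≤ b.length ∧
    a.length + b.length = n ∧ h = Dw a f * Dw b g}

lemma Sp_mem {m n : ℕ} {f g : Q X} (a b : List (Fin 4)) (ha : m ≤ a.length) (hb : m ≤ b.length)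
    (h : a.length + b.length = n) : Dw a f * Dw b g ∈ Sp m n f g :=
  Submodule.subset_span ⟨a, b, ha, hb, h, rfl⟩

lemma Sp_le {m n : ℕ} {f g : Q X} {S : Submodule ℝ (Q X)}
    (h : ∀ a b : List (Fin 4), m ≤ a.length → m ≤ b.length → a.length + b.length = n →
      Dw a f * Dw b g ∈ S) : Sp m n f g ≤ S := by
  apply Submodule.span_le.2
  rintro _ ⟨a, b, ha, hb, hn, rfl⟩
  exact h a b ha hb hn

lemma D_Sp {m n : ℕ} {f g h : Q X} (hh : h ∈ Sp m n f g) (i : Fin 4) : D i h ∈ Sp m (n+1) f g := by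
  have : Sp m n f g ≤ (Sp m (n+1) f g).comap (D i) := by
    apply Sp_le
    intro a b ha hb hn
    rw [Submodule.mem_comap, D_mul]
    refine Submodule.add_mem _ ?_ ?_
    · exact Sp_mem a (i :: b) ha (by simp; omega) (by simp; omega)
    · rw [mul_comm]; exact Sp_mem (i :: a) b (by simp; omega) hb (by simp; omega)
  exact this hh

lemma Dw_mul_mem (γ : List (Fin 4)) (f g : Q X) : Dw γ (f * g) ∈ Sp 0 γ.length f g := by
  induction γ with
  | nil => exact Sp_mem [] [] (by simp) (by simp) rfl
  | cons i γ ih => exact D_Sp ih i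

/-- Two-sided commutator. -/
def cm (γ : List (Fin 4)) (f g : Q X) : Q X := Dw γ (f * g) - f * Dw γ g - g * Dw γ f

lemma cm_eq (γ : List (Fin 4)) (f g : Q X) : Dw γ (f * g) = f * Dw γ g + g * Dw γ f + cm γ f g := by
  unfold cm; ring

lemma cm_cons (i : Fin 4) (γ : List (Fin 4)) (f g : Q X) :
    cm (i :: γ) f g = D i (cm γ f g) + D i f * Dw γ g + D i g * Dw γ f := by
  simp only [cm, Dw_cons, map_sub, D_mul]; ring

lemma cm_mem (i : Fin 4) (γ : List (Fin 4)) (f g : Q X) :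
    cm (i :: γ) f g ∈ Sp 1 (γ.length + 1) f g := by
  induction γ generalizing i with
  | nil =>
    have : cm [i] f g = 0 := by rw [cm_cons]; simp [cm, D_mul]; ring
    rw [this]; exact Submodule.zero_mem _
  | cons j γ ih =>
    rw [cm_cons]
    refine Submodule.add_mem _ (Submodule.add_mem _ (D_Sp (ih j) i) ?_) ?_
    · exact Sp_mem [i] (j :: γ) (by simp) (by simp) (by simp; omega)
    · rw [mul_comm]; exact Sp_mem (j :: γ) [i] (by simp) (by simp) (by simp)

lemma cm_mem' {γ : List (Fin 4)} {n : ℕ} (h : γ.length = n) (hn : 1 ≤ n) (f g : Q X) :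
    cm γ f g ∈ Sp 1 n f g := by
  cases γ with
  | nil => simp at h; omega
  | cons i γ => subst h; exact cm_mem i γ f g

/-- `D^γ f` is in `L²` for `|γ| ≤ k` and bounded for `|γ| ≤ l`. -/
def Cl (k l : ℕ) : Submodule ℝ (Q X) where
  carrier := {f | (∀ γ : List (Fin 4), γ.length ≤ k → Dw γ f ∈ L2) ∧
    ∀ γ : List (Fin 4), γ.length ≤ l → Dw γ f ∈ Li}
  add_mem' := fun {f g} hf hg => ⟨fun γ h => by rw [map_add]; exact L2.add_mem (hf.1 γ h) (hg.1 γ h),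
    fun γ h => by rw [map_add]; exact Li.add_mem (hf.2 γ h) (hg.2 γ h)⟩
  zero_mem' := ⟨fun γ h => by rw [map_zero]; exact L2.zero_mem,
    fun γ h => by rw [map_zero]; exact Li.zero_mem⟩
  smul_mem' := fun c f hf => ⟨fun γ h => by rw [map_smul]; exact L2.smul_mem _ (hf.1 γ h),
    fun γ h => by rw [map_smul]; exact Li.smul_mem (hf.2 γ h) _⟩

lemma Cl_mono {k l k' l' : ℕ} {f : Q X} (hf : f ∈ Cl k l) (hk : k' ≤ k) (hl : l' ≤ l) : f ∈ Cl k' l' :=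
  ⟨fun γ h => hf.1 γ (h.trans hk), fun γ h => hf.2 γ (h.trans hl)⟩

lemma Cl_D {k l : ℕ} {f : Q X} (hf : f ∈ Cl (k+1) (l+1)) (i : Fin 4) : D i f ∈ Cl k l :=
  ⟨fun γ h => by rw [Dw_D]; exact hf.1 (i :: γ) (by simp; omega),
   fun γ h => by rw [Dw_D]; exact hf.2 (i :: γ) (by simp; omega)⟩

lemma Cl_succ {k l : ℕ} {f : Q X} (h0 : f ∈ Li) (h : ∀ i, D i f ∈ Cl k l) : f ∈ Cl (k+1) (l+1) := by
  constructor
  · intro γ hγ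
    cases γ with
    | nil => exact Li_le h0
    | cons i γ => rw [Dw_cons, ← Dw_D]; exact (h i).1 γ (by simp at hγ; omega)
  · intro γ hγ
    cases γ with
    | nil => exact h0
    | cons i γ => rw [Dw_cons, ← Dw_D]; exact (h i).2 γ (by simp at hγ; omega)

lemma Cl_Li {k l : ℕ} {f : Q X} (h : f ∈ Cl k l) : f ∈ Li := h.2 [] (by simp)
lemma Cl_L2 {k l : ℕ} {f : Q X} (h : f ∈ Cl k l) : f ∈ L2 := h.1 [] (by simp)

lemma Cl_up {k l : ℕ} {f : Q X} (h0 : f ∈ Cl k l) (h : ∀ i, D i f ∈ Cl k l) : f ∈ Cl (k+1) l := by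
  constructor
  · intro γ hγ
    cases γ with
    | nil => exact Cl_L2 h0
    | cons i γ => rw [Dw_cons, ← Dw_D]; exact (h i).1 γ (by simp at hγ; omega)
  · exact h0.2

/-- The condition under which products of derivatives of total order `n` are in `L²`. -/
def Adm (m n k1 l1 k2 l2 : ℕ) : Prop := ∀ a b : ℕ, m ≤ a → m ≤ b → a + b = n →
  (a ≤ l1 ∧ b ≤ k2) ∨ (a ≤ k1 ∧ b ≤ l2)

lemma Sp_L2 {m n k1 l1 k2 l2 : ℕ} {f g : Q X} (hf : f ∈ Cl k1 l1) (hg : g ∈ Cl k2 l2)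
    (h : Adm m n k1 l1 k2 l2) : Sp m n f g ≤ L2 := by
  apply Sp_le
  intro a b ha hb hn
  rcases h _ _ ha hb hn with h | h
  · exact Li_L2 (hf.2 a h.1) (hg.1 b h.2)
  · exact L2_Li (hf.1 a h.1) (hg.2 b h.2)

lemma Sp_G {m n k1 l1 k2 l2 : ℕ} {f g : Q X} (hf : f ∈ Cl k1 l1) (hg : g ∈ Cl k2 l2)
    (h : Adm m n k1 l1 k2 l2) (h' : Adm m (n+1) k1 l1 k2 l2) : Sp m n f g ≤ L2w 0 :=
  fun _ hr => L2w_of (Sp_L2 hf hg h hr) (Sp_L2 hf hg h' (D_Sp hr 0))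

lemma Sp_Li {n l1 l2 k1 k2 : ℕ} {f g : Q X} (hf : f ∈ Cl k1 l1) (hg : g ∈ Cl k2 l2)
    (h1 : n ≤ l1) (h2 : n ≤ l2) : Sp 0 n f g ≤ Li.toSubmodule := by
  apply Sp_le
  intro a b ha hb hn
  exact Li.mul_mem (hf.2 a (by omega)) (hg.2 b (by omega))

lemma Cl_mul' {k l k1 l1 k2 l2 : ℕ} {f g : Q X} (hf : f ∈ Cl k1 l1) (hg : g ∈ Cl k2 l2)
    (h1 : l ≤ l1) (h2 : l ≤ l2) (h : ∀ n ≤ k, Adm 0 n k1 l1 k2 l2) : f * g ∈ Cl k l :=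
  ⟨fun γ hγ => Sp_L2 hf hg (h _ hγ) (Dw_mul_mem γ f g),
   fun γ hγ => Sp_Li hf hg (hγ.trans h1) (hγ.trans h2) (Dw_mul_mem γ f g)⟩

lemma Cl_mul {k l : ℕ} (hkl : k ≤ 2 * l + 1) {f g : Q X} (hf : f ∈ Cl k l) (hg : g ∈ Cl k l) :
    f * g ∈ Cl k l :=
  Cl_mul' hf hg le_rfl le_rfl (fun n hn a b _ _ h => by omega)

/-- All derivatives bounded. -/
lemma Cl_of_Li {k l : ℕ} {f : Q X} (h : ∀ γ, Dw γ f ∈ Li) : f ∈ Cl k l :=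
  ⟨fun γ _ => Li_le (h γ), fun γ _ => h γ⟩

lemma Dw_cst {γ : List (Fin 4)} (hγ : 1 ≤ γ.length) (c : X.S → ℝ) : Dw γ (cst c) = 0 := by
  cases γ with
  | nil => simp at hγ
  | cons i γ => rw [Dw_cons, ← Dw_D, D_cst, map_zero]

lemma Cl_cst {k l : ℕ} {c : X.S → ℝ} {C : ℝ} (h : ∀ s, |c s| ≤ C) : cst c ∈ Cl k l := by
  apply Cl_of_Li
  intro γ
  cases γ with
  | nil => exact cst_Li h
  | cons i γ => rw [Dw_cst (by simp)]; exact Li.zero_mem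

lemma cst_one : cst (fun _ => 1) = (1 : Q X) := by
  apply Q_ext; intro s p hp; rw [ev_cst _ hp, ev_one hp]

lemma Cl_one {k l : ℕ} : (1 : Q X) ∈ Cl k l := by
  rw [← cst_one]; exact Cl_cst (C := 1) (fun _ => by simp)

lemma cst_mul_cst (c d : X.S → ℝ) : (cst c * cst d : Q X) = cst (fun s => c s * d s) := by
  apply Q_ext; intro s p hp; rw [ev_mul _ _ hp, ev_cst _ hp, ev_cst _ hp, ev_cst _ hp]

lemma Dw_cst_mul (γ : List (Fin 4)) (c : X.S → ℝ) (f : Q X) : Dw γ (cst c * f) = cst c * Dw γ f := by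
  induction γ with
  | nil => rfl
  | cons i γ ih => rw [Dw_cons, ih, D_mul, D_cst, Dw_cons]; ring

lemma D_cst_mul (i : Fin 4) (c : X.S → ℝ) (f : Q X) : D i (cst c * f) = cst c * D i f := by
  rw [D_mul, D_cst]; ring

/-- From `L²` bounds to class `(k+2,k)`. -/
lemma Cl_of_L2 {k : ℕ} {f : Q X} (h : ∀ γ : List (Fin 4), γ.length ≤ k + 2 → Dw γ f ∈ L2) :
    f ∈ Cl (k+2) k := by
  refine ⟨h, fun γ hγ => ?_⟩
  refine Li_of_sob (h γ (by omega)) (fun i => h (i.succ :: γ) (by simp; omega))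
    (fun i j => h (i.succ :: j.succ :: γ) (by simp; omega))

lemma Cl_G {k l : ℕ} {f : Q X} (hf : f ∈ Cl (k+1) l) (γ : List (Fin 4)) (hγ : γ.length ≤ k) :
    Dw γ f ∈ L2w 0 :=
  L2w_of (hf.1 γ (by omega)) (hf.1 (0 :: γ) (by simp; omega))

lemma Cl_GLi {k l : ℕ} {f : Q X} (hf : f ∈ Cl k (l+1)) (γ : List (Fin 4)) (hγ : γ.length ≤ l) :
    Dw γ f ∈ GLi :=
  GLi_of (hf.2 γ (by omega)) (hf.2 (0 :: γ) (by simp; omega))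

/-- The vertical coordinate. -/
def x3 : Q X := mk ⟨fun _ p => p.2.2.2, fun _ => ⟨by fun_prop, fun _ => by simp [ee], fun _ => by simp [ee]⟩⟩

lemma ev_x3 {s : X.S} {p : Pt} (hp : p ∈ Box X s) : ev x3 s p = p.2.2.2 := ev_mk _ hp

lemma dd_x3 (i : Fin 4) (p : Pt) : dd i (fun p : Pt => p.2.2.2) p = (ee i).2.2.2 := by
  have h : HasFDerivAt (fun p : Pt => p.2.2.2)
      ((ContinuousLinearMap.snd ℝ ℝ ℝ).comp ((ContinuousLinearMap.snd ℝ ℝ (ℝ × ℝ)).comp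
        (ContinuousLinearMap.snd ℝ ℝ (ℝ × ℝ × ℝ)))) p :=
    ((ContinuousLinearMap.snd ℝ ℝ ℝ).comp ((ContinuousLinearMap.snd ℝ ℝ (ℝ × ℝ)).comp
        (ContinuousLinearMap.snd ℝ ℝ (ℝ × ℝ × ℝ)))).hasFDerivAt
  rw [dd, h.fderiv]; rfl

lemma D3_x3 : D 3 (x3 : Q X) = 1 := by
  rw [x3, D_mk]
  change mk _ = mk 1
  congr 1; ext s p
  exact dd_x3 3 p

lemma D_x3 (i : Fin 4) (hi : i ≠ 3) : D i (x3 : Q X) = 0 := by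
  rw [x3, D_mk]
  change mk _ = mk 0
  congr 1; ext s p
  refine (dd_x3 i p).trans ?_
  fin_cases i <;> simp_all [ee]

lemma x3_Li : (x3 : Q X) ∈ Li := fun _ => ⟨X.b, fun s t ht _ x hx => by
  rw [ev_x3 (ev_box ht hx), abs_le]; exact ⟨hx.1, hx.2.trans X.hb.le⟩⟩

lemma ev_tr (f : Q X) {s : X.S} {p : Pt} (hp : p ∈ Box X s) :
    ev (tr f) s p = ev f s (p.1, p.2.1, p.2.2.1, 0) := ev_trc 0 _ f hp
lemma ev_trb (f : Q X) {s : X.S} {p : Pt} (hp : p ∈ Box X s) :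
    ev (trb f) s p = ev f s (p.1, p.2.1, p.2.2.1, -X.b) := ev_trc (-X.b) _ f hp

lemma box_tr {s : X.S} {p : Pt} (hp : p ∈ Box X s) : (p.1, p.2.1, p.2.2.1, (0:ℝ)) ∈ Box X s :=
  ⟨hp.1, by simp [X.hb.le]⟩
lemma box_trb {s : X.S} {p : Pt} (hp : p ∈ Box X s) : (p.1, p.2.1, p.2.2.1, -X.b) ∈ Box X s :=
  ⟨hp.1, by simp [X.hb.le]⟩

lemma tr_x3 : tr (x3 : Q X) = 0 := by
  apply Q_ext; intro s p hp
  rw [ev_tr _ hp, ev_x3 (box_tr hp), ev_zero hp]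

lemma trb_x3 : trb (x3 : Q X) = -bb := by
  apply Q_ext; intro s p hp
  rw [ev_trb _ hp, ev_x3 (box_trb hp), ev_neg _ hp, bb, ev_cst _ hp]

lemma tr_cst (c : X.S → ℝ) : tr (cst c) = cst c := by
  apply Q_ext; intro s p hp
  rw [ev_tr _ hp, ev_cst _ hp, ev_cst _ (box_tr hp)]
lemma trb_cst (c : X.S → ℝ) : trb (cst c) = cst c := by
  apply Q_ext; intro s p hp
  rw [ev_trb _ hp, ev_cst _ hp, ev_cst _ (box_trb hp)]

lemma D0_tr (f : Q X) : D 0 (tr f) = tr (D 0 f) := (D_trc _ _ f).1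
lemma D1_tr (f : Q X) : D 1 (tr f) = tr (D 1 f) := (D_trc _ _ f).2.1
lemma D2_tr (f : Q X) : D 2 (tr f) = tr (D 2 f) := (D_trc _ _ f).2.2.1
lemma D3_tr (f : Q X) : D 3 (tr f) = 0 := (D_trc _ _ f).2.2.2
lemma D_tr (i : Fin 4) (hi : i ≠ 3) (f : Q X) : D i (tr f) = tr (D i f) := by
  fin_cases i
  · exact D0_tr f
  · exact D1_tr f
  · exact D2_tr f
  · exact absurd rfl hi
lemma D_trb (i : Fin 4) (hi : i ≠ 3) (f : Q X) : D i (trb f) = trb (D i f) := by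
  fin_cases i
  · exact (D_trc _ _ f).1
  · exact (D_trc _ _ f).2.1
  · exact (D_trc _ _ f).2.2.1
  · exact absurd rfl hi
lemma Dw_tr {γ : List (Fin 4)} (hγ : 3 ∉ γ) (f : Q X) : Dw γ (tr f) = tr (Dw γ f) := by
  induction γ with
  | nil => rfl
  | cons i γ ih =>
    simp only [List.mem_cons, not_or] at hγ
    rw [Dw_cons, ih hγ.2, D_tr i (Ne.symm hγ.1), Dw_cons]
lemma Dw_trb {γ : List (Fin 4)} (hγ : 3 ∉ γ) (f : Q X) : Dw γ (trb f) = trb (Dw γ f) := by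
  induction γ with
  | nil => rfl
  | cons i γ ih =>
    simp only [List.mem_cons, not_or] at hγ
    rw [Dw_cons, ih hγ.2, D_trb i (Ne.symm hγ.1), Dw_cons]

lemma tr_Li {f : Q X} (hf : f ∈ Li) : tr f ∈ Li := by
  intro K
  obtain ⟨C, hC⟩ := hf K
  refine ⟨C, fun s t ht hE x hx => ?_⟩
  rw [ev_tr _ (ev_box ht hx)]
  exact hC s t ht hE (x.1, x.2.1, 0) ⟨by simp [X.hb.le], le_rfl⟩

lemma tr_GLi {f : Q X} (hf : f ∈ GLi) : tr f ∈ GLi := by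
  obtain ⟨C, hC⟩ := hf
  refine ⟨C, fun K => ?_⟩
  obtain ⟨τ, hτ, h⟩ := hC K
  refine ⟨τ, hτ, fun s hs t ht x hx => ?_⟩
  rw [ev_tr _ (ev_box ht hx)]
  exact h s hs t ht (x.1, x.2.1, 0) ⟨by simp [X.hb.le], le_rfl⟩

lemma tr_tr (f : Q X) : tr (tr f) = tr f := by
  apply Q_ext; intro s p hp
  have hp' : (p.1, p.2.1, p.2.2.1, (0:ℝ)) ∈ Box X s := ⟨hp.1, by simp [X.hb.le]⟩
  rw [ev_tr _ hp, ev_tr _ hp', ev_tr _ hp]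

lemma cancel_LB {f : Q X} (h : bb * f ∈ LB) : f ∈ LB := by
  intro K
  obtain ⟨C, hC⟩ := h K
  refine ⟨X.b⁻¹ * C, fun s t ht hE => ?_⟩
  have := hC s t ht hE
  rw [bb, I_cmul _ _ ht, abs_mul, abs_of_pos X.hb] at this
  rw [inv_mul_eq_div, le_div_iff₀ X.hb]; linarith

/-- Traces in `L²`. -/
lemma tr_L2 {f : Q X} (hf : f ∈ L2) (h3 : D 3 f ∈ L2) : tr f ∈ L2 := by
  rw [mem_L2]
  apply cancel_LB
  have h := D3_Null ((x3 + bb) * f * f)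
  have e1 : tr ((x3 + bb) * f * f) = bb * (tr f * tr f) := by
    rw [map_mul, map_mul, map_add, tr_x3, bb, tr_cst]; ring
  have e2 : trb ((x3 + bb) * f * f) = 0 := by
    rw [map_mul, map_mul, map_add, trb_x3, bb, trb_cst]; ring
  have e3 : D 3 ((x3 + bb) * f * f) = f * f + (x3 + bb) * f * D 3 f + (x3 + bb) * f * D 3 f := by
    rw [D_mul, D_mul, map_add, D3_x3, bb, D_cst]; ring
  rw [e1, e2, e3] at h
  have hx : x3 + bb ∈ (Li : Subalgebra ℝ (Q X)) := Li.add_mem x3_Li bb_Li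
  have hm := mul_LB (Li_L2 hx hf) h3
  have hb2 := mul_cst_LB (c := fun _ => X.b) (fun _ => (abs_of_pos X.hb).le)
    (LB.add_mem (LB.add_mem hf hm) hm)
  have := LB.sub_mem hb2 (Null_LB h)
  convert this using 1
  unfold bb; ring

end EE

namespace EE
open scoped ContDiff
open MeasureTheory Set Filter Topology

variable {X : Ctx}

/-- First-order operator with coefficients `a`. -/
def Op (a : Fin 4 → Q X) (f : Q X) : Q X := a 0 * D 0 f + a 1 * D 1 f + a 2 * D 2 f + a 3 * D 3 f

/-- `1 - Δ`. -/
def Lp (f : Q X) : Q X := f - D 1 (D 1 f) - D 2 (D 2 f)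

/-- The fields of the problem. -/
structure Pre (X : Ctx) where
  v : Fin 3 → Q X
  F : Fin 3 → Fin 3 → Q X
  q : Q X
  psi : Q X
  chi : Q X
  iJ : Q X
  nn : Q X
  σ : ℝ
  κ : X.S → ℝ

namespace Pre
variable (Y : Pre X)
/-- The flattening map. -/
def phi : Q X := x3 + Y.chi * Y.psi
/-- Its Jacobian. -/
def J : Q X := D 3 Y.phi
/-- The material transport field. -/
def Xv : Fin 4 → Q X := ![Y.J, Y.J * Y.v 0, Y.J * Y.v 1,
  Y.v 2 - Y.v 0 * D 1 Y.phi - Y.v 1 * D 2 Y.phi - D 0 Y.phi]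
/-- The transport fields of the deformation columns. -/
def Xk (k : Fin 3) : Fin 4 → Q X := ![0, Y.J * Y.F k 0, Y.J * Y.F k 1,
  Y.F k 2 - Y.F k 0 * D 1 Y.phi - Y.F k 1 * D 2 Y.phi]
/-- The cofactor rows. -/
def Bm : Fin 3 → Fin 4 → Q X := ![![0, Y.J, 0, - D 1 Y.phi], ![0, 0, Y.J, - D 2 Y.phi], ![0, 0, 0, 1]]
/-- Constants. -/
def sg : Q X := cst (fun _ => Y.σ)
/-- The square root of the regularization parameter. -/
def sk : Q X := cst (fun s => Real.sqrt (Y.κ s))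
end Pre

/-- The system satisfied by the fields. -/
structure Sys (X : Ctx) extends Pre X where
  hσ : 0 < σ
  hκ : ∀ s, κ s ∈ Ioc (0:ℝ) 1
  D_chi : ∀ i, i ≠ 3 → D i chi = 0
  chi_Li : ∀ γ, Dw γ chi ∈ Li
  tr_chi : tr chi = 1
  trb_chi : ∀ γ, trb (Dw γ chi) = 0
  D3_psi : D 3 psi = 0
  tr_psi : tr psi = psi
  iJ_J : iJ * toPre.J = 1
  iJ_Li : iJ ∈ Li
  J_pos : ∀ s, ∀ p ∈ Box X s, 1 / 2 ≤ ev toPre.J s p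
  nn_eq : nn * nn * (1 + D 1 psi * D 1 psi + D 2 psi * D 2 psi) = 1
  nn_pos : ∀ s, ∀ p ∈ Box X s, 0 < ev nn s p ∧ ev nn s p ≤ 1
  mom : ∀ i, Op toPre.Xv (v i) + Op (toPre.Bm i) q =
    Op (toPre.Xk 0) (F 0 i) + Op (toPre.Xk 1) (F 1 i) + Op (toPre.Xk 2) (F 2 i)
  trans : ∀ k i, Op toPre.Xv (F k i) = Op (toPre.Xk k) (v i)
  divv : Op (toPre.Bm 0) (v 0) + Op (toPre.Bm 1) (v 1) + Op (toPre.Bm 2) (v 2) = 0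
  divF : ∀ k, Op (toPre.Bm 0) (F k 0) + Op (toPre.Bm 1) (F k 1) + Op (toPre.Bm 2) (F k 2) = 0
  kin : D 0 psi = tr (v 2) - tr (v 0) * D 1 psi - tr (v 1) * D 2 psi
  tang : ∀ k, tr (F k 2) - tr (F k 0) * D 1 psi - tr (F k 1) * D 2 psi = 0
  botv : trb (v 2) = 0
  botF : ∀ k, trb (F k 2) = 0
  press : tr q = - toPre.sg * (D 1 (nn * D 1 psi) + D 2 (nn * D 2 psi)) +
    toPre.sk * toPre.sk * Lp (Lp psi) + toPre.sk * toPre.sk * Lp (D 0 psi)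
  Ev : ∀ i γ, γ.length ≤ 4 → ∀ s, ∀ t ∈ Tm s, I (Dw γ (v i) * Dw γ (v i)) s t ≤ X.E s t
  EF : ∀ k i γ, γ.length ≤ 4 → ∀ s, ∀ t ∈ Tm s, I (Dw γ (F k i) * Dw γ (F k i)) s t ≤ X.E s t
  Es : ∀ γ : List (Fin 4), 3 ∉ γ → γ.length ≤ 5 → γ.count 0 ≤ 4 → ∀ s, ∀ t ∈ Tm s,
    σ * I (Dw γ psi * Dw γ psi) s t ≤ X.b * X.E s t
  Ek : ∀ γ : List (Fin 4), 3 ∉ γ → γ.length ≤ 6 → γ.count 0 ≤ 4 → ∀ s, ∀ t ∈ Tm s,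
    κ s * I (Dw γ psi * Dw γ psi) s t ≤ X.b * X.E s t
  Ec : ∃ Ce, 0 ≤ Ce ∧ ∀ s, ∀ t ∈ Tm s, ∀ B : ℝ,
    (∀ i γ, γ.length ≤ 4 → I (Dw γ (v i) * Dw γ (v i)) s t ≤ B) →
    (∀ k i γ, γ.length ≤ 4 → I (Dw γ (F k i) * Dw γ (F k i)) s t ≤ B) →
    (∀ γ : List (Fin 4), 3 ∉ γ → γ.length ≤ 5 → γ.count 0 ≤ 4 →
      σ * I (Dw γ psi * Dw γ psi) s t ≤ B) →
    (∀ γ : List (Fin 4), 3 ∉ γ → γ.length ≤ 6 → γ.count 0 ≤ 4 →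
      κ s * I (Dw γ psi * Dw γ psi) s t ≤ B) →
    (∀ γ : List (Fin 4), 3 ∉ γ → γ.length ≤ 6 → γ.count 0 ≤ 5 → 1 ≤ γ.count 0 →
      κ s * ∫ r in (0:ℝ)..t, I (Dw γ psi * Dw γ psi) s r ≤ B) → X.E s t ≤ Ce * B

lemma L2_of_le {f : Q X} {C : ℝ} (h : ∀ s, ∀ t ∈ Tm s, I (f * f) s t ≤ C * X.E s t) (hC : 0 ≤ C) : f ∈ L2 := by
  intro K
  refine ⟨C * K, fun s t ht hE => ?_⟩
  rw [abs_of_nonneg (I_sq_nonneg f ht)]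
  exact (h s t ht).trans (mul_le_mul_of_nonneg_left hE hC)

lemma wt_sq {s : X.S} {t : ℝ} (ht : t ∈ Tm s) : wt s t ^ 2 = 1 + X.E s t :=
  Real.sq_sqrt (by linarith [X.hE s t ht])

lemma L2E_of_le {f : Q X} {C : ℝ} (h : ∀ s, ∀ t ∈ Tm s, I (f * f) s t ≤ C * X.E s t) (hC : 0 ≤ C) :
    f ∈ L2w 2 := by
  refine ⟨C, fun K => ⟨1, one_pos, fun s _ t ht => ?_⟩⟩
  rw [abs_of_nonneg (I_sq_nonneg f ht), wt_sq ht]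
  linarith [h s t ht]

namespace Sys
variable (Y : Sys X)

lemma v_L2E (i : Fin 3) (γ : List (Fin 4)) (h : γ.length ≤ 4) : Dw γ (Y.v i) ∈ L2w 2 :=
  L2E_of_le (C := 1) (fun s t ht => by rw [one_mul]; exact Y.Ev i γ h s t ht) zero_le_one
lemma F_L2E (k i : Fin 3) (γ : List (Fin 4)) (h : γ.length ≤ 4) : Dw γ (Y.F k i) ∈ L2w 2 :=
  L2E_of_le (C := 1) (fun s t ht => by rw [one_mul]; exact Y.EF k i γ h s t ht) zero_le_one
lemma v_Cl (i : Fin 3) : Y.v i ∈ Cl 4 2 := Cl_of_L2 fun γ h =>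
  L2_of_le (C := 1) (fun s t ht => by rw [one_mul]; exact Y.Ev i γ h s t ht) zero_le_one
lemma F_Cl (k i : Fin 3) : Y.F k i ∈ Cl 4 2 := Cl_of_L2 fun γ h =>
  L2_of_le (C := 1) (fun s t ht => by rw [one_mul]; exact Y.EF k i γ h s t ht) zero_le_one

lemma psi_le (γ : List (Fin 4)) (h3 : 3 ∉ γ) (h : γ.length ≤ 5) (h0 : γ.count 0 ≤ 4) :
    ∀ s, ∀ t ∈ Tm s, I (Dw γ Y.psi * Dw γ Y.psi) s t ≤ (X.b / Y.σ) * X.E s t := fun s t ht => by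
  have := Y.Es γ h3 h h0 s t ht
  rw [div_mul_eq_mul_div, le_div_iff₀ Y.hσ]; linarith

lemma Dw3_psi {γ : List (Fin 4)} (h3 : 3 ∈ γ) : Dw γ Y.psi = 0 := by
  rw [Dw_perm (List.perm_cons_erase h3), Dw_cons, ← Dw_D, Y.D3_psi, map_zero]

lemma psi_L2 (γ : List (Fin 4)) (h : γ.length ≤ 5) (h0 : γ.count 0 ≤ 4) : Dw γ Y.psi ∈ L2 := by
  by_cases h3 : 3 ∈ γ
  · rw [Y.Dw3_psi h3]; exact L2.zero_mem
  · exact L2_of_le (Y.psi_le γ h3 h h0) (div_nonneg X.hb.le Y.hσ.le)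

lemma psi_L2E (γ : List (Fin 4)) (h : γ.length ≤ 5) (h0 : γ.count 0 ≤ 4) : Dw γ Y.psi ∈ L2w 2 := by
  by_cases h3 : 3 ∈ γ
  · rw [Y.Dw3_psi h3]; exact (L2w 2).zero_mem
  · exact L2E_of_le (Y.psi_le γ h3 h h0) (div_nonneg X.hb.le Y.hσ.le)

lemma sk_sq : Y.sk * Y.sk = cst Y.κ := by
  rw [Pre.sk, cst_mul_cst]
  congr 1; funext s; exact Real.mul_self_sqrt (Y.hκ s).1.le

lemma skpsi_L2 (γ : List (Fin 4)) (h : γ.length ≤ 6) (h0 : γ.count 0 ≤ 4) :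
    Y.sk * Dw γ Y.psi ∈ L2 := by
  by_cases h3 : 3 ∈ γ
  · rw [Y.Dw3_psi h3, mul_zero]; exact L2.zero_mem
  · refine L2_of_le (C := X.b) (fun s t ht => ?_) X.hb.le
    have e : Y.sk * Dw γ Y.psi * (Y.sk * Dw γ Y.psi) = cst Y.κ * (Dw γ Y.psi * Dw γ Y.psi) := by
      rw [← Y.sk_sq]; ring
    rw [e, I_cmul _ _ ht]
    exact Y.Ek γ h3 h h0 s t ht

lemma psi_Li (γ : List (Fin 4)) (h : γ.length ≤ 3) : Dw γ Y.psi ∈ Li := by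
  have hc := List.count_le_length (a := (0 : Fin 4)) (l := γ)
  refine Li_of_sob (Y.psi_L2 γ (by omega) (by omega))
    (fun i => Y.psi_L2 (i.succ :: γ) (by simp; omega) ?_)
    (fun i j => Y.psi_L2 (i.succ :: j.succ :: γ) (by simp; omega) ?_)
  · rw [List.count_cons_of_ne (Fin.succ_ne_zero i)]; omega
  · rw [List.count_cons_of_ne (Fin.succ_ne_zero i), List.count_cons_of_ne (Fin.succ_ne_zero j)]; omega

lemma psi_Cl : Y.psi ∈ Cl 4 3 :=
  ⟨fun γ h => Y.psi_L2 γ (by omega) ((List.count_le_length).trans (by omega)), fun γ h => Y.psi_Li γ h⟩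

lemma p_Cl (i : Fin 4) (hi : i ≠ 0) : D i Y.psi ∈ Cl 4 2 :=
  ⟨fun γ h => by
    rw [Dw_D]
    refine Y.psi_L2 (i :: γ) (by simp; omega) ?_
    rw [List.count_cons_of_ne hi]
    exact (List.count_le_length).trans (by omega),
   fun γ h => by rw [Dw_D]; exact Y.psi_Li (i :: γ) (by simp; omega)⟩

lemma chi_Cl {k l : ℕ} (γ : List (Fin 4)) : Dw γ Y.chi ∈ Cl k l :=
  Cl_of_Li fun δ => by rw [← Dw_append]; exact Y.chi_Li _

lemma D_phi (i : Fin 4) (hi : i ≠ 3) : D i Y.phi = Y.chi * D i Y.psi := by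
  rw [Pre.phi, map_add, D_x3 i hi, D_mul, Y.D_chi i hi]; ring

lemma D3_phi : D 3 Y.phi = 1 + D 3 Y.chi * Y.psi := by
  rw [Pre.phi, map_add, D3_x3, D_mul, Y.D3_psi]; ring

lemma J_eq : Y.J = 1 + D 3 Y.chi * Y.psi := Y.D3_phi

lemma J_Cl : Y.J ∈ Cl 4 2 := by
  rw [J_eq]
  exact (Cl 4 2).add_mem Cl_one (Cl_mul (by norm_num) (Y.chi_Cl [3]) (Cl_mono Y.psi_Cl le_rfl (by norm_num)))

lemma phi_Cl (i : Fin 4) (hi : i ≠ 0) : D i Y.phi ∈ Cl 4 2 := by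
  by_cases h3 : i = 3
  · subst h3; exact Y.J_Cl
  · rw [Y.D_phi i h3]; exact Cl_mul (by norm_num) (Y.chi_Cl []) (Y.p_Cl i hi)

lemma phit_Cl : D 0 Y.phi ∈ Cl 3 2 := by
  rw [Y.D_phi 0 (by decide)]; exact Cl_mul (by norm_num) (Y.chi_Cl []) (Cl_D Y.psi_Cl 0)

lemma phitj_Cl (i : Fin 4) (hi : i ≠ 0) : D i (D 0 Y.phi) ∈ Cl 3 1 := by
  rw [D_comm]; exact Cl_D (Y.phi_Cl i hi) 0

lemma D_iJ (i : Fin 4) : D i Y.iJ = -(Y.iJ * Y.iJ * D i Y.J) := by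
  have h := congrArg (D i) Y.iJ_J
  rw [D_mul, D_one] at h
  have e := Y.iJ_J
  linear_combination Y.iJ * h - D i Y.iJ * e

lemma iJ_Cl : Y.iJ ∈ Cl 4 2 := by
  have hJ : ∀ i, D i Y.J ∈ Cl 3 1 := fun i => Cl_D Y.J_Cl i
  have step : ∀ k l, k ≤ 3 → l ≤ 1 → k ≤ 2 * l + 1 → Y.iJ ∈ Cl k l → Y.iJ ∈ Cl (k+1) (l+1) := by
    intro k l hk hl hkl h
    refine Cl_succ Y.iJ_Li fun i => ?_
    rw [Y.D_iJ]
    exact (Cl k l).neg_mem (Cl_mul hkl (Cl_mul hkl h h) (Cl_mono (hJ i) hk hl))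
  have h0 : Y.iJ ∈ Cl 0 0 := ⟨fun γ h => by
      rw [List.length_eq_zero_iff.1 (Nat.le_zero.1 h)]; exact Li_le Y.iJ_Li, fun γ h => by
      rw [List.length_eq_zero_iff.1 (Nat.le_zero.1 h)]; exact Y.iJ_Li⟩
  have h1 := step 0 0 (by norm_num) (by norm_num) (by norm_num) h0
  have h2 := step 1 1 (by norm_num) (by norm_num) (by norm_num) h1
  have h3 := step 2 1 (by norm_num) (by norm_num) (by norm_num) (Cl_mono h2 (by norm_num) (by norm_num))
  exact step 3 1 (by norm_num) (by norm_num) (by norm_num) (Cl_mono h3 (by norm_num) (by norm_num))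

lemma two_cancel {f g : Q X} (h : f + f = g + g) : f = g := by
  have h1 : (2:ℝ) • f = (2:ℝ) • g := by rw [two_smul, two_smul, h]
  have := congrArg (fun z => (2⁻¹:ℝ) • z) h1
  simpa [smul_smul] using this

lemma D_nn (i : Fin 4) : D i Y.nn = -(Y.nn * Y.nn * Y.nn *
    (D 1 Y.psi * D i (D 1 Y.psi) + D 2 Y.psi * D i (D 2 Y.psi))) := by
  have h := congrArg (D i) Y.nn_eq
  simp only [D_mul, D_one, map_add] at h
  have e := Y.nn_eq
  apply two_cancel
  linear_combination Y.nn * h - 2 * D i Y.nn * e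

lemma nn_Li : Y.nn ∈ Li := fun _ => ⟨1, fun s t ht _ x hx => by
  have := Y.nn_pos s _ (ev_box ht hx)
  rw [abs_of_pos this.1]; exact this.2⟩

lemma nn_Cl : Y.nn ∈ Cl 4 2 := by
  have hp : ∀ i, D i (D 1 Y.psi) ∈ Cl 3 1 := fun i => Cl_D (Y.p_Cl 1 (by decide)) i
  have hp2 : ∀ i, D i (D 2 Y.psi) ∈ Cl 3 1 := fun i => Cl_D (Y.p_Cl 2 (by decide)) i
  have step : ∀ k l, k ≤ 3 → l ≤ 1 → k ≤ 2 * l + 1 → Y.nn ∈ Cl k l → Y.nn ∈ Cl (k+1) (l+1) := by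
    intro k l hk hl hkl h
    refine Cl_succ Y.nn_Li fun i => ?_
    rw [Y.D_nn]
    refine (Cl k l).neg_mem (Cl_mul hkl (Cl_mul hkl (Cl_mul hkl h h) h) ?_)
    exact (Cl k l).add_mem
      (Cl_mul hkl (Cl_mono (Y.p_Cl 1 (by decide)) (by omega) (by omega)) (Cl_mono (hp i) hk hl))
      (Cl_mul hkl (Cl_mono (Y.p_Cl 2 (by decide)) (by omega) (by omega)) (Cl_mono (hp2 i) hk hl))
  have h0 : Y.nn ∈ Cl 0 0 := ⟨fun γ h => by
      rw [List.length_eq_zero_iff.1 (Nat.le_zero.1 h)]; exact Li_le Y.nn_Li, fun γ h => by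
      rw [List.length_eq_zero_iff.1 (Nat.le_zero.1 h)]; exact Y.nn_Li⟩
  have h1 := step 0 0 (by norm_num) (by norm_num) (by norm_num) h0
  have h2 := step 1 1 (by norm_num) (by norm_num) (by norm_num) h1
  have h3 := step 2 1 (by norm_num) (by norm_num) (by norm_num) (Cl_mono h2 (by norm_num) (by norm_num))
  exact step 3 1 (by norm_num) (by norm_num) (by norm_num) (Cl_mono h3 (by norm_num) (by norm_num))

/-- Coefficients of the operators. -/
lemma Xk_Cl (k : Fin 3) (j : Fin 4) : Y.Xk k j ∈ Cl 4 2 := by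
  have hJ := Y.J_Cl
  have h := fun i => Y.F_Cl k i
  have h1 := Y.phi_Cl 1 (by decide)
  have h2 := Y.phi_Cl 2 (by decide)
  fin_cases j
  · exact (Cl 4 2).zero_mem
  · exact Cl_mul (by norm_num) hJ (h 0)
  · exact Cl_mul (by norm_num) hJ (h 1)
  · exact (Cl 4 2).sub_mem ((Cl 4 2).sub_mem (h 2) (Cl_mul (by norm_num) (h 0) h1))
      (Cl_mul (by norm_num) (h 1) h2)

/-- The last coefficient of the material field without the grid velocity. -/
def w0 : Q X := Y.v 2 - Y.v 0 * D 1 Y.phi - Y.v 1 * D 2 Y.phi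

lemma w0_Cl : Y.w0 ∈ Cl 4 2 := by
  have h := fun i => Y.v_Cl i
  have h1 := Y.phi_Cl 1 (by decide)
  have h2 := Y.phi_Cl 2 (by decide)
  exact (Cl 4 2).sub_mem ((Cl 4 2).sub_mem (h 2) (Cl_mul (by norm_num) (h 0) h1))
      (Cl_mul (by norm_num) (h 1) h2)

lemma Xv_Cl (j : Fin 4) (hj : j ≠ 3) : Y.Xv j ∈ Cl 4 2 := by
  have hJ := Y.J_Cl
  have h := fun i => Y.v_Cl i
  fin_cases j
  · exact hJ
  · exact Cl_mul (by norm_num) hJ (h 0)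
  · exact Cl_mul (by norm_num) hJ (h 1)
  · exact absurd rfl hj

lemma Xv3 : Y.Xv 3 = Y.w0 - D 0 Y.phi := rfl

lemma Xv_Cl' (j : Fin 4) : Y.Xv j ∈ Cl 3 2 := by
  by_cases hj : j = 3
  · subst hj
    rw [Y.Xv3]
    exact (Cl 3 2).sub_mem (Cl_mono Y.w0_Cl (by norm_num) le_rfl) Y.phit_Cl
  · exact Cl_mono (Y.Xv_Cl j hj) (by norm_num) le_rfl

lemma Bm_Cl (i : Fin 3) (j : Fin 4) : Y.Bm i j ∈ Cl 4 2 := by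
  have hJ := Y.J_Cl
  have h1 := (Cl 4 2).neg_mem (Y.phi_Cl 1 (by decide))
  have h2 := (Cl 4 2).neg_mem (Y.phi_Cl 2 (by decide))
  have h0 : (0 : Q X) ∈ Cl 4 2 := (Cl 4 2).zero_mem
  have h3 : (1 : Q X) ∈ Cl 4 2 := Cl_one
  fin_cases i <;> fin_cases j <;> assumption

lemma Op_Cl {a : Fin 4 → Q X} (ha : ∀ j, a j ∈ Cl 3 2) {f : Q X} (hf : f ∈ Cl 4 2) : Op a f ∈ Cl 3 1 := by
  have h : ∀ j, a j * D j f ∈ Cl 3 1 := fun j =>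
    Cl_mul (by norm_num) (Cl_mono (ha j) le_rfl (by norm_num)) (Cl_D hf j)
  exact (Cl 3 1).add_mem ((Cl 3 1).add_mem ((Cl 3 1).add_mem (h 0) (h 1)) (h 2)) (h 3)

/-- Flattened pressure gradient. -/
def H (i : Fin 3) : Q X := Op (Y.Bm i) Y.q

lemma H_eq (i : Fin 3) : Y.H i = Op (Y.Xk 0) (Y.F 0 i) + Op (Y.Xk 1) (Y.F 1 i) + Op (Y.Xk 2) (Y.F 2 i)
    - Op Y.Xv (Y.v i) := by
  rw [← Y.mom i, H]; ring

lemma H_Cl (i : Fin 3) : Y.H i ∈ Cl 3 1 := by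
  rw [H_eq]
  have h : ∀ k, Op (Y.Xk k) (Y.F k i) ∈ Cl 3 1 := fun k =>
    Op_Cl (fun j => Cl_mono (Y.Xk_Cl k j) (by norm_num) le_rfl) (Y.F_Cl k i)
  exact (Cl 3 1).sub_mem ((Cl 3 1).add_mem ((Cl 3 1).add_mem (h 0) (h 1)) (h 2))
    (Op_Cl Y.Xv_Cl' (Y.v_Cl i))

lemma Bm0 (f : Q X) : Op (Y.Bm 0) f = Y.J * D 1 f - D 1 Y.phi * D 3 f := by
  change (0:Q X) * _ + Y.J * _ + 0 * _ + (- D 1 Y.phi) * _ = _; ring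
lemma Bm1 (f : Q X) : Op (Y.Bm 1) f = Y.J * D 2 f - D 2 Y.phi * D 3 f := by
  change (0:Q X) * _ + 0 * _ + Y.J * _ + (- D 2 Y.phi) * _ = _; ring
lemma Bm2 (f : Q X) : Op (Y.Bm 2) f = D 3 f := by
  change (0:Q X) * _ + 0 * _ + 0 * _ + 1 * _ = _; ring

lemma q3 : D 3 Y.q = Y.H 2 := (Y.Bm2 _).symm
lemma q1 : D 1 Y.q = Y.iJ * Y.H 0 + Y.iJ * D 1 Y.phi * Y.H 2 := by
  rw [← q3, H, Bm0]
  have e := Y.iJ_J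
  linear_combination -(D 1 Y.q) * e
lemma q2 : D 2 Y.q = Y.iJ * Y.H 1 + Y.iJ * D 2 Y.phi * Y.H 2 := by
  rw [← q3, H, Bm1]
  have e := Y.iJ_J
  linear_combination -(D 2 Y.q) * e

lemma q_Cl (j : Fin 4) (hj : j ≠ 0) : D j Y.q ∈ Cl 3 1 := by
  have hi : Y.iJ ∈ Cl 3 1 := Cl_mono Y.iJ_Cl (by norm_num) (by norm_num)
  have hp : ∀ j, j ≠ 0 → D j Y.phi ∈ Cl 3 1 := fun j hj =>
    Cl_mono (Y.phi_Cl j hj) (by norm_num) (by norm_num)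
  fin_cases j
  · exact absurd rfl hj
  · change D 1 Y.q ∈ _
    rw [q1]
    exact (Cl 3 1).add_mem (Cl_mul (by norm_num) hi (Y.H_Cl 0))
      (Cl_mul (by norm_num) (Cl_mul (by norm_num) hi (hp 1 (by decide))) (Y.H_Cl 2))
  · change D 2 Y.q ∈ _
    rw [q2]
    exact (Cl 3 1).add_mem (Cl_mul (by norm_num) hi (Y.H_Cl 1))
      (Cl_mul (by norm_num) (Cl_mul (by norm_num) hi (hp 2 (by decide))) (Y.H_Cl 2))
  · change D 3 Y.q ∈ _
    rw [q3]; exact Y.H_Cl 2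

/-- Divergence identities and vanishing normal components. -/
lemma Xv_div : D 0 (Y.Xv 0) + D 1 (Y.Xv 1) + D 2 (Y.Xv 2) + D 3 (Y.Xv 3) = 0 := by
  have h := Y.divv
  rw [Bm0, Bm1, Bm2] at h
  change D 0 Y.J + D 1 (Y.J * Y.v 0) + D 2 (Y.J * Y.v 1) +
    D 3 (Y.v 2 - Y.v 0 * D 1 Y.phi - Y.v 1 * D 2 Y.phi - D 0 Y.phi) = 0
  simp only [map_sub, D_mul]
  rw [D_comm 3 1, D_comm 3 2, D_comm 3 0]
  simp only [Pre.J] at h ⊢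
  linear_combination h

lemma Xk_div (k : Fin 3) : D 0 (Y.Xk k 0) + D 1 (Y.Xk k 1) + D 2 (Y.Xk k 2) + D 3 (Y.Xk k 3) = 0 := by
  have h := Y.divF k
  rw [Bm0, Bm1, Bm2] at h
  change D 0 (0 : Q X) + D 1 (Y.J * Y.F k 0) + D 2 (Y.J * Y.F k 1) +
    D 3 (Y.F k 2 - Y.F k 0 * D 1 Y.phi - Y.F k 1 * D 2 Y.phi) = 0
  simp only [map_sub, D_mul, map_zero]
  rw [D_comm 3 1, D_comm 3 2]
  simp only [Pre.J] at h ⊢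
  linear_combination h

lemma tr_phi : tr Y.phi = Y.psi := by
  rw [Pre.phi, map_add, map_mul, tr_x3, Y.tr_chi, Y.tr_psi]; ring

lemma tr_Dphi (i : Fin 4) (hi : i ≠ 3) : tr (D i Y.phi) = D i Y.psi := by
  rw [← D_tr i hi, tr_phi]

lemma trb_Dw_chi_mul (γ δ : List (Fin 4)) (f : Q X) : trb (Dw γ (Dw δ Y.chi * f)) = 0 := by
  have : Sp 0 γ.length (Dw δ Y.chi) f ≤ (RingHom.ker trb).restrictScalars ℝ := by
    apply Sp_le
    intro a b _ _ _
    change trb _ = 0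
    rw [map_mul, ← Dw_append, Y.trb_chi, zero_mul]
  exact this (Dw_mul_mem γ _ f)

lemma trb_Dphi (i : Fin 4) (hi : i ≠ 3) : trb (D i Y.phi) = 0 := by
  rw [Y.D_phi i hi]; exact Y.trb_Dw_chi_mul [] [] _

lemma tr_Xv : tr (Y.Xv 3) = 0 := by
  rw [Y.Xv3, w0]
  simp only [map_sub, map_mul, Y.tr_Dphi 0 (by decide), Y.tr_Dphi 1 (by decide), Y.tr_Dphi 2 (by decide)]
  rw [Y.kin]; ring
lemma trb_Xv : trb (Y.Xv 3) = 0 := by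
  rw [Y.Xv3, w0]
  simp only [map_sub, map_mul, Y.trb_Dphi 0 (by decide), Y.trb_Dphi 1 (by decide), Y.trb_Dphi 2 (by decide), Y.botv]
  ring
lemma tr_Xk (k : Fin 3) : tr (Y.Xk k 3) = 0 := by
  change tr (Y.F k 2 - Y.F k 0 * D 1 Y.phi - Y.F k 1 * D 2 Y.phi) = 0
  simp only [map_sub, map_mul, Y.tr_Dphi 1 (by decide), Y.tr_Dphi 2 (by decide)]
  exact Y.tang k
lemma trb_Xk (k : Fin 3) : trb (Y.Xk k 3) = 0 := by
  change trb (Y.F k 2 - Y.F k 0 * D 1 Y.phi - Y.F k 1 * D 2 Y.phi) = 0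
  simp only [map_sub, map_mul, Y.trb_Dphi 1 (by decide), Y.trb_Dphi 2 (by decide), Y.botF]
  ring

end Sys
end EE

namespace EE
open scoped ContDiff
open MeasureTheory Set Filter Topology

variable {X : Ctx}

lemma cancel_Null {f : Q X} (h : bb * f ∈ Null) : f ∈ Null := by
  intro s t ht
  have := h s t ht
  rw [bb, I_cmul _ _ ht] at this
  exact (mul_eq_zero.1 this).resolve_left X.hb.ne'

lemma Op_mul (a : Fin 4 → Q X) (f g : Q X) : Op a (f * g) = f * Op a g + g * Op a f := by
  simp only [Op, D_mul]; ring
lemma Op_sub (a : Fin 4 → Q X) (f g : Q X) : Op a (f - g) = Op a f - Op a g := by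
  simp only [Op, map_sub]; ring
lemma Op_add (a : Fin 4 → Q X) (f g : Q X) : Op a (f + g) = Op a f + Op a g := by
  simp only [Op, map_add]; ring

lemma Op_Null {a : Fin 4 → Q X} (hd : D 0 (a 0) + D 1 (a 1) + D 2 (a 2) + D 3 (a 3) = 0)
    (h0 : tr (a 3) = 0) (h1 : trb (a 3) = 0) (h : Q X) : Op a h - D 0 (a 0 * h) ∈ Null := by
  apply cancel_Null
  have e : bb * (Op a h - D 0 (a 0 * h)) = bb * D 1 (a 1 * h) + bb * D 2 (a 2 * h)
      + (bb * D 3 (a 3 * h) - tr (a 3 * h) + trb (a 3 * h)) := by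
    rw [map_mul tr, map_mul trb, h0, h1]
    simp only [Op, D_mul]
    linear_combination (-bb * h) * hd
  rw [e]
  exact Null.add_mem (Null.add_mem (Null_cmul _ (D1_Null _)) (Null_cmul _ (D2_Null _))) (D3_Null _)

/-- Commutator of a derivative with a first-order operator. -/
lemma Dw_Op (γ : List (Fin 4)) (a : Fin 4 → Q X) (f : Q X) : Dw γ (Op a f) = Op a (Dw γ f) +
    (D 0 f * Dw γ (a 0) + D 1 f * Dw γ (a 1) + D 2 f * Dw γ (a 2) + D 3 f * Dw γ (a 3)) +
    (cm γ (a 0) (D 0 f) + cm γ (a 1) (D 1 f) + cm γ (a 2) (D 2 f) + cm γ (a 3) (D 3 f)) := by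
  simp only [Op, map_add, cm_eq, Dw_D]; ring

lemma cm_zero (γ : List (Fin 4)) (g : Q X) : cm γ 0 g = 0 := by simp [cm]

/-- Pure `L²` part of a coefficient commutator of order four. -/
lemma cm4 {γ : List (Fin 4)} (hγ : γ.length = 4) {f g : Q X} (hf : f ∈ Cl 3 2) (hg : g ∈ Cl 3 1) :
    cm γ f g ∈ L2 :=
  Sp_L2 hf hg (m := 1) (n := 4) (fun a b _ _ _ => by omega) (cm_mem' hγ (by norm_num) f g)

lemma co4 {γ : List (Fin 4)} (hγ : γ.length = 4) {f g : Q X} (hf : f ∈ Cl 4 2) (hg : g ∈ Cl 3 1) :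
    g * Dw γ f + cm γ f g ∈ L2 :=
  L2.add_mem (Li_L2 (Cl_Li hg) (hf.1 γ hγ.le)) (cm4 hγ (Cl_mono hf (by norm_num) le_rfl) hg)

lemma co3 {γ : List (Fin 4)} (hγ : γ.length = 3) {f g : Q X} (hf : f ∈ Cl 4 2) (hg : g ∈ Cl 3 1) :
    g * Dw γ f + cm γ f g ∈ L2w 0 := by
  refine (L2w 0).add_mem (L2w_of (Li_L2 (Cl_Li hg) (hf.1 γ (by omega))) ?_) ?_
  · rw [D_mul]
    exact L2.add_mem (Li_L2 (Cl_Li hg) (hf.1 (0 :: γ) (by simp; omega)))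
      (L2_Li (hf.1 γ (by omega)) (hg.2 [0] (by simp))  |> fun h => h)
  · exact Sp_G hf hg (m := 1) (n := 3) (fun a b _ _ _ => by omega) (fun a b _ _ _ => by omega)
      (cm_mem' hγ (by norm_num) f g)

lemma co3' {γ : List (Fin 4)} (hγ : γ.length = 3) {f g : Q X} (hf : f ∈ Cl 4 2) (hg : g ∈ Cl 3 1)
    (h : Dw γ g ∈ L2w 2) : Dw γ (f * g) ∈ L2w 2 := by
  rw [cm_eq, add_assoc]
  exact (L2w 2).add_mem (GLi_L2w (Cl_GLi hf [] (by simp)) h) (L2w_mono (by norm_num) (co3 hγ hf hg))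

namespace Sys
variable (Y : Sys X)

lemma Xk0 (k : Fin 3) : Y.Xk k 0 = 0 := rfl
lemma Xv0 : Y.Xv 0 = Y.J := rfl

lemma Xv_Null (h : Q X) : Op Y.Xv h - D 0 (Y.J * h) ∈ Null := Op_Null Y.Xv_div Y.tr_Xv Y.trb_Xv h
lemma Xk_Null (k : Fin 3) (h : Q X) : Op (Y.Xk k) h ∈ Null := by
  have := Op_Null (Y.Xk_div k) (Y.tr_Xk k) (Y.trb_Xk k) h
  rwa [Xk0, zero_mul, map_zero, sub_zero] at this

/-- Basic energy identity. -/
lemma EN {U P : Q X} {G : Fin 3 → Q X} (hU : U ∈ L2) (hG : ∀ k, G k ∈ L2)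
    (h1 : Op Y.Xv U + P - (Op (Y.Xk 0) (G 0) + Op (Y.Xk 1) (G 1) + Op (Y.Xk 2) (G 2)) ∈ L2)
    (h2 : ∀ k, Op Y.Xv (G k) - Op (Y.Xk k) U ∈ L2) :
    D 0 (Y.J * (U * U + (G 0 * G 0 + G 1 * G 1 + G 2 * G 2))) + 2 * (U * P) ∈ LB := by
  have a1 := mul_LB hU h1
  have a2 := fun k => mul_LB (hG k) (h2 k)
  have a3 := Null_LB (Y.Xv_Null (U * U + (G 0 * G 0 + G 1 * G 1 + G 2 * G 2)))
  have a4 := fun k => Null_LB (Y.Xk_Null k (U * G k))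
  have b1 := LB.add_mem (LB.add_mem a1 (LB.add_mem (LB.add_mem (a2 0) (a2 1)) (a2 2)))
    (LB.add_mem (LB.add_mem (a4 0) (a4 1)) (a4 2))
  have b2 := LB.sub_mem (LB.add_mem b1 b1) a3
  convert b2 using 1
  simp only [Op_mul, Op_add]
  ring

/-- Order-four commutators. -/
lemma Dw_Xk {γ : List (Fin 4)} (hγ : γ.length = 4) (k : Fin 3) {f : Q X} (hf : f ∈ Cl 4 2) :
    Dw γ (Op (Y.Xk k) f) - Op (Y.Xk k) (Dw γ f) ∈ L2 := by
  have h := fun j => co4 hγ (Y.Xk_Cl k j) (Cl_D hf j)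
  have := L2.add_mem (L2.add_mem (L2.add_mem (h 0) (h 1)) (h 2)) (h 3)
  convert this using 1
  rw [Dw_Op]; ring

lemma Dw_Xv {γ : List (Fin 4)} (hγ : γ.length = 4) {f : Q X} (hf : f ∈ Cl 4 2) :
    Dw γ (Op Y.Xv f) - Op Y.Xv (Dw γ f) + D 0 (Dw γ Y.phi) * D 3 f ∈ L2 := by
  have h := fun j hj => co4 hγ (Y.Xv_Cl j hj) (Cl_D hf j)
  have h3 := cm4 hγ (Y.Xv_Cl' 3) (Cl_D hf 3)
  have h3' := Li_L2 (Cl_Li (Cl_D hf 3)) (Y.w0_Cl.1 γ hγ.le)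
  have := L2.add_mem (L2.add_mem (L2.add_mem (L2.add_mem (h 0 (by decide)) (h 1 (by decide)))
    (h 2 (by decide))) h3) h3'
  convert this using 1
  rw [Dw_Op, Y.Xv3, map_sub, Dw_D]; ring

lemma Dw_B {γ : List (Fin 4)} (hγ : γ.length = 4) (i : Fin 3) :
    Dw γ (Op (Y.Bm i) Y.q) - Op (Y.Bm i) (Dw γ Y.q) ∈ L2 := by
  have h := fun j hj => co4 hγ (Y.Bm_Cl i j) (Y.q_Cl j hj)
  have := L2.add_mem (L2.add_mem (h 1 (by decide)) (h 2 (by decide))) (h 3 (by decide))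
  convert this using 1
  have h0 : Y.Bm i 0 = 0 := by fin_cases i <;> rfl
  rw [Dw_Op, h0, map_zero, cm_zero]; ring

lemma Xv_Li (j : Fin 4) : Y.Xv j ∈ Li := Cl_Li (Y.Xv_Cl' j)
lemma Xk_Li (k : Fin 3) (j : Fin 4) : Y.Xk k j ∈ Li := Cl_Li (Y.Xk_Cl k j)
lemma J_Li : Y.J ∈ Li := Cl_Li Y.J_Cl

lemma Op_Li {a : Fin 4 → Q X} (ha : ∀ j, a j ∈ Li) {f : Q X} (hf : ∀ j, D j f ∈ Li) : Op a f ∈ Li :=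
  Li.add_mem (Li.add_mem (Li.add_mem (Li.mul_mem (ha 0) (hf 0)) (Li.mul_mem (ha 1) (hf 1)))
    (Li.mul_mem (ha 2) (hf 2))) (Li.mul_mem (ha 3) (hf 3))

section good
variable {γ : List (Fin 4)} {z : Fin 4}

lemma Zphi_L2 (hγ : γ.length = 4) : Dw γ Y.phi ∈ L2 := by
  cases γ with
  | nil => simp at hγ
  | cons i γ =>
    simp at hγ
    rw [Dw_cons, ← Dw_D]
    by_cases hi : i = 0
    · subst hi; exact Y.phit_Cl.1 γ (by omega)
    · exact (Y.phi_Cl i hi).1 γ (by omega)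

lemma DZphi_L2 (hγ : γ.length = 4) (j : Fin 4) (hj : j ≠ 0) : D j (Dw γ Y.phi) ∈ L2 := by
  rw [← Dw_D]; exact (Y.phi_Cl j hj).1 γ (by omega)

/-- Alinhac's good unknown. -/
def gu (γ : List (Fin 4)) (f : Q X) : Q X := Dw γ f - Dw γ Y.phi * Y.iJ * D 3 f

lemma gu_L2 (hγ : γ.length = 4) {f : Q X} (hf : f ∈ Cl 4 2) : Y.gu γ f ∈ L2 :=
  L2.sub_mem (hf.1 γ hγ.le) (L2_Li (L2_Li (Y.Zphi_L2 hγ) Y.iJ_Li) (hf.2 [3] (by simp)))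

lemma Xv_gu (hγ : γ.length = 4) {f : Q X} (hf : f ∈ Cl 4 2) :
    Op Y.Xv (Y.gu γ f) - Dw γ (Op Y.Xv f) ∈ L2 := by
  have a1 := Y.Dw_Xv hγ hf
  have hS := L2_Li (Y.Zphi_L2 hγ) Y.iJ_Li
  have a2 := L2_Li hS (Op_Li Y.Xv_Li (f := D 3 f) fun j => hf.2 [j, 3] (by simp))
  have hI := Op_Li Y.Xv_Li (f := Y.iJ) fun j => Y.iJ_Cl.2 [j] (by simp)
  have h3 : D 3 f ∈ Li := hf.2 [3] (by simp)
  have a3 := L2_Li (Y.Zphi_L2 hγ) (Li.mul_mem hI h3)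
  have a4 := fun j hj => L2_Li (Y.DZphi_L2 hγ j hj) (Li.mul_mem (Li.mul_mem (Y.Xv_Li j) Y.iJ_Li) h3)
  have := L2.neg_mem (L2.add_mem a1 (L2.add_mem a2 (L2.add_mem a3 (L2.add_mem (L2.add_mem
    (a4 1 (by decide)) (a4 2 (by decide))) (a4 3 (by decide))))))
  convert this using 1
  have e := Y.iJ_J
  simp only [gu, Op_sub, Op_mul]
  rw [show Op Y.Xv (Dw γ Y.phi) = Y.J * D 0 (Dw γ Y.phi) + Y.Xv 1 * D 1 (Dw γ Y.phi)
    + Y.Xv 2 * D 2 (Dw γ Y.phi) + Y.Xv 3 * D 3 (Dw γ Y.phi) from rfl]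
  linear_combination (-(D 0 (Dw γ Y.phi) * D 3 f)) * e

lemma Xk_gu (hγ : γ.length = 4) (k : Fin 3) {f : Q X} (hf : f ∈ Cl 4 2) :
    Op (Y.Xk k) (Y.gu γ f) - Dw γ (Op (Y.Xk k) f) ∈ L2 := by
  have a1 := Y.Dw_Xk hγ k hf
  have hS := L2_Li (Y.Zphi_L2 hγ) Y.iJ_Li
  have a2 := L2_Li hS (Op_Li (Y.Xk_Li k) (f := D 3 f) fun j => hf.2 [j, 3] (by simp))
  have hI := Op_Li (Y.Xk_Li k) (f := Y.iJ) fun j => Y.iJ_Cl.2 [j] (by simp)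
  have h3 : D 3 f ∈ Li := hf.2 [3] (by simp)
  have a3 := L2_Li (Y.Zphi_L2 hγ) (Li.mul_mem hI h3)
  have a4 := fun j hj => L2_Li (Y.DZphi_L2 hγ j hj)
    (Li.mul_mem (Li.mul_mem (Y.Xk_Li k j) Y.iJ_Li) h3)
  have := L2.neg_mem (L2.add_mem a1 (L2.add_mem a2 (L2.add_mem a3 (L2.add_mem (L2.add_mem
    (a4 1 (by decide)) (a4 2 (by decide))) (a4 3 (by decide))))))
  convert this using 1
  simp only [gu, Op_sub, Op_mul]
  rw [show Op (Y.Xk k) (Dw γ Y.phi) = 0 * D 0 (Dw γ Y.phi) + Y.Xk k 1 * D 1 (Dw γ Y.phi)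
    + Y.Xk k 2 * D 2 (Dw γ Y.phi) + Y.Xk k 3 * D 3 (Dw γ Y.phi) from rfl]
  ring

/-- Interior energy density of the good unknowns. -/
def eD (γ : List (Fin 4)) (i : Fin 3) : Q X :=
  Y.gu γ (Y.v i) * Y.gu γ (Y.v i) + (Y.gu γ (Y.F 0 i) * Y.gu γ (Y.F 0 i) +
    Y.gu γ (Y.F 1 i) * Y.gu γ (Y.F 1 i) + Y.gu γ (Y.F 2 i) * Y.gu γ (Y.F 2 i))

lemma gu_EN (hγ : γ.length = 4) (i : Fin 3) :
    D 0 (Y.J * Y.eD γ i) + 2 * (Y.gu γ (Y.v i) * Op (Y.Bm i) (Dw γ Y.q)) ∈ LB := by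
  refine Y.EN (U := Y.gu γ (Y.v i)) (G := fun k => Y.gu γ (Y.F k i)) (Y.gu_L2 hγ (Y.v_Cl i))
    (fun k => Y.gu_L2 hγ (Y.F_Cl k i)) ?_ ?_
  · have a1 := Y.Xv_gu hγ (Y.v_Cl i)
    have a2 := Y.Dw_B hγ i
    have a3 := fun k => Y.Xk_gu hγ k (Y.F_Cl k i)
    have := L2.sub_mem (L2.sub_mem a1 a2) (L2.add_mem (L2.add_mem (a3 0) (a3 1)) (a3 2))
    convert this using 1
    have m := congrArg (Dw γ) (Y.mom i)
    simp only [map_add] at m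
    linear_combination m
  · intro k
    have a1 := Y.Xv_gu hγ (Y.F_Cl k i)
    have a3 := Y.Xk_gu hγ k (Y.v_Cl i)
    have := L2.sub_mem a1 a3
    convert this using 1
    rw [Y.trans]; ring

/-- The divergence-free flux. -/
def W1 (γ : List (Fin 4)) : Q X := Dw γ (Y.J * Y.v 0) - Y.v 0 * Dw γ Y.J - Dw γ Y.phi * D 3 (Y.v 0)
/-- The divergence-free flux. -/
def W2 (γ : List (Fin 4)) : Q X := Dw γ (Y.J * Y.v 1) - Y.v 1 * Dw γ Y.J - Dw γ Y.phi * D 3 (Y.v 1)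
/-- The divergence-free flux. -/
def W3 (γ : List (Fin 4)) : Q X := Dw γ Y.w0 + Y.v 0 * D 1 (Dw γ Y.phi) + Y.v 1 * D 2 (Dw γ Y.phi)
  + Dw γ Y.phi * (D 1 (Y.v 0) + D 2 (Y.v 1))

lemma w0_div : D 1 (Y.J * Y.v 0) + D 2 (Y.J * Y.v 1) + D 3 Y.w0 = 0 := by
  have h := Y.Xv_div
  change D 0 Y.J + D 1 (Y.J * Y.v 0) + D 2 (Y.J * Y.v 1) + D 3 (Y.w0 - D 0 Y.phi) = 0 at h
  rw [map_sub, D_comm 3 0] at h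
  simp only [Pre.J] at h ⊢
  linear_combination h

lemma W_div (γ : List (Fin 4)) : D 1 (Y.W1 γ) + D 2 (Y.W2 γ) + D 3 (Y.W3 γ) = 0 := by
  have h := congrArg (Dw γ) Y.w0_div
  simp only [map_add, map_zero, Dw_D] at h
  have hJ : Dw γ Y.J = D 3 (Dw γ Y.phi) := Dw_D _ _ _
  simp only [W1, W2, W3, map_sub, map_add, D_mul, hJ]
  rw [D_comm 3 1 (Dw γ Y.phi), D_comm 3 2 (Dw γ Y.phi), D_comm 3 1 (Y.v 0), D_comm 3 2 (Y.v 1)]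
  linear_combination h

lemma tr_w0 : tr Y.w0 = D 0 Y.psi := by
  have := Y.tr_Xv
  rw [Y.Xv3, map_sub, Y.tr_Dphi 0 (by decide)] at this
  linear_combination this
lemma trb_w0 : trb Y.w0 = 0 := by
  have := Y.trb_Xv
  rw [Y.Xv3, map_sub, Y.trb_Dphi 0 (by decide)] at this
  linear_combination this

lemma tr_Zphi (h3 : 3 ∉ γ) : tr (Dw γ Y.phi) = Dw γ Y.psi := by rw [← Dw_tr h3, Y.tr_phi]

lemma tr_W3 (h3 : 3 ∉ γ) : tr (Y.W3 γ) = D 0 (Dw γ Y.psi) + D 1 (tr (Y.v 0) * Dw γ Y.psi)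
    + D 2 (tr (Y.v 1) * Dw γ Y.psi) := by
  simp only [W3, map_add, map_mul, D_mul, Y.tr_Zphi h3, ← Dw_tr h3, Y.tr_w0, ← D1_tr, ← D2_tr, Dw_D]
  ring

lemma trb_Zphi (h3 : 3 ∉ γ) (hγ : γ.length = 4) : trb (Dw γ Y.phi) = 0 := by
  cases γ with
  | nil => simp at hγ
  | cons i γ =>
    simp only [List.mem_cons, not_or] at h3
    rw [Dw_cons, ← Dw_D, ← Dw_trb h3.2, Y.trb_Dphi i (Ne.symm h3.1), map_zero]

lemma trb_W3 (h3 : 3 ∉ γ) (hγ : γ.length = 4) : trb (Y.W3 γ) = 0 := by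
  simp only [W3, map_add, map_mul, Y.trb_Zphi h3 hγ, ← Dw_trb h3, Y.trb_w0,
    ← D_trb 1 (by decide) (Dw γ Y.phi), ← D_trb 2 (by decide) (Dw γ Y.phi), map_zero]
  ring

/-- Remainder fluxes. -/
def Y1 (γ : List (Fin 4)) : Q X := cm γ Y.J (Y.v 0)
/-- Remainder fluxes. -/
def Y2 (γ : List (Fin 4)) : Q X := cm γ Y.J (Y.v 1)
/-- Remainder fluxes. -/
def Y3 (γ : List (Fin 4)) : Q X := - cm γ (Y.v 0) (D 1 Y.phi) - cm γ (Y.v 1) (D 2 Y.phi)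

lemma cm44 (hγ : γ.length = 4) {f g : Q X} (hf : f ∈ Cl 4 2) (hg : g ∈ Cl 4 2) :
    cm γ f g ∈ L2 ∧ ∀ i, D i (cm γ f g) ∈ L2 := by
  have h := cm_mem' hγ (by norm_num) f g
  exact ⟨Sp_L2 hf hg (m := 1) (n := 4) (fun a b _ _ _ => by omega) h,
    fun i => Sp_L2 hf hg (m := 1) (n := 5) (fun a b _ _ _ => by omega) (D_Sp h i)⟩

lemma Y1_L2 (hγ : γ.length = 4) : Y.Y1 γ ∈ L2 ∧ ∀ i, D i (Y.Y1 γ) ∈ L2 := cm44 hγ Y.J_Cl (Y.v_Cl 0)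
lemma Y2_L2 (hγ : γ.length = 4) : Y.Y2 γ ∈ L2 ∧ ∀ i, D i (Y.Y2 γ) ∈ L2 := cm44 hγ Y.J_Cl (Y.v_Cl 1)
lemma Y3_L2 (hγ : γ.length = 4) : Y.Y3 γ ∈ L2 ∧ ∀ i, D i (Y.Y3 γ) ∈ L2 := by
  have h1 := cm44 hγ (Y.v_Cl 0) (Y.phi_Cl 1 (by decide))
  have h2 := cm44 hγ (Y.v_Cl 1) (Y.phi_Cl 2 (by decide))
  refine ⟨L2.sub_mem (L2.neg_mem h1.1) h2.1, fun i => ?_⟩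
  rw [Y3, map_sub, map_neg]
  exact L2.sub_mem (L2.neg_mem (h1.2 i)) (h2.2 i)

lemma V_flux (γ : List (Fin 4)) (f : Q X) :
    Y.gu γ (Y.v 0) * Op (Y.Bm 0) f + Y.gu γ (Y.v 1) * Op (Y.Bm 1) f + Y.gu γ (Y.v 2) * Op (Y.Bm 2) f =
    (Y.W1 γ - Y.Y1 γ) * D 1 f + (Y.W2 γ - Y.Y2 γ) * D 2 f + (Y.W3 γ - Y.Y3 γ) * D 3 f := by
  have h := Y.divv
  rw [Bm0, Bm1, Bm2] at h ⊢
  have e := Y.iJ_J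
  have hJ : Dw γ Y.J = D 3 (Dw γ Y.phi) := Dw_D _ _ _
  simp only [gu, W1, W2, W3, Y1, Y2, Y3, w0, map_sub, cm, Dw_D]
  have e2 : Y.iJ * (D 3 (Y.v 2) - D 1 Y.phi * D 3 (Y.v 0) - D 2 Y.phi * D 3 (Y.v 1)) =
      - (D 1 (Y.v 0) + D 2 (Y.v 1)) := by
    linear_combination Y.iJ * h - (D 1 (Y.v 0) + D 2 (Y.v 1)) * e
  linear_combination (-(Dw γ Y.phi) * D 3 f) * e2 - (Dw γ Y.phi) * (D 3 (Y.v 0) * D 1 f + D 3 (Y.v 1) * D 2 f) * e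

/-- Boundary reduction of the main pressure term. -/
lemma W_Null (h3 : 3 ∉ γ) (hγ : γ.length = 4) (f : Q X) :
    bb * (Y.W1 γ * D 1 f + Y.W2 γ * D 2 f + Y.W3 γ * D 3 f) - tr (Y.W3 γ) * tr f ∈ Null := by
  have h := Null.add_mem (Null.add_mem (Null_cmul (fun _ => X.b) (D1_Null (Y.W1 γ * f)))
    (Null_cmul (fun _ => X.b) (D2_Null (Y.W2 γ * f)))) (D3_Null (Y.W3 γ * f))
  convert h using 1
  have e := Y.W_div γ
  rw [map_mul tr, map_mul trb, Y.trb_W3 h3 hγ]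
  change _ = bb * _ + bb * _ + _
  simp only [D_mul]
  linear_combination (-bb * f) * e

lemma q_L2E (hγ : γ.length = 3) (j : Fin 4) (hj : j ≠ 0) : Dw γ (D j Y.q) ∈ L2w 2 := by
  have hF : ∀ k i j, Dw γ (Y.Xk k j * D j (Y.F k i)) ∈ L2w 2 := fun k i j =>
    co3' hγ (Y.Xk_Cl k j) (Cl_D (Y.F_Cl k i) j) (by
      rw [Dw_D]; exact Y.F_L2E k i (j :: γ) (by simp; omega))
  have hv : ∀ i j, j ≠ 3 → Dw γ (Y.Xv j * D j (Y.v i)) ∈ L2w 2 := fun i j hj =>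
    co3' hγ (Y.Xv_Cl j hj) (Cl_D (Y.v_Cl i) j) (by
      rw [Dw_D]; exact Y.v_L2E i (j :: γ) (by simp; omega))
  have hphi : Dw γ (D 0 Y.phi) ∈ L2w 2 := by
    rw [Y.D_phi 0 (by decide)]
    refine Sp_le (S := L2w 2) ?_ (Dw_mul_mem γ _ _)
    intro a b _ _ hab
    refine GLi_L2w (Cl_GLi (k := 0) (l := 0) (Y.chi_Cl a) [] (by simp)) ?_
    rw [Dw_D]
    refine Y.psi_L2E (0 :: b) (by simp; omega) ?_
    have := List.count_le_length (a := (0 : Fin 4)) (l := b)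
    rw [List.count_cons_self]; omega
  have hv3 : ∀ i, Dw γ (Y.Xv 3 * D 3 (Y.v i)) ∈ L2w 2 := fun i => by
    have hd := Cl_D (Y.v_Cl i) 3
    rw [Y.Xv3, sub_mul, map_sub]
    refine (L2w 2).sub_mem (co3' hγ Y.w0_Cl hd (by
      rw [Dw_D]; exact Y.v_L2E i (3 :: γ) (by simp; omega))) ?_
    rw [cm_eq]
    refine (L2w 2).add_mem ((L2w 2).add_mem ?_ ?_) ?_
    · refine GLi_L2w (Cl_GLi Y.phit_Cl [] (by simp)) ?_
      rw [Dw_D]; exact Y.v_L2E i (3 :: γ) (by simp; omega)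
    · exact GLi_L2w (Cl_GLi hd [] (by simp)) hphi
    · exact L2w_mono (by norm_num) (Sp_G Y.phit_Cl hd (m := 1) (n := 3) (fun a b _ _ _ => by omega)
        (fun a b _ _ _ => by omega) (cm_mem' hγ (by norm_num) _ _))
  have hH : ∀ i, Dw γ (Y.H i) ∈ L2w 2 := fun i => by
    rw [H_eq]
    have h1 : ∀ k, Dw γ (Op (Y.Xk k) (Y.F k i)) ∈ L2w 2 := fun k => by
      simp only [Op, map_add]
      exact (L2w 2).add_mem ((L2w 2).add_mem ((L2w 2).add_mem (hF k i 0) (hF k i 1)) (hF k i 2)) (hF k i 3)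
    rw [map_sub, map_add, map_add]
    refine (L2w 2).sub_mem ((L2w 2).add_mem ((L2w 2).add_mem (h1 0) (h1 1)) (h1 2)) ?_
    simp only [Op, map_add]
    exact (L2w 2).add_mem ((L2w 2).add_mem ((L2w 2).add_mem (hv i 0 (by decide)) (hv i 1 (by decide)))
      (hv i 2 (by decide))) (hv3 i)
  fin_cases j
  · exact absurd rfl hj
  · change Dw γ (D 1 Y.q) ∈ _
    rw [q1, map_add]
    exact (L2w 2).add_mem (co3' hγ Y.iJ_Cl (Y.H_Cl 0) (hH 0))
      (co3' hγ (Cl_mul (by norm_num) Y.iJ_Cl (Y.phi_Cl 1 (by decide))) (Y.H_Cl 2) (hH 2))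
  · change Dw γ (D 2 Y.q) ∈ _
    rw [q2, map_add]
    exact (L2w 2).add_mem (co3' hγ Y.iJ_Cl (Y.H_Cl 1) (hH 1))
      (co3' hγ (Cl_mul (by norm_num) Y.iJ_Cl (Y.phi_Cl 2 (by decide))) (Y.H_Cl 2) (hH 2))
  · change Dw γ (D 3 Y.q) ∈ _
    rw [q3]; exact hH 2

/-- The remainder pressure term is a time derivative up to bounded terms. -/
lemma Y_term (hγ : γ.length = 3) (hz : z ≠ 3) : ∃ y ∈ GB (X := X) 1, y ∈ LB ∧
    Y.Y1 (z :: γ) * D 1 (Dw (z :: γ) Y.q) + Y.Y2 (z :: γ) * D 2 (Dw (z :: γ) Y.q)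
      + Y.Y3 (z :: γ) * D 3 (Dw (z :: γ) Y.q) - D 0 y ∈ LB := by
  have hl : (z :: γ).length = 4 := by simp [hγ]
  obtain ⟨a1, b1⟩ := Y.Y1_L2 hl
  obtain ⟨a2, b2⟩ := Y.Y2_L2 hl
  obtain ⟨a3, b3⟩ := Y.Y3_L2 hl
  set y := Y.Y1 (z :: γ) * Dw γ (D 1 Y.q) + Y.Y2 (z :: γ) * Dw γ (D 2 Y.q) +
    Y.Y3 (z :: γ) * Dw γ (D 3 Y.q) with hy
  have hq : ∀ j, j ≠ 0 → Dw γ (D j Y.q) ∈ L2 := fun j hj => (Y.q_Cl j hj).1 γ hγ.le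
  have hyG : y ∈ GB 1 := (GB 1).add_mem ((GB 1).add_mem
    (mul_GB (L2w_of a1 (b1 0)) (Y.q_L2E hγ 1 (by decide)))
    (mul_GB (L2w_of a2 (b2 0)) (Y.q_L2E hγ 2 (by decide))))
    (mul_GB (L2w_of a3 (b3 0)) (Y.q_L2E hγ 3 (by decide)))
  have hyL : y ∈ LB := LB.add_mem (LB.add_mem (mul_LB a1 (hq 1 (by decide)))
    (mul_LB a2 (hq 2 (by decide)))) (mul_LB a3 (hq 3 (by decide)))
  have key : Y.Y1 (z :: γ) * D 1 (Dw (z :: γ) Y.q) + Y.Y2 (z :: γ) * D 2 (Dw (z :: γ) Y.q)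
      + Y.Y3 (z :: γ) * D 3 (Dw (z :: γ) Y.q) - D z y ∈ LB := by
    have := LB.neg_mem (LB.add_mem (LB.add_mem (mul_LB (b1 z) (hq 1 (by decide)))
      (mul_LB (b2 z) (hq 2 (by decide)))) (mul_LB (b3 z) (hq 3 (by decide))))
    convert this using 1
    simp only [hy, map_add, D_mul, Dw_cons, Dw_D]
    rw [D_comm z 1, D_comm z 2, D_comm z 3]; ring
  have hother : D z y ∈ LB → ∃ y ∈ GB (X := X) 1, y ∈ LB ∧
    Y.Y1 (z :: γ) * D 1 (Dw (z :: γ) Y.q) + Y.Y2 (z :: γ) * D 2 (Dw (z :: γ) Y.q)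
      + Y.Y3 (z :: γ) * D 3 (Dw (z :: γ) Y.q) - D 0 y ∈ LB := fun h =>
    ⟨0, (GB 1).zero_mem, LB.zero_mem, by
      rw [map_zero, sub_zero]
      have := LB.add_mem key h
      rwa [sub_add_cancel] at this⟩
  by_cases h0 : z = 0
  · subst h0; exact ⟨y, hyG, hyL, key⟩
  · apply hother
    have h12 : z = 1 ∨ z = 2 := by fin_cases z <;> simp_all
    rcases h12 with h | h
    · rw [h]; exact Null_LB (D1_Null _)
    · rw [h]; exact Null_LB (D2_Null _)

end good
end Sys
end EE

namespace EE
open scoped ContDiff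
open MeasureTheory Set Filter Topology

variable {X : Ctx}

/-- Pointwise nonnegative fields. -/
def Pos (f : Q X) : Prop := ∀ s, ∀ p ∈ Box X s, 0 ≤ ev f s p

lemma Pos.add {f g : Q X} (hf : Pos f) (hg : Pos g) : Pos (f + g) := fun s p hp => by
  rw [ev_add _ _ hp]; exact add_nonneg (hf s p hp) (hg s p hp)
lemma Pos.mul {f g : Q X} (hf : Pos f) (hg : Pos g) : Pos (f * g) := fun s p hp => by
  rw [ev_mul _ _ hp]; exact mul_nonneg (hf s p hp) (hg s p hp)
lemma Pos_sq (f : Q X) : Pos (f * f) := fun s p hp => by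
  rw [ev_mul _ _ hp]; exact mul_self_nonneg _
lemma Pos_zero : Pos (0 : Q X) := fun s p hp => by rw [ev_zero hp]
lemma Pos_cst {c : X.S → ℝ} (h : ∀ s, 0 ≤ c s) : Pos (cst c) := fun s p hp => by
  rw [ev_cst _ hp]; exact h s
lemma Pos.I {f : Q X} (hf : Pos f) {s : X.S} {t : ℝ} (ht : t ∈ Tm s) : 0 ≤ I f s t :=
  I_nonneg ht fun _ hx => hf s _ (ev_box ht hx)

lemma GB_of_le {i : ℕ} {f g a : Q X} (hf : f ∈ GB i) (ha : a ∈ GLi) (hfp : Pos f) (hg : Pos g)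
    (h : Pos (a * f - g)) : g ∈ GB i := by
  obtain ⟨C, hC⟩ := ha
  obtain ⟨C', hC'⟩ := hf
  refine ⟨|C| * C', fun K => ?_⟩
  obtain ⟨τ, hτ, h1⟩ := hC K
  obtain ⟨τ', hτ', h2⟩ := hC' K
  refine ⟨min τ τ', lt_min hτ hτ', fun s hs t ht => ?_⟩
  rw [abs_of_nonneg (hg.I ht), mul_assoc]
  have h3 := (le_abs_self _).trans (h2 s ⟨hs.1.trans (min_le_right _ _), hs.2⟩ t ht)
  refine le_trans ?_ (mul_le_mul_of_nonneg_left h3 (abs_nonneg C))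
  rw [← I_cmul (fun _ => |C|) f ht]
  apply I_mono ht
  intro x hx
  have hp := ev_box ht hx
  have h4 := h s _ hp
  have h5 := h1 s ⟨hs.1.trans (min_le_left _ _), hs.2⟩ t ht x hx
  have h6 := hfp s _ hp
  rw [ev_sub _ _ hp, ev_mul _ _ hp] at h4
  rw [ev_mul _ _ hp, ev_cst _ hp]
  have := mul_le_mul_of_nonneg_right ((le_abs_self _).trans (h5.trans (le_abs_self _))) h6
  linarith

lemma GB_add_left {i : ℕ} {f g : Q X} (h : f + g ∈ GB i) (hf : Pos f) (hg : Pos g) : f ∈ GB i :=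
  GB_of_le h GLi.one_mem (hf.add hg) hf (by rw [one_mul, add_sub_cancel_left]; exact hg)
lemma GB_add_right {i : ℕ} {f g : Q X} (h : f + g ∈ GB i) (hf : Pos f) (hg : Pos g) : g ∈ GB i :=
  GB_add_left (by rwa [add_comm]) hg hf

/-- Time-integrated bound. -/
def TI (g : Q X) : Prop := ∃ C, ∀ K, ∃ τ > 0, ∀ s, Ok K τ s → ∀ t ∈ Tm s,
  ∫ r in (0:ℝ)..t, I g s r ≤ C * wt s t

lemma int_nonneg {g : Q X} (hg : Pos g) {s : X.S} {t : ℝ} (ht : t ∈ Tm s) :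
    0 ≤ ∫ r in (0:ℝ)..t, I g s r :=
  intervalIntegral.integral_nonneg ht.1 fun _ hr => hg.I ⟨hr.1, hr.2.trans ht.2⟩

lemma growth2 {e r g q : Q X} (he : e + r ∈ LB) (h : D 0 (e + r) + g + q ∈ LB) (hr : r ∈ GB 1)
    (pe : Pos e) (pg : Pos g) (pq : Pos q) : e ∈ GB 1 ∧ TI g := by
  obtain ⟨C, hC⟩ := growth he h (fun s t ht => pq.I ht)
  obtain ⟨C', hC'⟩ := hr
  have key : ∀ K, ∃ τ > 0, ∀ s, Ok K τ s → ∀ t ∈ Tm s,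
      I e s t + ∫ r in (0:ℝ)..t, I g s r ≤ (|C| + C') * wt s t := by
    intro K
    obtain ⟨τ, hτ, h1⟩ := hC K
    obtain ⟨τ', hτ', h2⟩ := hC' K
    refine ⟨min τ τ', lt_min hτ hτ', fun s hs t ht => ?_⟩
    have a1 := h1 s ⟨hs.1.trans (min_le_left _ _), hs.2⟩ t ht
    have a2 := (neg_abs_le _).trans' (neg_le_neg (h2 s ⟨hs.1.trans (min_le_right _ _), hs.2⟩ t ht))
    rw [I_add _ _ ht] at a1
    have := one_le_wt ht
    have h3 := le_abs_self C
    have h4 : |C| ≤ |C| * wt s t := le_mul_of_one_le_right (abs_nonneg _) this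
    rw [pow_one] at a2
    linarith
  refine ⟨⟨|C| + C', fun K => ?_⟩, ⟨|C| + C', fun K => ?_⟩⟩
  · obtain ⟨τ, hτ, h1⟩ := key K
    refine ⟨τ, hτ, fun s hs t ht => ?_⟩
    rw [abs_of_nonneg (pe.I ht), pow_one]
    linarith [h1 s hs t ht, int_nonneg pg ht]
  · obtain ⟨τ, hτ, h1⟩ := key K
    refine ⟨τ, hτ, fun s hs t ht => ?_⟩
    linarith [h1 s hs t ht, pe.I ht]

/-- Bounds on a boundary velocity component. -/
def Ub (u : Q X) : Prop := u ∈ Li ∧ (∀ i, D i u ∈ Li) ∧ (∀ i j, D i (D j u) ∈ Li) ∧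
  ∀ i j k, D i (D j (D k u)) ∈ L2

lemma Null_mul {c : X.S → ℝ} {k f : Q X} (hk : k = cst c) (h : f ∈ Null) : k * f ∈ Null := by
  rw [hk]; exact Null_cmul c h

/-- Surface-tension part of the boundary energy. -/
lemma sigma_part {η A11 A12 A22 R1 R2 u1 u2 : Q X} (h0 : η ∈ L2) (h1 : D 1 η ∈ L2) (h2 : D 2 η ∈ L2)
    (a11 : A11 ∈ Li) (a12 : A12 ∈ Li) (a22 : A22 ∈ Li) (b11 : ∀ i, D i A11 ∈ Li)
    (b12 : ∀ i, D i A12 ∈ Li) (b22 : ∀ i, D i A22 ∈ Li) (r1 : R1 ∈ L2) (r2 : R2 ∈ L2)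
    (s1 : ∀ i, D i R1 ∈ L2) (s2 : ∀ i, D i R2 ∈ L2) (hu1 : Ub u1) (hu2 : Ub u2) {m1 m2 : Q X}
    (e1 : m1 = A11 * D 1 η + A12 * D 2 η + R1) (e2 : m2 = A12 * D 1 η + A22 * D 2 η + R2) :
    2 * (-(D 1 m1 + D 2 m2) * (D 0 η + D 1 (u1 * η) + D 2 (u2 * η))) -
      D 0 ((A11 * (D 1 η * D 1 η) + 2 * (A12 * (D 1 η * D 2 η)) + A22 * (D 2 η * D 2 η)) +
        2 * (R1 * D 1 η + R2 * D 2 η)) ∈ LB := by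
  set om := D 0 η + D 1 (u1 * η) + D 2 (u2 * η) with hom
  have hm1 : m1 ∈ L2 := by rw [e1]; exact L2.add_mem (L2.add_mem (Li_L2 a11 h1) (Li_L2 a12 h2)) r1
  have hm2 : m2 ∈ L2 := by rw [e2]; exact L2.add_mem (L2.add_mem (Li_L2 a12 h1) (Li_L2 a22 h2)) r2
  -- bounded quadratic forms
  have q : ∀ {a : Q X}, a ∈ Li → ∀ {f g : Q X}, f ∈ L2 → g ∈ L2 → a * f * g ∈ LB :=
    fun ha _ _ hf hg => mul_LB (Li_L2 ha hf) hg
  have n1 := Null_LB (D1_Null (m1 * om))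
  have n2 := Null_LB (D2_Null (m2 * om))
  set S := A11 * (D 1 η * D 1 η) + 2 * (A12 * (D 1 η * D 2 η)) + A22 * (D 2 η * D 2 η) with hS
  set Z := 2 * (R1 * D 1 η + R2 * D 2 η) with hZ
  have n3 := Null_LB (D1_Null (u1 * (S + Z)))
  have n4 := Null_LB (D2_Null (u2 * (S + Z)))
  -- zeroth-order coefficient forms
  have f0 : ∀ i, ∀ w : Q X, w ∈ Li → w * D i A11 * D 1 η * D 1 η + 2 * (w * D i A12 * D 1 η * D 2 η) +
      w * D i A22 * D 2 η * D 2 η ∈ LB := fun i w hw => by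
    have h := q (Li.mul_mem hw (b12 i)) h1 h2
    rw [two_mul]
    exact LB.add_mem (LB.add_mem (q (Li.mul_mem hw (b11 i)) h1 h1) (LB.add_mem h h))
      (q (Li.mul_mem hw (b22 i)) h2 h2)
  have f1 : ∀ i, ∀ w : Q X, w ∈ Li → 2 * (w * D i R1 * D 1 η + w * D i R2 * D 2 η) ∈ LB := fun i w hw => by
    rw [two_mul]
    exact LB.add_mem (LB.add_mem (q hw (s1 i) h1) (q hw (s2 i) h2))
      (LB.add_mem (q hw (s1 i) h1) (q hw (s2 i) h2))
  have f2 : ∀ w : Q X, w ∈ Li → w * (S + Z) ∈ LB := fun w hw => by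
    have t1 := q (Li.mul_mem hw a12) h1 h2
    have t2 := LB.add_mem (q hw r1 h1) (q hw r2 h2)
    have := LB.add_mem (LB.add_mem (LB.add_mem (q (Li.mul_mem hw a11) h1 h1) (LB.add_mem t1 t1))
      (q (Li.mul_mem hw a22) h2 h2)) (LB.add_mem t2 t2)
    convert this using 1
    rw [hS, hZ]; ring
  have g1 : D 1 (D 1 u1) * η * m1 + D 1 (D 2 u2) * η * m1 + D 1 u1 * D 1 η * m1 + D 2 u2 * D 1 η * m1
      + D 1 u1 * D 1 η * m1 + D 1 u2 * D 2 η * m1 ∈ LB :=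
    LB.add_mem (LB.add_mem (LB.add_mem (LB.add_mem (LB.add_mem (q (hu1.2.2.1 1 1) h0 hm1)
      (q (hu2.2.2.1 1 2) h0 hm1)) (q (hu1.2.1 1) h1 hm1)) (q (hu2.2.1 2) h1 hm1))
      (q (hu1.2.1 1) h1 hm1)) (q (hu2.2.1 1) h2 hm1)
  have g2 : D 1 (D 2 u1) * η * m2 + D 2 (D 2 u2) * η * m2 + D 1 u1 * D 2 η * m2 + D 2 u2 * D 2 η * m2
      + D 2 u1 * D 1 η * m2 + D 2 u2 * D 2 η * m2 ∈ LB :=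
    LB.add_mem (LB.add_mem (LB.add_mem (LB.add_mem (LB.add_mem (q (hu1.2.2.1 1 2) h0 hm2)
      (q (hu2.2.2.1 2 2) h0 hm2)) (q (hu1.2.1 1) h2 hm2)) (q (hu2.2.1 2) h2 hm2))
      (q (hu1.2.1 2) h1 hm2)) (q (hu2.2.1 2) h2 hm2)
  have t0 := LB.neg_mem (LB.add_mem (LB.add_mem n1 n2) (LB.add_mem n1 n2))
  have t1 := LB.neg_mem (LB.add_mem (f0 0 1 Li.one_mem) (f1 0 1 Li.one_mem))
  have t2 := LB.add_mem (LB.add_mem g1 g2) (LB.add_mem g1 g2)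
  have t3 := LB.sub_mem (LB.sub_mem n3 (f2 _ (hu1.2.1 1))) (LB.add_mem (f0 1 _ hu1.1) (f1 1 _ hu1.1))
  have t4 := LB.sub_mem (LB.sub_mem n4 (f2 _ (hu2.2.1 2))) (LB.add_mem (f0 2 _ hu2.1) (f1 2 _ hu2.1))
  have := LB.add_mem (LB.add_mem (LB.add_mem t0 t1) t2) (LB.add_mem t3 t4)
  convert this using 1
  have d2 : ∀ i, D i (2 : Q X) = 0 := fun i => by
    rw [show (2 : Q X) = 1 + 1 by norm_num, map_add, D_one, add_zero]
  rw [D_mul 1 m1 om, D_mul 2 m2 om]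
  have E : 2 * (m1 * D 1 om + m2 * D 2 om) - D 0 (S + Z) = 
     -((1 * D 0 A11 * D 1 η * D 1 η + 2 * (1 * D 0 A12 * D 1 η * D 2 η) + 1 * D 0 A22 * D 2 η * D 2 η) +
       2 * (1 * D 0 R1 * D 1 η + 1 * D 0 R2 * D 2 η)) + 2 * (m1 * D 1 (D 1 (u1 * η) + D 2 (u2 * η)) +
         m2 * D 2 (D 1 (u1 * η) + D 2 (u2 * η))) := by
    rw [hom, hS, hZ, e1, e2]
    simp only [map_add, D_mul, d2, D_comm 1 0, D_comm 2 0, D_comm 2 1]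
    ring
  have E1 : D 1 (u1 * (S + Z)) = D 1 u1 * (S + Z) + (u1 * D 1 A11 * D 1 η * D 1 η +
      2 * (u1 * D 1 A12 * D 1 η * D 2 η) + u1 * D 1 A22 * D 2 η * D 2 η) +
      2 * (u1 * D 1 R1 * D 1 η + u1 * D 1 R2 * D 2 η) + 2 * u1 * (m1 * D 1 (D 1 η) + m2 * D 1 (D 2 η)) := by
    rw [hS, hZ, e1, e2]
    simp only [map_add, D_mul, d2, D_comm 2 1]
    ring
  have E2 : D 2 (u2 * (S + Z)) = D 2 u2 * (S + Z) + (u2 * D 2 A11 * D 1 η * D 1 η +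
      2 * (u2 * D 2 A12 * D 1 η * D 2 η) + u2 * D 2 A22 * D 2 η * D 2 η) +
      2 * (u2 * D 2 R1 * D 1 η + u2 * D 2 R2 * D 2 η) + 2 * u2 * (m1 * D 1 (D 2 η) + m2 * D 2 (D 2 η)) := by
    rw [hS, hZ, e1, e2]
    simp only [map_add, D_mul, d2, D_comm 2 1]
    ring
  have E3 : m1 * D 1 (D 1 (u1 * η) + D 2 (u2 * η)) + m2 * D 2 (D 1 (u1 * η) + D 2 (u2 * η)) =
      (D 1 (D 1 u1) * η * m1 + D 1 (D 2 u2) * η * m1 + D 1 u1 * D 1 η * m1 + D 2 u2 * D 1 η * m1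
      + D 1 u1 * D 1 η * m1 + D 1 u2 * D 2 η * m1) + (D 1 (D 2 u1) * η * m2 + D 2 (D 2 u2) * η * m2
      + D 1 u1 * D 2 η * m2 + D 2 u2 * D 2 η * m2 + D 2 u1 * D 1 η * m2 + D 2 u2 * D 2 η * m2) +
      u1 * (m1 * D 1 (D 1 η) + m2 * D 1 (D 2 η)) + u2 * (m1 * D 1 (D 2 η) + m2 * D 2 (D 2 η)) := by
    simp only [map_add, D_mul, D_comm 2 1]
    ring
  linear_combination E - E1 - E2 + 2 * E3

lemma Lp_sym (f g : Q X) : Lp f * g - f * Lp g ∈ Null := by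
  have := Null.add_mem (D1_Null (f * D 1 g - D 1 f * g)) (D2_Null (f * D 2 g - D 2 f * g))
  convert this using 1
  simp only [Lp, map_sub, D_mul]; ring

lemma Lp_weak (f g : Q X) : Lp f * g - (f * g + D 1 f * D 1 g + D 2 f * D 2 g) ∈ Null := by
  have := Null.neg_mem (Null.add_mem (D1_Null (D 1 f * g)) (D2_Null (D 2 f * g)))
  convert this using 1
  simp only [Lp, D_mul]; ring

lemma kap_l {c : X.S → ℝ} {k η u : Q X} (hk : k = cst c) (k0 : k * η ∈ Li) (k1 : ∀ i, i ≠ 0 → k * D i η ∈ L2)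
    (k2 : ∀ i j, i ≠ 0 → j ≠ 0 → k * D i (D j η) ∈ L2) (hu : Ub u) (l : Fin 4) (hl : l = 1 ∨ l = 2) :
    2 * (k * k * (Lp η * Lp (D l (u * η)))) ∈ LB := by
  have kL : k * Lp η ∈ L2 := by
    have := L2.sub_mem (L2.sub_mem (Li_le k0) (k2 1 1 (by decide) (by decide))) (k2 2 2 (by decide) (by decide))
    convert this using 1
    rw [Lp]; ring
  have l0 : l ≠ 0 := by rcases hl with h | h <;> rw [h] <;> decide
  have nl : ∀ f : Q X, D l f ∈ Null := by
    rcases hl with h | h <;> rw [h]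
    · exact D1_Null
    · exact D2_Null
  have kc : ∀ i, D i k = 0 := fun i => by rw [hk, D_cst]
  have a1 : k * D l (D 1 (D 1 u) * η + D 2 (D 2 u) * η + 2 * (D 1 u * D 1 η + D 2 u * D 2 η)) ∈ L2 := by
    have hb : ∀ i, i ≠ 0 → k * D l (D i u * D i η) ∈ L2 := fun i hi => by
      have := L2.add_mem (Li_L2 (hu.2.1 i) (k2 l i l0 hi)) (Li_L2 (hu.2.2.1 l i) (k1 i hi))
      convert this using 1
      rw [D_mul]; ring
    have hc : ∀ i, k * D l (D i (D i u) * η) ∈ L2 := fun i => by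
      have := L2.add_mem (Li_L2 (hu.2.2.1 i i) (k1 l l0)) (Li_L2 k0 (hu.2.2.2 l i i))
      convert this using 1
      rw [D_mul]; ring
    have t := L2.add_mem (hb 1 (by decide)) (hb 2 (by decide))
    have := L2.add_mem (L2.add_mem (hc 1) (hc 2)) (L2.add_mem t t)
    convert this using 1
    rw [two_mul]
    simp only [map_add]; ring
  have a2 := mul_LB kL a1
  have a3 := Null_LB (nl (u * (k * Lp η * (k * Lp η))))
  have a4 := mul_LB (Li_L2 (hu.2.1 l) kL) kL
  have := LB.sub_mem (LB.add_mem a3 a4) (LB.add_mem a2 a2)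
  convert this using 1
  have e : Lp (D l (u * η)) = D l (u * Lp η) - D l (D 1 (D 1 u) * η + D 2 (D 2 u) * η +
      2 * (D 1 u * D 1 η + D 2 u * D 2 η)) := by
    rw [← map_sub, two_mul]
    have : Lp (D l (u * η)) = D l (Lp (u * η)) := by
      simp only [Lp, map_sub]; rw [D_comm l 1, D_comm l 1 (u * η), D_comm l 2, D_comm l 2 (u * η)]
    rw [this]
    congr 1
    simp only [Lp, map_add, D_mul]; ring
  rw [e]
  generalize D l (D 1 (D 1 u) * η + D 2 (D 2 u) * η + 2 * (D 1 u * D 1 η + D 2 u * D 2 η)) = w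
  generalize Lp η = m
  simp only [D_mul, kc]; ring

lemma Lp_add (f g : Q X) : Lp (f + g) = Lp f + Lp g := by simp only [Lp, map_add]; ring
lemma Lp_D (i : Fin 4) (f : Q X) : Lp (D i f) = D i (Lp f) := by
  simp only [Lp, map_sub]; rw [D_comm i 1, D_comm i 1 f, D_comm i 2, D_comm i 2 f]

/-- Regularization part of the boundary energy. -/
lemma kappa_part {c : X.S → ℝ} {k η u1 u2 : Q X} (hk : k = cst c) (k0 : k * η ∈ Li)
    (k1 : ∀ i, i ≠ 0 → k * D i η ∈ L2)
    (k2 : ∀ i j, i ≠ 0 → j ≠ 0 → k * D i (D j η) ∈ L2) (hu1 : Ub u1) (hu2 : Ub u2) :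
    2 * ((k * k * Lp (Lp η)) * (D 0 η + D 1 (u1 * η) + D 2 (u2 * η))) - D 0 (k * k * (Lp η * Lp η)) ∈ LB := by
  have a1 := kap_l hk k0 k1 k2 hu1 1 (Or.inl rfl)
  have a2 := kap_l hk k0 k1 k2 hu2 2 (Or.inr rfl)
  have kc : ∀ i, D i k = 0 := fun i => by rw [hk, D_cst]
  have a3 := Null_LB (Null_mul hk (Null_mul hk (Lp_sym (Lp η) (D 0 η + D 1 (u1 * η) + D 2 (u2 * η)))))
  have := LB.add_mem (LB.add_mem a1 a2) (LB.add_mem a3 a3)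
  convert this using 1
  simp only [Lp_add, Lp_D 0]
  simp only [D_mul, kc]; ring

/-- Damping part of the boundary energy. -/
lemma damp_part {c : X.S → ℝ} {k η u1 u2 : Q X} (hk : k = cst c) (k0 : k * η ∈ Li)
    (k1 : ∀ i, i ≠ 0 → k * D i η ∈ L2)
    (k2 : ∀ i j, i ≠ 0 → j ≠ 0 → k * D i (D j η) ∈ L2) (hu1 : Ub u1) (hu2 : Ub u2) :
    ∃ q, Pos q ∧ 2 * ((k * k * Lp (D 0 η)) * (D 0 η + D 1 (u1 * η) + D 2 (u2 * η))) -
      (k * k * (D 0 η * D 0 η + D 1 (D 0 η) * D 1 (D 0 η) + D 2 (D 0 η) * D 2 (D 0 η))) - q ∈ LB := by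
  set g := D 1 (u1 * η) + D 2 (u2 * η) with hg
  refine ⟨k * (D 0 η + g) * (k * (D 0 η + g)) + k * D 1 (D 0 η + g) * (k * D 1 (D 0 η + g)) +
    k * D 2 (D 0 η + g) * (k * D 2 (D 0 η + g)), ((Pos_sq _).add (Pos_sq _)).add (Pos_sq _), ?_⟩
  have g0 : ∀ u : Q X, Ub u → ∀ l, l ≠ 0 → k * D l (u * η) ∈ L2 := fun u hu l hl => by
    have := L2.add_mem (Li_L2 hu.1 (k1 l hl)) (Li_L2 (hu.2.1 l) (Li_le k0))
    convert this using 1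
    rw [D_mul]; ring
  have g1 : ∀ u : Q X, Ub u → ∀ i l, i ≠ 0 → l ≠ 0 → k * D i (D l (u * η)) ∈ L2 := fun u hu i l hi hl => by
    have := L2.add_mem (L2.add_mem (Li_L2 hu.1 (k2 i l hi hl)) (Li_L2 (hu.2.1 i) (k1 l hl)))
      (L2.add_mem (Li_L2 (hu.2.1 l) (k1 i hi)) (Li_L2 (hu.2.2.1 i l) (Li_le k0)))
    convert this using 1
    simp only [D_mul, map_add]; ring
  have b0 : k * g ∈ L2 := by
    rw [hg, mul_add]; exact L2.add_mem (g0 u1 hu1 1 (by decide)) (g0 u2 hu2 2 (by decide))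
  have b1 : ∀ i, i ≠ 0 → k * D i g ∈ L2 := fun i hi => by
    rw [hg, map_add, mul_add]
    exact L2.add_mem (g1 u1 hu1 i 1 hi (by decide)) (g1 u2 hu2 i 2 hi (by decide))
  have a3 := Null_LB (Null_mul hk (Null_mul hk (Lp_weak (D 0 η) (D 0 η + g))))
  have a4 := LB.add_mem (LB.add_mem (mul_LB b0 b0) (mul_LB (b1 1 (by decide)) (b1 1 (by decide))))
    (mul_LB (b1 2 (by decide)) (b1 2 (by decide)))
  have := LB.sub_mem (LB.add_mem a3 a3) a4
  convert this using 1
  simp only [map_add (D 1), map_add (D 2)]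
  rw [add_assoc (D 0 η), ← hg]
  ring

end EE

namespace EE
open scoped ContDiff
open MeasureTheory Set Filter Topology

variable {X : Ctx}

lemma co3r {γ : List (Fin 4)} (hγ : γ.length = 3) {f g : Q X} (hf : f ∈ Cl 4 2) (hg : g ∈ Cl 3 1) :
    g * Dw γ f + cm γ f g ∈ L2 ∧ ∀ i, D i (g * Dw γ f + cm γ f g) ∈ L2 := by
  have h := cm_mem' hγ (by norm_num) f g
  refine ⟨L2.add_mem (Li_L2 (Cl_Li hg) (hf.1 γ (by omega)))
    (Sp_L2 hf hg (m := 1) (n := 3) (fun a b _ _ _ => by omega) h), fun i => ?_⟩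
  rw [map_add, D_mul]
  exact L2.add_mem (L2.add_mem (Li_L2 (Cl_Li hg) (hf.1 (i :: γ) (by simp; omega)))
      (L2_Li (hf.1 γ (by omega)) (hg.2 [i] (by simp))))
    (Sp_L2 hf hg (m := 1) (n := 4) (fun a b _ _ _ => by omega) (D_Sp h i))

lemma Dw_Lp (γ : List (Fin 4)) (f : Q X) : Dw γ (Lp f) = Lp (Dw γ f) := by
  simp only [Lp, map_sub, Dw_D]

lemma cst_GB {i : ℕ} {f : Q X} (c : ℝ) (hf : f ∈ GB i) : cst (fun _ => c) * f ∈ GB i := by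
  rw [← smul_eq_cst]; exact (GB i).smul_mem c hf

namespace Sys
variable (Y : Sys X)

/-- Coefficients of the linearized mean curvature. -/
def A11 : Q X := Y.nn - Y.nn * Y.nn * Y.nn * (D 1 Y.psi * D 1 Y.psi)
/-- Coefficients of the linearized mean curvature. -/
def A12 : Q X := - (Y.nn * Y.nn * Y.nn * (D 1 Y.psi * D 2 Y.psi))
/-- Coefficients of the linearized mean curvature. -/
def A22 : Q X := Y.nn - Y.nn * Y.nn * Y.nn * (D 2 Y.psi * D 2 Y.psi)

lemma nn3_Cl : Y.nn * Y.nn * Y.nn ∈ Cl 4 2 :=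
  Cl_mul (by norm_num) (Cl_mul (by norm_num) Y.nn_Cl Y.nn_Cl) Y.nn_Cl
lemma pp_Cl (i j : Fin 4) (hi : i ≠ 0) (hj : j ≠ 0) : D i Y.psi * D j Y.psi ∈ Cl 4 2 :=
  Cl_mul (by norm_num) (Y.p_Cl i hi) (Y.p_Cl j hj)
lemma A11_Cl : Y.A11 ∈ Cl 4 2 := (Cl 4 2).sub_mem Y.nn_Cl
  (Cl_mul (by norm_num) Y.nn3_Cl (Y.pp_Cl 1 1 (by decide) (by decide)))
lemma A12_Cl : Y.A12 ∈ Cl 4 2 := (Cl 4 2).neg_mem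
  (Cl_mul (by norm_num) Y.nn3_Cl (Y.pp_Cl 1 2 (by decide) (by decide)))
lemma A22_Cl : Y.A22 ∈ Cl 4 2 := (Cl 4 2).sub_mem Y.nn_Cl
  (Cl_mul (by norm_num) Y.nn3_Cl (Y.pp_Cl 2 2 (by decide) (by decide)))

lemma D_np1 (i : Fin 4) : D i (Y.nn * D 1 Y.psi) = Y.A11 * D i (D 1 Y.psi) + Y.A12 * D i (D 2 Y.psi) := by
  rw [D_mul, Y.D_nn, A11, A12]; ring
lemma D_np2 (i : Fin 4) : D i (Y.nn * D 2 Y.psi) = Y.A12 * D i (D 1 Y.psi) + Y.A22 * D i (D 2 Y.psi) := by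
  rw [D_mul, Y.D_nn, A12, A22]; ring

/-- Remainder of the linearized curvature. -/
def Rm (γ : List (Fin 4)) (z : Fin 4) (a b : Q X) : Q X :=
  (D z (D 1 Y.psi) * Dw γ a + cm γ a (D z (D 1 Y.psi))) +
  (D z (D 2 Y.psi) * Dw γ b + cm γ b (D z (D 2 Y.psi)))

section bnd
variable {γ : List (Fin 4)} {z : Fin 4}

lemma Rm_L2 (hγ : γ.length = 3) {a b : Q X} (ha : a ∈ Cl 4 2) (hb : b ∈ Cl 4 2) :
    Y.Rm γ z a b ∈ L2 ∧ ∀ i, D i (Y.Rm γ z a b) ∈ L2 := by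
  have h1 := co3r hγ ha (Cl_D (Y.p_Cl 1 (by decide)) z)
  have h2 := co3r hγ hb (Cl_D (Y.p_Cl 2 (by decide)) z)
  refine ⟨L2.add_mem h1.1 h2.1, fun i => ?_⟩
  rw [Rm, map_add]
  exact L2.add_mem (h1.2 i) (h2.2 i)

lemma Rm_eq (a b : Q X) : Dw γ (a * D z (D 1 Y.psi) + b * D z (D 2 Y.psi)) =
    a * D 1 (Dw (z :: γ) Y.psi) + b * D 2 (Dw (z :: γ) Y.psi) + Y.Rm γ z a b := by
  simp only [map_add, cm_eq, Rm, Dw_D, Dw_cons]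
  rw [D_comm z 1 (Dw γ Y.psi), D_comm z 2 (Dw γ Y.psi)]; ring

lemma m1_eq : Dw (z :: γ) (Y.nn * D 1 Y.psi) = Y.A11 * D 1 (Dw (z :: γ) Y.psi) +
    Y.A12 * D 2 (Dw (z :: γ) Y.psi) + Y.Rm γ z Y.A11 Y.A12 := by
  rw [Dw_cons, ← Dw_D, D_np1, Rm_eq]
lemma m2_eq : Dw (z :: γ) (Y.nn * D 2 Y.psi) = Y.A12 * D 1 (Dw (z :: γ) Y.psi) +
    Y.A22 * D 2 (Dw (z :: γ) Y.psi) + Y.Rm γ z Y.A12 Y.A22 := by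
  rw [Dw_cons, ← Dw_D, D_np2, Rm_eq]

lemma tr_q (h3 : 3 ∉ γ) : tr (Dw γ Y.q) = - Y.sg * (D 1 (Dw γ (Y.nn * D 1 Y.psi)) +
    D 2 (Dw γ (Y.nn * D 2 Y.psi))) + Y.sk * Y.sk * Lp (Lp (Dw γ Y.psi)) +
    Y.sk * Y.sk * Lp (D 0 (Dw γ Y.psi)) := by
  have e : tr Y.q = - (Y.sg * (D 1 (Y.nn * D 1 Y.psi) + D 2 (Y.nn * D 2 Y.psi))) +
    cst Y.κ * Lp (Lp Y.psi) + cst Y.κ * Lp (D 0 Y.psi) := by rw [Y.press, Y.sk_sq]; ring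
  rw [← Dw_tr h3, e, Pre.sg]
  simp only [map_add, map_neg, Dw_cst_mul, Dw_Lp, Dw_D, Y.sk_sq]
  ring

lemma D3_eta (γ : List (Fin 4)) : D 3 (Dw γ Y.psi) = 0 := by rw [← Dw_D, Y.D3_psi, map_zero]

lemma eta_L2 (hγ : γ.length = 4) : Dw γ Y.psi ∈ L2 :=
  Y.psi_L2 γ (by omega) ((List.count_le_length).trans (by omega))
lemma eta1_L2 (hγ : γ.length = 4) (i : Fin 4) (hi : i ≠ 0) : D i (Dw γ Y.psi) ∈ L2 :=
  Y.psi_L2 (i :: γ) (by simp; omega) (by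
    rw [List.count_cons_of_ne hi]; exact (List.count_le_length).trans (by omega))
lemma eta1_L2E (hγ : γ.length = 4) (i : Fin 4) (hi : i ≠ 0) : D i (Dw γ Y.psi) ∈ L2w 2 :=
  Y.psi_L2E (i :: γ) (by simp; omega) (by
    rw [List.count_cons_of_ne hi]; exact (List.count_le_length).trans (by omega))
lemma keta (hγ : γ.length = 4) : Y.sk * Dw γ Y.psi ∈ L2 :=
  Y.skpsi_L2 γ (by omega) ((List.count_le_length).trans (by omega))
lemma keta1 (hγ : γ.length = 4) (i : Fin 4) (hi : i ≠ 0) : Y.sk * D i (Dw γ Y.psi) ∈ L2 :=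
  Y.skpsi_L2 (i :: γ) (by simp; omega) (by
    rw [List.count_cons_of_ne hi]; exact (List.count_le_length).trans (by omega))
lemma keta2 (hγ : γ.length = 4) (i j : Fin 4) (hi : i ≠ 0) (hj : j ≠ 0) :
    Y.sk * D i (D j (Dw γ Y.psi)) ∈ L2 :=
  Y.skpsi_L2 (i :: j :: γ) (by simp; omega) (by
    rw [List.count_cons_of_ne hi, List.count_cons_of_ne hj]
    exact (List.count_le_length).trans (by omega))
lemma ketaLi (hγ : γ.length = 4) : Y.sk * Dw γ Y.psi ∈ Li := by
  refine Li_of_sob (Y.keta hγ) (fun i => ?_) (fun i j => ?_)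
  · rw [Pre.sk, D_cst_mul]; exact Y.keta1 hγ _ (Fin.succ_ne_zero i)
  · rw [Pre.sk, D_cst_mul, D_cst_mul]
    exact Y.keta2 hγ _ _ (Fin.succ_ne_zero i) (Fin.succ_ne_zero j)

lemma u_Ub (i : Fin 3) : Ub (tr (Y.v i)) := by
  have key : ∀ γ : List (Fin 4), (γ.length ≤ 2 → Dw γ (tr (Y.v i)) ∈ Li) ∧
      (γ.length ≤ 3 → Dw γ (tr (Y.v i)) ∈ L2) := by
    intro γ
    by_cases h3 : 3 ∈ γ
    · have : Dw γ (tr (Y.v i)) = 0 := by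
        rw [Dw_perm (List.perm_cons_erase h3), Dw_cons, ← Dw_D, D3_tr, map_zero]
      rw [this]
      exact ⟨fun _ => Li.zero_mem, fun _ => L2.zero_mem⟩
    · rw [Dw_tr h3]
      exact ⟨fun h => tr_Li ((Y.v_Cl i).2 γ h), fun h => tr_L2 ((Y.v_Cl i).1 γ (by omega))
        ((Y.v_Cl i).1 (3 :: γ) (by simp; omega))⟩
  exact ⟨(key []).1 (by simp), fun j => (key [j]).1 (by simp), fun j k => (key [j, k]).1 (by simp),
    fun j k l => (key [j, k, l]).2 (by simp)⟩

/-- Surface energy density. -/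
def SE (γ : List (Fin 4)) : Q X := Y.A11 * (D 1 (Dw γ Y.psi) * D 1 (Dw γ Y.psi)) +
  2 * (Y.A12 * (D 1 (Dw γ Y.psi) * D 2 (Dw γ Y.psi))) + Y.A22 * (D 2 (Dw γ Y.psi) * D 2 (Dw γ Y.psi))

lemma nn_ev {s : X.S} {p : Pt} (hp : p ∈ Box X s) :
    ev Y.nn s p * ev Y.nn s p * (1 + ev (D 1 Y.psi) s p * ev (D 1 Y.psi) s p +
      ev (D 2 Y.psi) s p * ev (D 2 Y.psi) s p) = 1 := by
  have := congrArg (fun f => ev f s p) Y.nn_eq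
  simpa only [ev_mul _ _ hp, ev_add _ _ hp, ev_one hp] using this

lemma SE_ge {s : X.S} {p : Pt} (hp : p ∈ Box X s) : ev Y.nn s p ^ 3 *
    (ev (D 1 (Dw γ Y.psi)) s p ^ 2 + ev (D 2 (Dw γ Y.psi)) s p ^ 2) ≤ ev (Y.SE γ) s p := by
  have h := Y.nn_ev hp
  have h2 : (2 : Q X) = 1 + 1 := by norm_num
  rw [SE, A11, A12, A22, h2]
  simp only [ev_mul _ _ hp, ev_add _ _ hp, ev_sub _ _ hp, ev_neg _ hp, ev_one hp]
  have hn := (Y.nn_pos s p hp).1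
  generalize ev Y.nn s p = n at *
  generalize ev (D 1 Y.psi) s p = p1 at *
  generalize ev (D 2 Y.psi) s p = p2 at *
  generalize ev (D 1 (Dw γ Y.psi)) s p = x at *
  generalize ev (D 2 (Dw γ Y.psi)) s p = y at *
  have k : 0 ≤ n ^ 3 * (p1 * y - p2 * x) ^ 2 := by positivity
  have e : n = n ^ 3 * (1 + p1 * p1 + p2 * p2) := by linear_combination (-n) * h
  have e2 : n * (x ^ 2 + y ^ 2) = n ^ 3 * (1 + p1 * p1 + p2 * p2) * (x ^ 2 + y ^ 2) := by rw [← e]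
  linarith

lemma SE_Pos (γ : List (Fin 4)) : Pos (Y.SE γ) := fun s p hp => by
  have hn := (Y.nn_pos s p hp).1
  exact le_trans (by positivity) (Y.SE_ge hp)

lemma SE_coer (γ : List (Fin 4)) : Pos ((1 + D 1 Y.psi * D 1 Y.psi + D 2 Y.psi * D 2 Y.psi) *
    (1 + D 1 Y.psi * D 1 Y.psi + D 2 Y.psi * D 2 Y.psi) * Y.SE γ -
    (D 1 (Dw γ Y.psi) * D 1 (Dw γ Y.psi) + D 2 (Dw γ Y.psi) * D 2 (Dw γ Y.psi))) := fun s p hp => by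
  have h1 := Y.SE_ge (γ := γ) hp
  have h := Y.nn_ev hp
  have hn := Y.nn_pos s p hp
  simp only [ev_mul _ _ hp, ev_add _ _ hp, ev_sub _ _ hp, ev_one hp]
  generalize ev (Y.SE γ) s p = S at *
  generalize ev Y.nn s p = n at *
  generalize ev (D 1 Y.psi) s p = p1 at *
  generalize ev (D 2 Y.psi) s p = p2 at *
  generalize ev (D 1 (Dw γ Y.psi)) s p = x at *
  generalize ev (D 2 (Dw γ Y.psi)) s p = y at *
  set P := 1 + p1 * p1 + p2 * p2 with hP
  have hP0 : 0 ≤ P := by nlinarith [mul_self_nonneg p1, mul_self_nonneg p2]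
  have hP1 : 1 ≤ n * P := by nlinarith [hn.1, hn.2]
  have h3 := mul_le_mul_of_nonneg_left h1 (mul_nonneg hP0 hP0)
  have h4 : P * P * (n ^ 3 * (x ^ 2 + y ^ 2)) = (n * P) * (x ^ 2 + y ^ 2) := by
    linear_combination (n * P * (x ^ 2 + y ^ 2)) * h
  have h5 := mul_le_mul_of_nonneg_right hP1 (show 0 ≤ x ^ 2 + y ^ 2 by positivity)
  linarith

/-- Total interior density. -/
def eT (γ : List (Fin 4)) : Q X := Y.eD γ 0 + Y.eD γ 1 + Y.eD γ 2
/-- Damping density. -/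
def dm (γ : List (Fin 4)) : Q X := D 0 (Dw γ Y.psi) * D 0 (Dw γ Y.psi) +
  D 1 (D 0 (Dw γ Y.psi)) * D 1 (D 0 (Dw γ Y.psi)) + D 2 (D 0 (Dw γ Y.psi)) * D 2 (D 0 (Dw γ Y.psi))

lemma eD_Pos (γ : List (Fin 4)) (i : Fin 3) : Pos (Y.eD γ i) :=
  (Pos_sq _).add (((Pos_sq _).add (Pos_sq _)).add (Pos_sq _))
lemma eT_Pos (γ : List (Fin 4)) : Pos (Y.eT γ) :=
  ((Y.eD_Pos γ 0).add (Y.eD_Pos γ 1)).add (Y.eD_Pos γ 2)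
lemma dm_Pos (γ : List (Fin 4)) : Pos (Y.dm γ) := ((Pos_sq _).add (Pos_sq _)).add (Pos_sq _)
lemma J_Pos : Pos Y.J := fun s p hp => le_trans (by norm_num) (Y.J_pos s p hp)

lemma eD_LB (hγ : γ.length = 4) (i : Fin 3) : Y.J * Y.eD γ i ∈ LB := by
  have h : ∀ f : Q X, f ∈ Cl 4 2 → Y.J * (Y.gu γ f * Y.gu γ f) ∈ LB := fun f hf => by
    rw [← mul_assoc]; exact mul_LB (Li_L2 Y.J_Li (Y.gu_L2 hγ hf)) (Y.gu_L2 hγ hf)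
  rw [eD]; simp only [mul_add]
  exact LB.add_mem (h _ (Y.v_Cl i)) (LB.add_mem (LB.add_mem (h _ (Y.F_Cl 0 i)) (h _ (Y.F_Cl 1 i)))
    (h _ (Y.F_Cl 2 i)))

/-- The tangential energy estimate. -/
lemma tan_est (hγ : γ.length = 3) (h3' : 3 ∉ z :: γ) :
    Y.J * Y.eT (z :: γ) ∈ GB 1 ∧ Y.SE (z :: γ) ∈ GB 1 ∧
    Y.sk * Y.sk * (Lp (Dw (z :: γ) Y.psi) * Lp (Dw (z :: γ) Y.psi)) ∈ GB 1 ∧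
    TI (Y.sk * Y.sk * Y.dm (z :: γ)) := by
  have h3 := h3'
  simp only [List.mem_cons, not_or] at h3
  have hl : (z :: γ).length = 4 := by simp [hγ]
  obtain ⟨y, yG, yL, hy⟩ := Y.Y_term hγ (Ne.symm h3.1)
  set η := Dw (z :: γ) Y.psi with hη
  set R1 := Y.Rm γ z Y.A11 Y.A12 with hR1
  set R2 := Y.Rm γ z Y.A12 Y.A22 with hR2
  have r1 := Y.Rm_L2 (z := z) hγ Y.A11_Cl Y.A12_Cl
  have r2 := Y.Rm_L2 (z := z) hγ Y.A12_Cl Y.A22_Cl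
  have c1 := fun i => (Y.A11_Cl).2 [i] (by simp)
  have c2 := fun i => (Y.A12_Cl).2 [i] (by simp)
  have c3 := fun i => (Y.A22_Cl).2 [i] (by simp)
  have e1 := Y.eta1_L2 hl 1 (by decide)
  have e2 := Y.eta1_L2 hl 2 (by decide)
  have sp := sigma_part (Y.eta_L2 hl) e1 e2 (Cl_Li Y.A11_Cl) (Cl_Li Y.A12_Cl) (Cl_Li Y.A22_Cl) c1 c2 c3
    r1.1 r2.1 r1.2 r2.2 (Y.u_Ub 0) (Y.u_Ub 1) Y.m1_eq Y.m2_eq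
  have kp := kappa_part (k := Y.sk) rfl (Y.ketaLi hl) (Y.keta1 hl) (Y.keta2 hl) (Y.u_Ub 0) (Y.u_Ub 1)
  obtain ⟨q, qP, dp⟩ := damp_part (k := Y.sk) rfl (Y.ketaLi hl) (Y.keta1 hl) (Y.keta2 hl) (Y.u_Ub 0) (Y.u_Ub 1)
  have wn := Null_LB (Y.W_Null h3' hl (Dw (z :: γ) Y.q))
  have gE := LB.add_mem (LB.add_mem (Y.gu_EN hl 0) (Y.gu_EN hl 1)) (Y.gu_EN hl 2)
  have bL : ∀ f : Q X, f ∈ LB → bb * f ∈ LB := fun f hf =>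
    mul_cst_LB (C := X.b) (fun _ => (abs_of_pos X.hb).le) hf
  have sL : ∀ f : Q X, f ∈ LB → Y.sg * f ∈ LB := fun f hf =>
    mul_cst_LB (C := |Y.σ|) (fun _ => le_rfl) hf
  set S := Y.SE (z :: γ) with hS
  set Z := 2 * (R1 * D 1 η + R2 * D 2 η) with hZ
  set k2 := Y.sk * Y.sk * (Lp η * Lp η) with hk2
  set e := bb * (Y.J * Y.eT (z :: γ)) + Y.sg * S + k2 with he
  set r := Y.sg * Z - bb * (y + y) with hr
  have pS := Y.SE_Pos (z :: γ)
  have pb : Pos (bb : Q X) := Pos_cst fun _ => X.hb.le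
  have psg : Pos Y.sg := Pos_cst fun _ => Y.hσ.le
  have psk : Pos (Y.sk * Y.sk) := Pos_sq _
  have pJ := Y.J_Pos.mul (Y.eT_Pos (z :: γ))
  have p1 : Pos (bb * (Y.J * Y.eT (z :: γ))) := pb.mul pJ
  have p2 : Pos (Y.sg * S) := psg.mul pS
  have p3 : Pos k2 := psk.mul (Pos_sq _)
  have SL : S ∈ LB := by
    have q : ∀ {a : Q X}, a ∈ Li → ∀ {f g : Q X}, f ∈ L2 → g ∈ L2 → a * f * g ∈ LB :=
      fun ha _ _ hf hg => mul_LB (Li_L2 ha hf) hg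
    have t := q (Cl_Li Y.A12_Cl) e1 e2
    have := LB.add_mem (LB.add_mem (q (Cl_Li Y.A11_Cl) e1 e1) (LB.add_mem t t)) (q (Cl_Li Y.A22_Cl) e2 e2)
    convert this using 1
    rw [hS, SE]; ring
  have ZL : Z ∈ LB := by
    have := LB.add_mem (mul_LB r1.1 e1) (mul_LB r2.1 e2)
    rw [hZ, two_mul]; exact LB.add_mem this this
  have kL : Y.sk * Lp η ∈ L2 := by
    have := L2.sub_mem (L2.sub_mem (Y.keta hl) (Y.keta2 hl 1 1 (by decide) (by decide)))
      (Y.keta2 hl 2 2 (by decide) (by decide))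
    convert this using 1
    rw [Lp, ← hη]; ring
  have k2L : k2 ∈ LB := by
    have := mul_LB kL kL
    convert this using 1
    rw [hk2]; ring
  have JL : Y.J * Y.eT (z :: γ) ∈ LB := by
    rw [eT, mul_add, mul_add]
    exact LB.add_mem (LB.add_mem (Y.eD_LB hl 0) (Y.eD_LB hl 1)) (Y.eD_LB hl 2)
  have rG : r ∈ GB 1 := by
    have h1 : R1 * D 1 η + R2 * D 2 η ∈ GB 1 := (GB 1).add_mem
      (mul_GB (L2w_of r1.1 (r1.2 0)) (Y.eta1_L2E hl 1 (by decide)))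
      (mul_GB (L2w_of r2.1 (r2.2 0)) (Y.eta1_L2E hl 2 (by decide)))
    rw [hr, hZ, two_mul]
    exact (GB 1).sub_mem (cst_GB _ ((GB 1).add_mem h1 h1)) (cst_GB _ ((GB 1).add_mem yG yG))
  have eL : e + r ∈ LB := LB.add_mem (LB.add_mem (LB.add_mem (bL _ JL) (sL _ SL)) k2L)
    (LB.sub_mem (sL _ ZL) (bL _ (LB.add_mem yL yL)))
  have main : D 0 (e + r) + Y.sk * Y.sk * Y.dm (z :: γ) + q ∈ LB := by
    have sp' := sL _ sp
    have t1 := LB.sub_mem (bL _ gE) (LB.add_mem wn wn)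
    have t2 := LB.add_mem t1 (bL _ (LB.add_mem hy hy))
    have := LB.sub_mem (LB.sub_mem (LB.sub_mem t2 sp') kp) dp
    convert this using 1
    have vf := Y.V_flux (z :: γ) (Dw (z :: γ) Y.q)
    have tw := Y.tr_W3 h3'
    have tq := Y.tr_q h3'
    have eD' : D 0 (e + r) = bb * (D 0 (Y.J * Y.eD (z :: γ) 0) + D 0 (Y.J * Y.eD (z :: γ) 1) +
        D 0 (Y.J * Y.eD (z :: γ) 2)) + Y.sg * D 0 (S + Z) + D 0 k2 - bb * (D 0 y + D 0 y) := by
      have db : ∀ f : Q X, D 0 (bb * f) = bb * D 0 f := fun f => D_cst_mul 0 _ f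
      have ds : ∀ f : Q X, D 0 (Y.sg * f) = Y.sg * D 0 f := fun f => D_cst_mul 0 _ f
      simp only [he, hr, map_add, map_sub, db, ds, eT, mul_add]; ring
    rw [hS, SE] at eD'
    rw [eD', dm]
    linear_combination (-2 * bb) * vf - 2 * tr (Dw (z :: γ) Y.q) * tw - 2 * (D 0 (Dw (z :: γ) Y.psi) +
      D 1 (tr (Y.v 0) * Dw (z :: γ) Y.psi) + D 2 (tr (Y.v 1) * Dw (z :: γ) Y.psi)) * tq
  obtain ⟨a, b⟩ := growth2 eL main rG ((p1.add p2).add p3) (psk.mul (Y.dm_Pos _)) qP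
  have a12 := GB_add_left a (p1.add p2) p3
  have hc : ∀ c : ℝ, c ≠ 0 → ∀ f : Q X, cst (fun _ => c) * f ∈ GB 1 → f ∈ GB 1 := fun c h0 f hf => by
    have := cst_GB c⁻¹ hf
    rwa [← mul_assoc, cst_mul_cst, inv_mul_cancel₀ h0, cst_one, one_mul] at this
  exact ⟨hc _ X.hb.ne' _ (GB_add_left a12 p1 p2), hc _ Y.hσ.ne' _ (GB_add_right a12 p1 p2),
    GB_add_right a (p1.add p2) p3, b⟩

end bnd
end Sys
end EE

namespace EE
open scoped ContDiff
open MeasureTheory Set Filter Topology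

variable {X : Ctx}

lemma L2w0_of {f : Q X} (hf : f ∈ L2) (h0 : D 0 (f * f) ∈ LB) : f ∈ L2w 0 := by
  obtain ⟨C, hC⟩ := growth (e := f * f) (g := 0) (q := 0) hf (by rwa [add_zero, add_zero])
    (fun s t ht => (I_zero ht).ge)
  refine ⟨C, fun K => ?_⟩
  obtain ⟨τ, hτ, h⟩ := hC K
  refine ⟨τ, hτ, fun s hs t ht => ?_⟩
  rw [abs_of_nonneg (I_sq_nonneg f ht), pow_zero, mul_one]
  have := h s hs t ht
  have := int_nonneg Pos_zero ht
  linarith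

lemma D_two (i : Fin 4) : D i (2 : Q X) = 0 := by
  rw [show (2 : Q X) = 1 + 1 by norm_num, map_add, D_one, add_zero]

lemma two_GLi : (2 : Q X) ∈ GLi := by
  rw [show (2 : Q X) = 1 + 1 by norm_num]; exact GLi.add_mem GLi.one_mem GLi.one_mem

/-- Difference of the pointwise order. -/
lemma Pos.congr {f g : Q X} (h : Pos f) (e : f = g) : Pos g := e ▸ h

namespace Sys
variable (Y : Sys X)
section bnd
variable {γ : List (Fin 4)} {z : Fin 4}

lemma Zphi_eq (hγ : 1 ≤ γ.length) (h3 : 3 ∉ γ) : Dw γ Y.phi = Y.chi * Dw γ Y.psi := by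
  induction γ with
  | nil => simp at hγ
  | cons i γ ih =>
    simp only [List.mem_cons, not_or] at h3
    rw [Dw_cons, Dw_cons]
    cases γ with
    | nil => exact Y.D_phi i (Ne.symm h3.1)
    | cons j γ => rw [ih (by simp) h3.2, D_mul, Y.D_chi i (Ne.symm h3.1)]; ring

lemma W1_L2 (hγ : γ.length = 4) : Y.W1 γ ∈ L2 :=
  L2.sub_mem (L2.sub_mem ((Cl_mul (by norm_num) Y.J_Cl (Y.v_Cl 0)).1 γ hγ.le)
    (Li_L2 (Cl_Li (Y.v_Cl 0)) (Y.J_Cl.1 γ hγ.le))) (L2_Li (Y.Zphi_L2 hγ) ((Y.v_Cl 0).2 [3] (by simp)))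
lemma W2_L2 (hγ : γ.length = 4) : Y.W2 γ ∈ L2 :=
  L2.sub_mem (L2.sub_mem ((Cl_mul (by norm_num) Y.J_Cl (Y.v_Cl 1)).1 γ hγ.le)
    (Li_L2 (Cl_Li (Y.v_Cl 1)) (Y.J_Cl.1 γ hγ.le))) (L2_Li (Y.Zphi_L2 hγ) ((Y.v_Cl 1).2 [3] (by simp)))

lemma tr_eta (h3 : 3 ∉ γ) : tr (Dw γ Y.psi) = Dw γ Y.psi := by rw [← Dw_tr h3, Y.tr_psi]

/-- The top derivative of the height is good. -/
lemma eta_G (hγ : γ.length = 4) (h3 : 3 ∉ γ) : Dw γ Y.psi ∈ L2w 0 := by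
  have h0 := Y.eta_L2 hγ
  have h1 := Y.eta1_L2 hγ 1 (by decide)
  have h2 := Y.eta1_L2 hγ 2 (by decide)
  apply L2w0_of h0
  have wn := Null_LB (Y.W_Null h3 hγ (Dw γ Y.psi))
  rw [Y.tr_eta h3, Y.D3_eta, Y.tr_W3 h3] at wn
  have bL : ∀ f : Q X, f ∈ LB → bb * f ∈ LB := fun f hf =>
    mul_cst_LB (C := X.b) (fun _ => (abs_of_pos X.hb).le) hf
  have a1 := bL _ (LB.add_mem (mul_LB (Y.W1_L2 hγ) h1) (mul_LB (Y.W2_L2 hγ) h2))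
  have a2 := LB.sub_mem a1 wn
  have n1 := Null_LB (D1_Null (tr (Y.v 0) * (Dw γ Y.psi * Dw γ Y.psi)))
  have n2 := Null_LB (D2_Null (tr (Y.v 1) * (Dw γ Y.psi * Dw γ Y.psi)))
  have m1 := mul_LB (Li_L2 ((Y.u_Ub 0).2.1 1) h0) h0
  have m2 := mul_LB (Li_L2 ((Y.u_Ub 1).2.1 2) h0) h0
  have := LB.sub_mem (LB.sub_mem (LB.add_mem a2 a2) (LB.add_mem n1 n2)) (LB.add_mem m1 m2)
  convert this using 1
  simp only [D_mul]; ring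

lemma split4 (hγ : γ.length = 4) : ∃ z δ, γ = z :: δ ∧ δ.length = 3 := by
  cases γ with
  | nil => simp at hγ
  | cons z δ => exact ⟨z, δ, rfl, by simpa using hγ⟩

lemma J_eT_G (hγ : γ.length = 4) (h3 : 3 ∉ γ) : Y.J * Y.eT γ ∈ GB 1 := by
  obtain ⟨z, δ, rfl, hδ⟩ := split4 hγ
  exact (Y.tan_est hδ h3).1
lemma SE_G (hγ : γ.length = 4) (h3 : 3 ∉ γ) : Y.SE γ ∈ GB 1 := by
  obtain ⟨z, δ, rfl, hδ⟩ := split4 hγ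
  exact (Y.tan_est hδ h3).2.1
lemma Lp_G (hγ : γ.length = 4) (h3 : 3 ∉ γ) : Y.sk * Lp (Dw γ Y.psi) ∈ L2w 1 := by
  obtain ⟨z, δ, rfl, hδ⟩ := split4 hγ
  have := (Y.tan_est hδ h3).2.2.1
  change Y.sk * Lp _ * (Y.sk * Lp _) ∈ GB 1
  rw [mul_mul_mul_comm]
  exact this
lemma dm_TI (hγ : γ.length = 4) (h3 : 3 ∉ γ) : TI (Y.sk * Y.sk * Y.dm γ) := by
  obtain ⟨z, δ, rfl, hδ⟩ := split4 hγ
  exact (Y.tan_est hδ h3).2.2.2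

lemma eT_G (hγ : γ.length = 4) (h3 : 3 ∉ γ) : Y.eT γ ∈ GB 1 := by
  refine GB_of_le (Y.J_eT_G hγ h3) two_GLi (Y.J_Pos.mul (Y.eT_Pos γ)) (Y.eT_Pos γ) ?_
  intro s p hp
  have h2 : (2 : Q X) = 1 + 1 := by norm_num
  have := mul_le_mul_of_nonneg_right (Y.J_pos s p hp) (Y.eT_Pos γ s p hp)
  rw [h2, ev_sub _ _ hp, ev_mul _ _ hp, ev_add _ _ hp, ev_mul _ _ hp, ev_one hp]
  linarith

lemma eD_G (hγ : γ.length = 4) (h3 : 3 ∉ γ) (i : Fin 3) : Y.eD γ i ∈ GB 1 := by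
  have h := Y.eT_G hγ h3
  have p := Y.eD_Pos γ
  have h1 := GB_add_left h ((p 0).add (p 1)) (p 2)
  fin_cases i
  · exact GB_add_left h1 (p 0) (p 1)
  · exact GB_add_right h1 (p 0) (p 1)
  · exact GB_add_right h ((p 0).add (p 1)) (p 2)

lemma guv_G (hγ : γ.length = 4) (h3 : 3 ∉ γ) (i : Fin 3) : Y.gu γ (Y.v i) ∈ L2w 1 :=
  GB_add_left (Y.eD_G hγ h3 i) (Pos_sq _) (((Pos_sq _).add (Pos_sq _)).add (Pos_sq _))
lemma guF_G (hγ : γ.length = 4) (h3 : 3 ∉ γ) (k i : Fin 3) : Y.gu γ (Y.F k i) ∈ L2w 1 := by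
  have h := GB_add_right (Y.eD_G hγ h3 i) (Pos_sq _) (((Pos_sq _).add (Pos_sq _)).add (Pos_sq _))
  have h1 := GB_add_left h ((Pos_sq _).add (Pos_sq _)) (Pos_sq _)
  fin_cases k
  · exact GB_add_left h1 (Pos_sq _) (Pos_sq _)
  · exact GB_add_right h1 (Pos_sq _) (Pos_sq _)
  · exact GB_add_right h ((Pos_sq _).add (Pos_sq _)) (Pos_sq _)

lemma of_gu (hγ : γ.length = 4) (h3 : 3 ∉ γ) {f : Q X} (hf : f ∈ Cl 4 2) (h : Y.gu γ f ∈ L2w 1) :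
    Dw γ f ∈ L2w 1 := by
  have h1 : Y.chi ∈ GLi := Cl_GLi (k := 0) (l := 0) (Y.chi_Cl []) [] (by simp)
  have a : Y.chi * Y.iJ * D 3 f * Dw γ Y.psi ∈ L2w 1 := GLi_L2w (GLi.mul_mem (GLi.mul_mem h1
    (Cl_GLi Y.iJ_Cl [] (by simp))) (Cl_GLi hf [3] (by simp))) (L2w_mono (by norm_num) (Y.eta_G hγ h3))
  have := (L2w 1).add_mem h a
  convert this using 1
  rw [gu, Y.Zphi_eq (by omega) h3]; ring

/-- Tangential derivatives of the velocity. -/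
lemma v_tan (hγ : γ.length = 4) (h3 : 3 ∉ γ) (i : Fin 3) : Dw γ (Y.v i) ∈ L2w 1 :=
  Y.of_gu hγ h3 (Y.v_Cl i) (Y.guv_G hγ h3 i)
/-- Tangential derivatives of the deformation. -/
lemma F_tan (hγ : γ.length = 4) (h3 : 3 ∉ γ) (k i : Fin 3) : Dw γ (Y.F k i) ∈ L2w 1 :=
  Y.of_gu hγ h3 (Y.F_Cl k i) (Y.guF_G hγ h3 k i)

lemma eta1_G (hγ : γ.length = 4) (h3 : 3 ∉ γ) (j : Fin 4) (hj : j ≠ 0) : D j (Dw γ Y.psi) ∈ L2w 1 := by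
  have hp : ∀ i, i ≠ 0 → D i Y.psi ∈ GLi := fun i hi => Cl_GLi (Y.p_Cl i hi) [] (by simp)
  have hP : 1 + D 1 Y.psi * D 1 Y.psi + D 2 Y.psi * D 2 Y.psi ∈ GLi :=
    GLi.add_mem (GLi.add_mem GLi.one_mem (GLi.mul_mem (hp 1 (by decide)) (hp 1 (by decide))))
      (GLi.mul_mem (hp 2 (by decide)) (hp 2 (by decide)))
  have h := GB_of_le (Y.SE_G hγ h3) (GLi.mul_mem hP hP) (Y.SE_Pos γ) ((Pos_sq _).add (Pos_sq _)) (Y.SE_coer γ)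
  fin_cases j
  · exact absurd rfl hj
  · exact GB_add_left h (Pos_sq _) (Pos_sq _)
  · exact GB_add_right h (Pos_sq _) (Pos_sq _)
  · change D 3 _ ∈ _
    rw [Y.D3_eta]; exact (L2w 1).zero_mem

end bnd
end Sys
end EE

namespace EE
open scoped ContDiff
open MeasureTheory Set Filter Topology

variable {X : Ctx}

lemma Op_comm (a b : Fin 4 → Q X) (f : Q X) : Op a (Op b f) - Op b (Op a f) =
    Op (fun j => Op a (b j) - Op b (a j)) f := by
  have h10 := D_comm 1 0 f
  have h20 := D_comm 2 0 f
  have h30 := D_comm 3 0 f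
  have h21 := D_comm 2 1 f
  have h31 := D_comm 3 1 f
  have h32 := D_comm 3 2 f
  simp only [Op, map_add, D_mul, h10, h20, h30, h21, h31, h32]
  ring

lemma Op_Cl31 {a : Fin 4 → Q X} (ha : ∀ j, a j ∈ Cl 3 1) {f : Q X} (hf : f ∈ Cl 4 2) : Op a f ∈ Cl 3 1 := by
  have h := fun j => Cl_mul (by norm_num) (ha j) (Cl_D hf j)
  exact (Cl 3 1).add_mem ((Cl 3 1).add_mem ((Cl 3 1).add_mem (h 0) (h 1)) (h 2)) (h 3)

lemma Dw_Op3 {γ : List (Fin 4)} (hγ : γ.length = 3) {a : Fin 4 → Q X} (ha : ∀ j, a j ∈ Cl 3 2) {f : Q X}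
    (hf : f ∈ Cl 3 1) : Dw γ (Op a f) - Op a (Dw γ f) ∈ L2 := by
  have h : ∀ j, D j f * Dw γ (a j) + cm γ (a j) (D j f) ∈ L2 := fun j =>
    L2.add_mem (Li_L2 (Cl_Li (Cl_D hf j)) ((ha j).1 γ hγ.le))
      (Sp_L2 (ha j) (Cl_D hf j) (m := 1) (n := 3) (fun a b _ _ _ => by omega)
        (cm_mem' hγ (by norm_num) _ _))
  have := L2.add_mem (L2.add_mem (L2.add_mem (h 0) (h 1)) (h 2)) (h 3)
  convert this using 1
  rw [Dw_Op]; ring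

lemma GB0_of {f : Q X} (hf : f ∈ LB) (p : Pos f) (h0 : D 0 f ∈ LB) : f ∈ GB 0 := by
  obtain ⟨C, hC⟩ := growth (e := f) (g := 0) (q := 0) hf (by rwa [add_zero, add_zero])
    (fun s t ht => (I_zero ht).ge)
  refine ⟨C, fun K => ?_⟩
  obtain ⟨τ, hτ, h⟩ := hC K
  refine ⟨τ, hτ, fun s hs t ht => ?_⟩
  rw [abs_of_nonneg (p.I ht), pow_zero, mul_one]
  have := h s hs t ht
  have := int_nonneg Pos_zero ht
  linarith

namespace Sys
variable (Y : Sys X) {γ : List (Fin 4)}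

/-- The flattened curl. -/
def cu (τ : Fin 3) (u : Fin 3 → Q X) : Q X := Op (Y.Bm 2) (u τ) - Op (Y.Bm τ) (u 2)

lemma Bm_0 (i : Fin 3) : Y.Bm i 0 = 0 := by fin_cases i <;> rfl

lemma B_Cl {i : Fin 3} {f : Q X} (hf : f ∈ Cl 4 2) : Op (Y.Bm i) f ∈ Cl 3 1 :=
  Op_Cl (fun j => Cl_mono (Y.Bm_Cl i j) (by norm_num) le_rfl) hf

lemma comm_Xk (k i : Fin 3) {f : Q X} (hf : f ∈ Cl 4 2) :
    Op (Y.Xk k) (Op (Y.Bm i) f) - Op (Y.Bm i) (Op (Y.Xk k) f) ∈ Cl 3 1 := by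
  rw [Op_comm]
  exact Op_Cl31 (fun j => (Cl 3 1).sub_mem
    (Op_Cl (fun j => Cl_mono (Y.Xk_Cl k j) (by norm_num) le_rfl) (Y.Bm_Cl i j)) (Y.B_Cl (Y.Xk_Cl k j))) hf

lemma comm_Xv (i : Fin 3) {f : Q X} (hf : f ∈ Cl 4 2) :
    Op Y.Xv (Op (Y.Bm i) f) - Op (Y.Bm i) (Op Y.Xv f) ∈ Cl 3 1 := by
  rw [Op_comm]
  refine Op_Cl31 (fun j => (Cl 3 1).sub_mem (Op_Cl Y.Xv_Cl' (Y.Bm_Cl i j)) ?_) hf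
  by_cases hj : j = 3
  · subst hj
    rw [Y.Xv3, Op_sub]
    refine (Cl 3 1).sub_mem (Y.B_Cl Y.w0_Cl) ?_
    have h : ∀ j, j ≠ 0 → Y.Bm i j * D j (D 0 Y.phi) ∈ Cl 3 1 := fun j hj =>
      Cl_mul (by norm_num) (Cl_mono (Y.Bm_Cl i j) (by norm_num) (by norm_num)) (Y.phitj_Cl j hj)
    rw [Op, Y.Bm_0, zero_mul, zero_add]
    exact (Cl 3 1).add_mem ((Cl 3 1).add_mem (h 1 (by decide)) (h 2 (by decide))) (h 3 (by decide))
  · exact Y.B_Cl (Y.Xv_Cl j hj)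

lemma qcomm (τ : Fin 3) : Op (Y.Bm 2) (Op (Y.Bm τ) Y.q) - Op (Y.Bm τ) (Op (Y.Bm 2) Y.q) ∈ Cl 3 1 := by
  have hz : Op (Y.Bm 2) (Y.Bm τ 0) - Op (Y.Bm τ) (Y.Bm 2 0) = 0 := by
    rw [Bm_0, Bm_0]; simp [Op]
  have h : ∀ j, j ≠ 0 → (Op (Y.Bm 2) (Y.Bm τ j) - Op (Y.Bm τ) (Y.Bm 2 j)) * D j Y.q ∈ Cl 3 1 := fun j hj =>
    Cl_mul (by norm_num) ((Cl 3 1).sub_mem (Y.B_Cl (Y.Bm_Cl τ j)) (Y.B_Cl (Y.Bm_Cl 2 j))) (Y.q_Cl j hj)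
  rw [Op_comm, Op, hz, zero_mul, zero_add]
  exact (Cl 3 1).add_mem ((Cl 3 1).add_mem (h 1 (by decide)) (h 2 (by decide))) (h 3 (by decide))

lemma cu_Cl (τ : Fin 3) {u : Fin 3 → Q X} (hu : ∀ i, u i ∈ Cl 4 2) : Y.cu τ u ∈ Cl 3 1 :=
  (Cl 3 1).sub_mem (Y.B_Cl (hu τ)) (Y.B_Cl (hu 2))

lemma curl1 (τ : Fin 3) : Op Y.Xv (Y.cu τ Y.v) - (Op (Y.Xk 0) (Y.cu τ (Y.F 0)) + Op (Y.Xk 1) (Y.cu τ (Y.F 1)) +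
    Op (Y.Xk 2) (Y.cu τ (Y.F 2))) ∈ Cl 3 1 := by
  have a := (Cl 3 1).sub_mem (Y.comm_Xv 2 (Y.v_Cl τ)) (Y.comm_Xv τ (Y.v_Cl 2))
  have b := fun k => (Cl 3 1).sub_mem (Y.comm_Xk k 2 (Y.F_Cl k τ)) (Y.comm_Xk k τ (Y.F_Cl k 2))
  have := (Cl 3 1).sub_mem ((Cl 3 1).sub_mem a ((Cl 3 1).add_mem ((Cl 3 1).add_mem (b 0) (b 1)) (b 2))) (Y.qcomm τ)
  convert this using 1
  have m1 := congrArg (Op (Y.Bm 2)) (Y.mom τ)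
  have m2 := congrArg (Op (Y.Bm τ)) (Y.mom 2)
  rw [Op_add, Op_add, Op_add] at m1 m2
  simp only [cu, Op_sub]
  linear_combination m1 - m2

lemma curl2 (τ k : Fin 3) : Op Y.Xv (Y.cu τ (Y.F k)) - Op (Y.Xk k) (Y.cu τ Y.v) ∈ Cl 3 1 := by
  have a := (Cl 3 1).sub_mem (Y.comm_Xv 2 (Y.F_Cl k τ)) (Y.comm_Xv τ (Y.F_Cl k 2))
  have b := (Cl 3 1).sub_mem (Y.comm_Xk k 2 (Y.v_Cl τ)) (Y.comm_Xk k τ (Y.v_Cl 2))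
  have := (Cl 3 1).sub_mem a b
  convert this using 1
  rw [Y.trans k τ, Y.trans k 2]
  simp only [cu, Op_sub]
  ring

lemma curl_G (hγ : γ.length = 3) (τ : Fin 3) : Dw γ (Y.cu τ Y.v) ∈ L2w 0 ∧ ∀ k, Dw γ (Y.cu τ (Y.F k)) ∈ L2w 0 := by
  have cv := Y.cu_Cl τ Y.v_Cl
  have cF := fun k => Y.cu_Cl τ (Y.F_Cl k)
  have hk := fun k j => Cl_mono (k' := 3) (Y.Xk_Cl k j) (by norm_num) (le_refl 2)
  have U2 := cv.1 γ hγ.le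
  have G2 := fun k => (cF k).1 γ hγ.le
  have en := Y.EN (P := 0) (G := fun k => Dw γ (Y.cu τ (Y.F k))) U2 G2 (by
    have c0 := Dw_Op3 hγ Y.Xv_Cl' cv
    have c := fun k => Dw_Op3 hγ (hk k) (cF k)
    have d := (Y.curl1 τ).1 γ hγ.le
    have := L2.add_mem (L2.sub_mem d c0) (L2.add_mem (L2.add_mem (c 0) (c 1)) (c 2))
    convert this using 1
    simp only [map_sub, map_add]; ring) (fun k => by
    have c0 := Dw_Op3 hγ Y.Xv_Cl' (cF k)
    have c := Dw_Op3 hγ (hk k) cv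
    have d := (Y.curl2 τ k).1 γ hγ.le
    have := L2.add_mem (L2.sub_mem d c0) c
    convert this using 1
    simp only [map_sub]; ring)
  rw [mul_zero, mul_zero, add_zero] at en
  set U := Dw γ (Y.cu τ Y.v)
  set G := fun k => Dw γ (Y.cu τ (Y.F k))
  have pf : Pos (U * U + (G 0 * G 0 + G 1 * G 1 + G 2 * G 2)) :=
    (Pos_sq _).add (((Pos_sq _).add (Pos_sq _)).add (Pos_sq _))
  have lb : Y.J * (U * U + (G 0 * G 0 + G 1 * G 1 + G 2 * G 2)) ∈ LB := by
    have h := fun f (hf : f ∈ L2) => mul_LB hf (Li_L2 Y.J_Li hf)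
    have := LB.add_mem (h U U2) (LB.add_mem (LB.add_mem (h _ (G2 0)) (h _ (G2 1))) (h _ (G2 2)))
    convert this using 1
    simp only [G]; ring
  have g0 := GB0_of lb (Y.J_Pos.mul pf) en
  have g1 : U * U + (G 0 * G 0 + G 1 * G 1 + G 2 * G 2) ∈ GB 0 := by
    refine GB_of_le g0 two_GLi (Y.J_Pos.mul pf) pf ?_
    intro s p hp
    have h2 : (2 : Q X) = 1 + 1 := by norm_num
    have := mul_le_mul_of_nonneg_right (Y.J_pos s p hp) (pf s p hp)
    rw [h2, ev_sub _ _ hp, ev_mul _ _ hp, ev_add 1 1 hp, ev_mul _ _ hp, ev_one hp]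
    linarith
  have q01 := (Pos_sq (G 0)).add (Pos_sq (G 1))
  have q := q01.add (Pos_sq (G 2))
  have g2 := GB_add_right g1 (Pos_sq _) q
  have g3 := GB_add_left g2 q01 (Pos_sq _)
  refine ⟨GB_add_left g1 (Pos_sq _) q, fun k => ?_⟩
  fin_cases k
  · exact GB_add_left g3 (Pos_sq _) (Pos_sq _)
  · exact GB_add_right g3 (Pos_sq _) (Pos_sq _)
  · exact GB_add_right g2 q01 (Pos_sq _)

/-- Normal derivatives are recovered from curl, divergence and tangential derivatives. -/
lemma recov (hγ : γ.length = 3) {u : Fin 3 → Q X} (hu : ∀ i, u i ∈ Cl 4 2)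
    (hd : Op (Y.Bm 0) (u 0) + Op (Y.Bm 1) (u 1) + Op (Y.Bm 2) (u 2) = 0)
    (hc : ∀ τ, Dw γ (Y.cu τ u) ∈ L2w 0) (h1 : ∀ i, D 1 (Dw γ (u i)) ∈ L2w 1)
    (h2 : ∀ i, D 2 (Dw γ (u i)) ∈ L2w 1) (i : Fin 3) : D 3 (Dw γ (u i)) ∈ L2w 1 := by
  have eJ := fun i j => L2w_mono (j := 1) (by norm_num) (co3 hγ Y.J_Cl (Cl_D (hu i) j))
  have e1 := fun i j => L2w_mono (j := 1) (by norm_num) (co3 hγ (Y.phi_Cl 1 (by decide)) (Cl_D (hu i) j))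
  have e2 := fun i j => L2w_mono (j := 1) (by norm_num) (co3 hγ (Y.phi_Cl 2 (by decide)) (Cl_D (hu i) j))
  have gJ := Cl_GLi Y.J_Cl [] (by simp)
  have gp1 := Cl_GLi (Y.phi_Cl 1 (by decide)) [] (by simp)
  have gp2 := Cl_GLi (Y.phi_Cl 2 (by decide)) [] (by simp)
  rw [Dw_nil] at gJ gp1 gp2
  have hc' := fun τ => L2w_mono (j := 1) (by norm_num) (hc τ)
  set U := fun i => Dw γ (u i) with hU
  -- corrected curl
  have o0 : D 3 (U 0) - Y.J * D 1 (U 2) + D 1 Y.phi * D 3 (U 2) ∈ L2w 1 := by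
    have := (L2w 1).add_mem (hc' 0) ((L2w 1).sub_mem (eJ 2 1) (e1 2 3))
    convert this using 1
    simp only [cu, Bm0, Bm2, map_sub, cm_eq, Dw_D, hU]; ring
  have o1 : D 3 (U 1) - Y.J * D 2 (U 2) + D 2 Y.phi * D 3 (U 2) ∈ L2w 1 := by
    have := (L2w 1).add_mem (hc' 1) ((L2w 1).sub_mem (eJ 2 2) (e2 2 3))
    convert this using 1
    simp only [cu, Bm1, Bm2, map_sub, cm_eq, Dw_D, hU]; ring
  have dv : Y.J * D 1 (U 0) - D 1 Y.phi * D 3 (U 0) + (Y.J * D 2 (U 1) - D 2 Y.phi * D 3 (U 1)) + D 3 (U 2)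
      ∈ L2w 1 := by
    have := (L2w 1).neg_mem ((L2w 1).add_mem ((L2w 1).sub_mem (eJ 0 1) (e1 0 3)) ((L2w 1).sub_mem (eJ 1 2) (e2 1 3)))
    convert this using 1
    have h := congrArg (Dw γ) hd
    simp only [Bm0, Bm1, Bm2, map_add, map_sub, cm_eq, Dw_D, map_zero] at h
    simp only [hU, Dw_D]
    linear_combination h
  have R : (1 + (D 1 Y.phi * D 1 Y.phi + D 2 Y.phi * D 2 Y.phi)) * D 3 (U 2) ∈ L2w 1 := by
    have s0 := (L2w 1).add_mem o0 (GLi_L2w gJ (h1 2))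
    have s1 := (L2w 1).add_mem o1 (GLi_L2w gJ (h2 2))
    have := (L2w 1).add_mem ((L2w 1).sub_mem ((L2w 1).sub_mem dv (GLi_L2w gJ (h1 0))) (GLi_L2w gJ (h2 1)))
      ((L2w 1).add_mem (GLi_L2w gp1 s0) (GLi_L2w gp2 s1))
    convert this using 1
    simp only [hU]; ring
  have z : D 3 (U 2) ∈ L2w 1 := by
    have one := GLi.one_mem (R := ℝ) (A := Q X)
    refine GB_of_le R one (Pos_sq _) (Pos_sq _) ?_
    have pp : Pos (D 1 Y.phi * D 1 Y.phi + D 2 Y.phi * D 2 Y.phi) := (Pos_sq _).add (Pos_sq _)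
    exact (((pp.add pp).add (pp.mul pp)).mul (Pos_sq (D 3 (U 2)))).congr (by ring)
  fin_cases i
  · have := (L2w 1).sub_mem ((L2w 1).add_mem o0 (GLi_L2w gJ (h1 2))) (GLi_L2w gp1 z)
    convert this using 1
    simp only [hU]; change D 3 (Dw γ (u 0)) = _; ring
  · have := (L2w 1).sub_mem ((L2w 1).add_mem o1 (GLi_L2w gJ (h2 2))) (GLi_L2w gp2 z)
    convert this using 1
    simp only [hU]; change D 3 (Dw γ (u 1)) = _; ring
  · exact z

lemma recov4 {u : Fin 3 → Q X} (hu : ∀ i, u i ∈ Cl 4 2)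
    (hd : Op (Y.Bm 0) (u 0) + Op (Y.Bm 1) (u 1) + Op (Y.Bm 2) (u 2) = 0)
    (hc : ∀ γ : List (Fin 4), γ.length = 3 → ∀ τ, Dw γ (Y.cu τ u) ∈ L2w 0)
    (ht : ∀ γ : List (Fin 4), γ.length = 4 → 3 ∉ γ → ∀ i, Dw γ (u i) ∈ L2w 1) (n : ℕ) :
    ∀ γ : List (Fin 4), γ.length = 4 → γ.count 3 = n → ∀ i, Dw γ (u i) ∈ L2w 1 := by
  induction n with
  | zero => exact fun γ h4 h0 i => ht γ h4 (List.count_eq_zero.1 h0) i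
  | succ n ih =>
    intro γ h4 hn i
    have hm : 3 ∈ γ := List.count_pos_iff.1 (by omega)
    have hp := List.perm_cons_erase hm
    have hl := hp.length_eq
    have hcn := hp.count_eq 3
    rw [List.length_cons] at hl
    rw [List.count_cons_self] at hcn
    rw [Dw_perm hp, Dw_cons]
    have key : ∀ j : Fin 4, j ≠ 3 → ∀ i, D j (Dw (γ.erase 3) (u i)) ∈ L2w 1 := fun j hj i => by
      rw [← Dw_cons]
      refine ih _ (by rw [List.length_cons]; omega) ?_ i
      rw [List.count_cons_of_ne hj]; omega
    exact Y.recov (by omega) hu hd (hc _ (by omega)) (key 1 (by decide)) (key 2 (by decide)) i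

lemma v_G (h : γ.length = 4) (i : Fin 3) : Dw γ (Y.v i) ∈ L2w 1 :=
  Y.recov4 Y.v_Cl Y.divv (fun _ h τ => (Y.curl_G h τ).1) (fun _ h h3 i => Y.v_tan h h3 i) _ γ h rfl i
lemma F_G (h : γ.length = 4) (k i : Fin 3) : Dw γ (Y.F k i) ∈ L2w 1 :=
  Y.recov4 (Y.F_Cl k) (Y.divF k) (fun _ h τ => (Y.curl_G h τ).2 k) (fun _ h h3 i => Y.F_tan h h3 k i) _ γ h rfl i

lemma v_G' (h : γ.length ≤ 4) (i : Fin 3) : Dw γ (Y.v i) ∈ L2w 1 := by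
  rcases h.lt_or_eq with h | h
  · exact L2w_mono (by norm_num) (Cl_G (k := 3) (Y.v_Cl i) γ (by omega))
  · exact Y.v_G h i
lemma F_G' (h : γ.length ≤ 4) (k i : Fin 3) : Dw γ (Y.F k i) ∈ L2w 1 := by
  rcases h.lt_or_eq with h | h
  · exact L2w_mono (by norm_num) (Cl_G (k := 3) (Y.F_Cl k i) γ (by omega))
  · exact Y.F_G h k i

end Sys
end EE

namespace EE
open scoped ContDiff
open MeasureTheory Set Filter Topology

variable {X : Ctx}

/-- Bound by a multiple of the weight on short time intervals. -/
def Pr (P : X.S → ℝ → ℝ) : Prop := ∃ C, ∀ K, ∃ τ > 0, ∀ s, Ok K τ s → ∀ t ∈ Tm s, P s t ≤ C * wt s t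

lemma Pr_cmul {P : X.S → ℝ → ℝ} (h : Pr P) {c : ℝ} (hc : 0 ≤ c) : Pr fun s t => c * P s t := by
  obtain ⟨C, hC⟩ := h
  refine ⟨c * C, fun K => ?_⟩
  obtain ⟨τ, hτ, h⟩ := hC K
  refine ⟨τ, hτ, fun s hs t ht => ?_⟩
  rw [mul_assoc]
  exact mul_le_mul_of_nonneg_left (h s hs t ht) hc

lemma Pr_of_GB {f : Q X} (h : f ∈ GB 1) : Pr fun s t => I f s t := by
  obtain ⟨C, hC⟩ := h
  refine ⟨C, fun K => ?_⟩
  obtain ⟨τ, hτ, h⟩ := hC K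
  refine ⟨τ, hτ, fun s hs t ht => ?_⟩
  have := h s hs t ht
  rw [pow_one] at this
  exact (le_abs_self _).trans this

lemma Pr_fin {ι : Type} [DecidableEq ι] (P : ι → X.S → ℝ → ℝ) (S : Finset ι) (h : ∀ i ∈ S, Pr (P i)) :
    ∃ C, 0 ≤ C ∧ ∀ K, ∃ τ > 0, ∀ s, Ok K τ s → ∀ t ∈ Tm s, ∀ i ∈ S, P i s t ≤ C * wt s t := by
  induction S using Finset.induction_on with
  | empty => exact ⟨0, le_rfl, fun K => ⟨1, one_pos, fun _ _ _ _ i hi => by simp at hi⟩⟩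
  | insert a S ha ih =>
    obtain ⟨C, hC0, hC⟩ := ih fun i hi => h i (Finset.mem_insert_of_mem hi)
    obtain ⟨C', hC'⟩ := h a (Finset.mem_insert_self _ _)
    refine ⟨max C C', hC0.trans (le_max_left _ _), fun K => ?_⟩
    obtain ⟨τ, hτ, h⟩ := hC K
    obtain ⟨τ', hτ', h'⟩ := hC' K
    refine ⟨min τ τ', lt_min hτ hτ', fun s hs t ht i hi => ?_⟩
    have hw := zero_le_one.trans (one_le_wt ht)
    rcases Finset.mem_insert.1 hi with rfl | hi
    · exact (h' s ⟨hs.1.trans (min_le_right _ _), hs.2⟩ t ht).trans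
        (mul_le_mul_of_nonneg_right (le_max_right _ _) hw)
    · exact (h s ⟨hs.1.trans (min_le_left _ _), hs.2⟩ t ht i hi).trans
        (mul_le_mul_of_nonneg_right (le_max_left _ _) hw)

lemma Null_GB {f : Q X} {i : ℕ} (h : f ∈ Null) : f ∈ GB i :=
  ⟨0, fun _ => ⟨1, one_pos, fun s _ t ht => by rw [h s t ht]; simp⟩⟩

lemma TI_mono {f g : Q X} (hf : TI f) (h : Pos (f - g)) : TI g := by
  obtain ⟨C, hC⟩ := hf
  refine ⟨C, fun K => ?_⟩
  obtain ⟨τ, hτ, h'⟩ := hC K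
  refine ⟨τ, hτ, fun s hs t ht => le_trans ?_ (h' s hs t ht)⟩
  refine intervalIntegral.integral_mono_on ht.1 ((I_cont g s).intervalIntegrable _ _)
    ((I_cont f s).intervalIntegrable _ _) fun r hr => ?_
  have hr' : r ∈ Tm s := ⟨hr.1, hr.2.trans ht.2⟩
  have := h.I hr'
  rw [I_sub _ _ hr'] at this
  linarith

lemma TI_of_GB {g : Q X} (hg : g ∈ GB 0) : TI g := by
  obtain ⟨C, hC⟩ := hg
  refine ⟨|C|, fun K => ?_⟩
  obtain ⟨τ, hτ, h⟩ := hC K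
  refine ⟨min τ 1, lt_min hτ one_pos, fun s hs t ht => ?_⟩
  have hs' : Ok K τ s := ⟨hs.1.trans (min_le_left _ _), hs.2⟩
  have ht1 : t ≤ 1 := ht.2.trans (hs.1.trans (min_le_right _ _))
  have h1 : ∫ r in (0:ℝ)..t, I g s r ≤ ∫ _r in (0:ℝ)..t, |C| := by
    refine intervalIntegral.integral_mono_on ht.1 ((I_cont g s).intervalIntegrable _ _)
      intervalIntegrable_const fun r hr => ?_
    have := h s hs' r ⟨hr.1, hr.2.trans ht.2⟩
    rw [pow_zero, mul_one] at this
    exact (le_abs_self _).trans (this.trans (le_abs_self _))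
  rw [intervalIntegral.integral_const, smul_eq_mul, sub_zero] at h1
  have := one_le_wt ht
  have := abs_nonneg C
  nlinarith [ht.1]

lemma Lp_sq (η : Q X) : (η * η + (D 1 η * D 1 η + D 1 η * D 1 η) + (D 2 η * D 2 η + D 2 η * D 2 η) +
    (D 2 (D 1 η) * D 2 (D 1 η) + D 2 (D 1 η) * D 2 (D 1 η)) + D 1 (D 1 η) * D 1 (D 1 η) +
    D 2 (D 2 η) * D 2 (D 2 η)) - Lp η * Lp η ∈ Null := by
  have h := Null.add_mem (Null.add_mem (D1_Null (η * D 1 η + η * D 1 η)) (D2_Null (η * D 2 η + η * D 2 η)))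
    (Null.sub_mem (D2_Null (D 1 η * D 2 (D 1 η) + D 1 η * D 2 (D 1 η)))
      (D1_Null (D 1 η * D 2 (D 2 η) + D 1 η * D 2 (D 2 η))))
  convert h using 1
  have e : D 1 (D 2 (D 2 η)) = D 2 (D 2 (D 1 η)) := by rw [D_comm 1 2, D_comm 1 2]
  simp only [map_add, D_mul, e, Lp]
  ring

/-- The list contains a nonzero entry. -/
lemma exists_pull {γ : List (Fin 4)} (h : γ.count 0 < γ.length) : ∃ j δ, j ≠ 0 ∧ γ.Perm (j :: δ) := by
  obtain ⟨j, hj, h0⟩ : ∃ j ∈ γ, j ≠ 0 := by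
    by_contra hc
    push Not at hc
    have : γ.count 0 = γ.length := List.count_eq_length.2 fun j hj => (hc j hj).symm
    omega
  exact ⟨j, γ.erase j, h0, List.perm_cons_erase hj⟩

lemma pull_data {γ δ : List (Fin 4)} {j : Fin 4} (hp : γ.Perm (j :: δ)) (h3 : 3 ∉ γ) :
    γ.length = δ.length + 1 ∧ 3 ∉ δ ∧ j ≠ 3 ∧ γ.count 0 = δ.count 0 + if j = 0 then 1 else 0 := by
  refine ⟨by rw [hp.length_eq, List.length_cons], fun h => h3 (hp.mem_iff.2 (List.mem_cons_of_mem _ h)),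
    fun h => h3 (hp.mem_iff.2 (by simp [h])), ?_⟩
  rw [hp.count_eq, List.count_cons]
  simp

namespace Sys
variable (Y : Sys X) {γ : List (Fin 4)}

lemma sk_GLi : Y.sk ∈ GLi := cst_GLi (C := 1) fun s => by
  rw [abs_of_nonneg (Real.sqrt_nonneg _)]
  exact Real.sqrt_le_one.2 (Y.hκ s).2

lemma psi4_G (h3 : 3 ∉ γ) (h : γ.length ≤ 4) : Dw γ Y.psi ∈ L2w 0 := by
  rcases h.lt_or_eq with h | h
  · exact Cl_G (k := 3) Y.psi_Cl γ (by omega)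
  · exact Y.eta_G h h3

lemma psi5_G (h3 : 3 ∉ γ) (h : γ.length ≤ 5) (h0 : γ.count 0 ≤ 4) : Dw γ Y.psi ∈ L2w 1 := by
  rcases h.lt_or_eq with h | h
  · exact L2w_mono (by norm_num) (Y.psi4_G h3 (by omega))
  · obtain ⟨j, δ, hj, hp⟩ := exists_pull (γ := γ) (by omega)
    obtain ⟨e1, e2, e3, e4⟩ := pull_data hp h3
    rw [Dw_perm hp, Dw_cons]
    exact Y.eta1_G (by omega) e2 j hj

lemma kpsi_D2 (h : γ.length = 4) (h3 : 3 ∉ γ) (i j : Fin 4) (hi : i ≠ 0) (hj : j ≠ 0) :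
    Y.sk * D i (D j (Dw γ Y.psi)) ∈ L2w 1 := by
  set η := Dw γ Y.psi
  have hL := Y.Lp_G h h3
  change Y.sk * Lp η * (Y.sk * Lp η) ∈ GB 1 at hL
  have hN := Null_GB (i := 1) (Null_cmul Y.κ (Lp_sq η))
  rw [← Y.sk_sq] at hN
  have hs := (GB 1).add_mem hL hN
  have hs' : Y.sk * η * (Y.sk * η) + (Y.sk * D 1 η * (Y.sk * D 1 η) + Y.sk * D 1 η * (Y.sk * D 1 η)) +
      (Y.sk * D 2 η * (Y.sk * D 2 η) + Y.sk * D 2 η * (Y.sk * D 2 η)) +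
      (Y.sk * D 2 (D 1 η) * (Y.sk * D 2 (D 1 η)) + Y.sk * D 2 (D 1 η) * (Y.sk * D 2 (D 1 η))) +
      Y.sk * D 1 (D 1 η) * (Y.sk * D 1 (D 1 η)) +
      Y.sk * D 2 (D 2 η) * (Y.sk * D 2 (D 2 η)) ∈ GB 1 := by
    convert hs using 1; ring
  have p := fun f : Q X => Pos_sq (Y.sk * f)
  have p2 := fun f : Q X => (p f).add (p f)
  have q1 := ((p η).add (p2 (D 1 η))).add (p2 (D 2 η))
  have q2 := q1.add (p2 (D 2 (D 1 η)))
  have q3 := q2.add (p (D 1 (D 1 η)))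
  have a22 := GB_add_right hs' q3 (p _)
  have b := GB_add_left hs' q3 (p _)
  have a11 := GB_add_right b q2 (p _)
  have a12 := GB_add_left (GB_add_right (GB_add_left b q2 (p _)) q1 (p2 _)) (p _) (p _)
  have z3 : ∀ k, D 3 (D k η) = 0 := fun k => by rw [D_comm, Y.D3_eta, map_zero]
  have z3' : D 3 η = 0 := Y.D3_eta _
  fin_cases i <;> fin_cases j <;> first | exact absurd rfl hi | exact absurd rfl hj | skip
  · exact a11
  · change Y.sk * D 1 (D 2 η) ∈ _; rw [D_comm]; exact a12
  · change Y.sk * D 1 (D 3 η) ∈ _; rw [z3', map_zero, mul_zero]; exact (L2w 1).zero_mem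
  · exact a12
  · exact a22
  · change Y.sk * D 2 (D 3 η) ∈ _; rw [z3', map_zero, mul_zero]; exact (L2w 1).zero_mem
  all_goals
    change Y.sk * D 3 (D _ η) ∈ _; rw [z3, mul_zero]; exact (L2w 1).zero_mem

lemma kpsi_G (h3 : 3 ∉ γ) (h : γ.length ≤ 6) (h0 : γ.count 0 ≤ 4) : Y.sk * Dw γ Y.psi ∈ L2w 1 := by
  rcases h.lt_or_eq with h | h
  · exact GLi_L2w Y.sk_GLi (Y.psi5_G h3 (by omega) h0)
  · obtain ⟨j, δ, hj, hp⟩ := exists_pull (γ := γ) (by omega)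
    obtain ⟨e1, e2, e3, e4⟩ := pull_data hp h3
    rw [if_neg hj] at e4
    obtain ⟨i, ε, hi, hp'⟩ := exists_pull (γ := δ) (by omega)
    obtain ⟨f1, f2, f3, f4⟩ := pull_data hp' e2
    rw [Dw_perm hp, Dw_cons, Dw_perm hp', Dw_cons]
    exact Y.kpsi_D2 (by omega) f2 j i hj hi

lemma kpsi_TI (h3 : 3 ∉ γ) (h : γ.length ≤ 6) (h0 : γ.count 0 ≤ 5) (h1 : 1 ≤ γ.count 0) :
    TI (Y.sk * Y.sk * (Dw γ Y.psi * Dw γ Y.psi)) := by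
  have hm : (0 : Fin 4) ∈ γ := List.count_pos_iff.1 (by omega)
  have hp := List.perm_cons_erase hm
  obtain ⟨e1, e2, e3, e4⟩ := pull_data hp h3
  rw [if_pos rfl] at e4
  set δ := γ.erase 0
  have sp := Pos_sq Y.sk
  rcases Nat.lt_or_ge δ.length 4 with h4 | h4
  · have := TI_of_GB (show (Y.sk * Dw γ Y.psi) * (Y.sk * Dw γ Y.psi) ∈ GB 0 from
      GLi_L2w Y.sk_GLi (Y.psi4_G h3 (by omega)))
    rwa [mul_mul_mul_comm] at this
  rcases h4.eq_or_lt with h4 | h4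
  · refine TI_mono (Y.dm_TI h4.symm e2) ?_
    rw [Dw_perm hp, Dw_cons]
    set η := Dw δ Y.psi
    refine (sp.mul ((Pos_sq (D 1 (D 0 η))).add (Pos_sq (D 2 (D 0 η))))).congr ?_
    rw [dm]; ring
  · obtain ⟨j, ε, hj, hp'⟩ := exists_pull (γ := δ) (by omega)
    obtain ⟨f1, f2, f3, f4⟩ := pull_data hp' e2
    refine TI_mono (Y.dm_TI (γ := ε) (by omega) f2) ?_
    rw [Dw_perm hp, Dw_cons, Dw_perm hp', Dw_cons, D_comm]
    set η := Dw ε Y.psi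
    fin_cases j
    · exact absurd rfl hj
    · refine (sp.mul ((Pos_sq (D 0 η)).add (Pos_sq (D 2 (D 0 η))))).congr ?_
      change _ = _ - Y.sk * Y.sk * (D 1 (D 0 η) * D 1 (D 0 η))
      rw [dm]; ring
    · refine (sp.mul ((Pos_sq (D 0 η)).add (Pos_sq (D 1 (D 0 η))))).congr ?_
      change _ = _ - Y.sk * Y.sk * (D 2 (D 0 η) * D 2 (D 0 η))
      rw [dm]; ring
    · exact absurd rfl f3

/-- The main a priori bound. -/
theorem main (Y : Sys X) : ∃ C0 : ℝ, ∀ K, ∃ τ > 0, ∀ s, Ok K τ s → ∀ t ∈ Tm s, X.E s t ≤ C0 := by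
  obtain ⟨Ce, hCe, hE⟩ := Y.Ec
  have fin := List.finite_length_le (Fin 4) 6
  set S : Finset (List (Fin 4)) := fin.toFinset
  have hS : ∀ γ : List (Fin 4), γ.length ≤ 6 → γ ∈ S := fun γ h => by simpa [S] using h
  have hκI : ∀ (f : Q X) s, ∀ t ∈ Tm s, Y.κ s * I (f * f) s t = I (Y.sk * Y.sk * (f * f)) s t :=
    fun f s t ht => by rw [Y.sk_sq, I_cmul _ _ ht]
  obtain ⟨C1, p1, H1⟩ := Pr_fin (fun (a : List (Fin 4) × Fin 3) s t => I (Dw a.1 (Y.v a.2) * Dw a.1 (Y.v a.2)) s t)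
    ((S ×ˢ Finset.univ).filter fun a => a.1.length ≤ 4)
    (fun a ha => Pr_of_GB (Y.v_G' (Finset.mem_filter.1 ha).2 a.2))
  obtain ⟨C2, p2, H2⟩ := Pr_fin (fun (a : List (Fin 4) × Fin 3 × Fin 3) s t =>
      I (Dw a.1 (Y.F a.2.1 a.2.2) * Dw a.1 (Y.F a.2.1 a.2.2)) s t)
    ((S ×ˢ Finset.univ).filter fun a => a.1.length ≤ 4)
    (fun a ha => Pr_of_GB (Y.F_G' (Finset.mem_filter.1 ha).2 a.2.1 a.2.2))
  obtain ⟨C3, p3, H3⟩ := Pr_fin (fun (γ : List (Fin 4)) s t => Y.σ * I (Dw γ Y.psi * Dw γ Y.psi) s t)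
    (S.filter fun γ => 3 ∉ γ ∧ γ.length ≤ 5 ∧ γ.count 0 ≤ 4)
    (fun γ h => by
      obtain ⟨_, a, b, c⟩ := Finset.mem_filter.1 h
      exact Pr_cmul (Pr_of_GB (Y.psi5_G a b c)) Y.hσ.le)
  obtain ⟨C4, p4, H4⟩ := Pr_fin (fun (γ : List (Fin 4)) s t => I (Y.sk * Y.sk * (Dw γ Y.psi * Dw γ Y.psi)) s t)
    (S.filter fun γ => 3 ∉ γ ∧ γ.length ≤ 6 ∧ γ.count 0 ≤ 4)
    (fun γ h => by
      obtain ⟨_, a, b, c⟩ := Finset.mem_filter.1 h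
      apply Pr_of_GB
      rw [mul_mul_mul_comm]
      exact Y.kpsi_G a b c)
  obtain ⟨C5, p5, H5⟩ := Pr_fin (fun (γ : List (Fin 4)) s t =>
      ∫ r in (0:ℝ)..t, I (Y.sk * Y.sk * (Dw γ Y.psi * Dw γ Y.psi)) s r)
    (S.filter fun γ => 3 ∉ γ ∧ γ.length ≤ 6 ∧ γ.count 0 ≤ 5 ∧ 1 ≤ γ.count 0)
    (fun γ h => by
      obtain ⟨_, a, b, c, d⟩ := Finset.mem_filter.1 h
      exact Y.kpsi_TI a b c d)
  set C := C1 + C2 + C3 + C4 + C5 with hC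
  have hC0 : 0 ≤ C := by positivity
  refine ⟨1 + (Ce * C) ^ 2, fun K => ?_⟩
  obtain ⟨τ1, q1, G1⟩ := H1 K
  obtain ⟨τ2, q2, G2⟩ := H2 K
  obtain ⟨τ3, q3, G3⟩ := H3 K
  obtain ⟨τ4, q4, G4⟩ := H4 K
  obtain ⟨τ5, q5, G5⟩ := H5 K
  refine ⟨min τ1 (min τ2 (min τ3 (min τ4 τ5))), by positivity, fun s hs t ht => ?_⟩
  have hmin := hs.1
  simp only [le_min_iff] at hmin
  obtain ⟨m1, m2, m3, m4, m5⟩ := hmin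
  have hw := one_le_wt ht
  have le : ∀ c, c ≤ C → c * wt s t ≤ C * wt s t := fun c hc =>
    mul_le_mul_of_nonneg_right hc (zero_le_one.trans hw)
  have key := hE s t ht (C * wt s t)
    (fun i γ h => (G1 s ⟨m1, hs.2⟩ t ht (γ, i) (by simp [hS γ (by omega), h])).trans (le _ (by linarith)))
    (fun k i γ h => (G2 s ⟨m2, hs.2⟩ t ht (γ, k, i) (by simp [hS γ (by omega), h])).trans (le _ (by linarith)))
    (fun γ a b c => (G3 s ⟨m3, hs.2⟩ t ht γ
      (Finset.mem_filter.2 ⟨hS γ (by omega), a, b, c⟩)).trans (le _ (by linarith)))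
    (fun γ a b c => by
      rw [hκI _ _ _ ht]
      exact (G4 s ⟨m4, hs.2⟩ t ht γ (Finset.mem_filter.2 ⟨hS γ (by omega), a, b, c⟩)).trans (le _ (by linarith)))
    (fun γ a b c d => by
      rw [← intervalIntegral.integral_const_mul]
      rw [intervalIntegral.integral_congr (g := fun r => I (Y.sk * Y.sk * (Dw γ Y.psi * Dw γ Y.psi)) s r)]
      · exact (G5 s ⟨m5, hs.2⟩ t ht γ (Finset.mem_filter.2 ⟨hS γ (by omega), a, b, c, d⟩)).trans (le _ (by linarith))
      · intro r hr
        rw [uIcc_of_le ht.1] at hr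
        exact hκI _ _ _ ⟨hr.1, hr.2.trans ht.2⟩)
  have e := wt_sq ht
  have := sq_nonneg (Ce * C - wt s t)
  nlinarith

end Sys
end EE

namespace EE
open scoped ContDiff
open MeasureTheory Set Filter Topology

/-- Uncurrying of functions of four variables. -/
def u4 (f : Fn4) : Pt → ℝ := fun p => f p.1 p.2.1 p.2.2.1 p.2.2.2
/-- Uncurrying of boundary functions, constant in the vertical variable. -/
def uB (f : FnB) : Pt → ℝ := fun p => f p.1 p.2.1 p.2.2.1

/-- Iterated partial derivatives. -/
def ddw (γ : List (Fin 4)) (f : Pt → ℝ) : Pt → ℝ := γ.foldr dd f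

lemma ddw_cons (i : Fin 4) (γ : List (Fin 4)) (f : Pt → ℝ) : ddw (i :: γ) f = dd i (ddw γ f) := rfl
lemma ddw_append (γ δ : List (Fin 4)) (f : Pt → ℝ) : ddw (γ ++ δ) f = ddw γ (ddw δ f) := by
  simp [ddw]

lemma Sm.ddw {f : Pt → ℝ} (hf : Sm f) (γ : List (Fin 4)) : Sm (ddw γ f) := by
  induction γ with
  | nil => exact hf
  | cons i γ ih => exact ih.dd i

lemma ddw_perm {f : Pt → ℝ} (hf : Sm f) {γ δ : List (Fin 4)} (h : γ.Perm δ) : ddw γ f = ddw δ f := by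
  induction h with
  | nil => rfl
  | cons x _ ih => rw [ddw_cons, ddw_cons, ih]
  | swap x y l => simp only [ddw_cons]; exact dd_comm (hf.ddw l) _ _
  | trans _ _ h1 h2 => rw [h1, h2]

lemma u4_pt {f : Fn4} (hf : Sm (u4 f)) : u4 (pt f) = dd 0 (u4 f) := by
  funext p; exact (pt_eq p.1 p.2.1 p.2.2.1 p.2.2.2 (u4 f) hf).1.deriv
lemma u4_p1 {f : Fn4} (hf : Sm (u4 f)) : u4 (p1 f) = dd 1 (u4 f) := by
  funext p; exact (pt_eq p.1 p.2.1 p.2.2.1 p.2.2.2 (u4 f) hf).2.1.deriv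
lemma u4_p2 {f : Fn4} (hf : Sm (u4 f)) : u4 (p2 f) = dd 2 (u4 f) := by
  funext p; exact (pt_eq p.1 p.2.1 p.2.2.1 p.2.2.2 (u4 f) hf).2.2.1.deriv
lemma u4_p3 {f : Fn4} (hf : Sm (u4 f)) : u4 (p3 f) = dd 3 (u4 f) := by
  funext p; exact (pt_eq p.1 p.2.1 p.2.2.1 p.2.2.2 (u4 f) hf).2.2.2.deriv
lemma uB_bt {f : FnB} (hf : Sm (uB f)) : uB (bt f) = dd 0 (uB f) := by
  funext p; exact (pt_eq p.1 p.2.1 p.2.2.1 p.2.2.2 (uB f) hf).1.deriv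
lemma uB_b1 {f : FnB} (hf : Sm (uB f)) : uB (b1 f) = dd 1 (uB f) := by
  funext p; exact (pt_eq p.1 p.2.1 p.2.2.1 p.2.2.2 (uB f) hf).2.1.deriv
lemma uB_b2 {f : FnB} (hf : Sm (uB f)) : uB (b2 f) = dd 2 (uB f) := by
  funext p; exact (pt_eq p.1 p.2.1 p.2.2.1 p.2.2.2 (uB f) hf).2.2.1.deriv
lemma uB_d3 {f : FnB} (hf : Sm (uB f)) : dd 3 (uB f) = 0 := by
  funext p
  have h := (pt_eq p.1 p.2.1 p.2.2.1 p.2.2.2 (uB f) hf).2.2.2.deriv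
  have h2 : (fun y => uB f (p.1, p.2.1, p.2.2.1, y)) = fun _ => uB f p := rfl
  rw [h2] at h; simpa using h.symm

lemma u4_iter {o : Fn4 → Fn4} {i : Fin 4} (ho : ∀ f, Sm (u4 f) → u4 (o f) = dd i (u4 f))
    {f : Fn4} (hf : Sm (u4 f)) (n : ℕ) :
    u4 (o^[n] f) = ddw (List.replicate n i) (u4 f) := by
  induction n with
  | zero => rfl
  | succ n ih =>
    have h : Sm (u4 (o^[n] f)) := ih ▸ hf.ddw _
    rw [Function.iterate_succ_apply', ho _ h, ih, List.replicate_succ, ddw_cons]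
lemma uB_iter {o : FnB → FnB} {i : Fin 4} (ho : ∀ f, Sm (uB f) → uB (o f) = dd i (uB f))
    {f : FnB} (hf : Sm (uB f)) (n : ℕ) :
    uB (o^[n] f) = ddw (List.replicate n i) (uB f) := by
  induction n with
  | zero => rfl
  | succ n ih =>
    have h : Sm (uB (o^[n] f)) := ih ▸ hf.ddw _
    rw [Function.iterate_succ_apply', ho _ h, ih, List.replicate_succ, ddw_cons]

lemma it1 (f : Fn4) (t : ℝ) (n : ℕ) : s1^[n] (f t) = (p1^[n] f) t := by
  induction n with
  | zero => rfl
  | succ n ih => rw [Function.iterate_succ_apply', ih, Function.iterate_succ_apply']; rfl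
lemma it2 (f : Fn4) (t : ℝ) (n : ℕ) : s2^[n] (f t) = (p2^[n] f) t := by
  induction n with
  | zero => rfl
  | succ n ih => rw [Function.iterate_succ_apply', ih, Function.iterate_succ_apply']; rfl
lemma it3 (f : Fn4) (t : ℝ) (n : ℕ) : s3^[n] (f t) = (p3^[n] f) t := by
  induction n with
  | zero => rfl
  | succ n ih => rw [Function.iterate_succ_apply', ih, Function.iterate_succ_apply']; rfl
lemma jt1 (f : FnB) (t : ℝ) (n : ℕ) : d1^[n] (f t) = (b1^[n] f) t := by
  induction n with
  | zero => rfl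
  | succ n ih => rw [Function.iterate_succ_apply', ih, Function.iterate_succ_apply']; rfl
lemma jt2 (f : FnB) (t : ℝ) (n : ℕ) : d2^[n] (f t) = (b2^[n] f) t := by
  induction n with
  | zero => rfl
  | succ n ih => rw [Function.iterate_succ_apply', ih, Function.iterate_succ_apply']; rfl

/-- Normal form of derivative words. -/
def lst (l a1 a2 a3 : ℕ) : List (Fin 4) :=
  List.replicate a1 1 ++ (List.replicate a2 2 ++ (List.replicate a3 3 ++ List.replicate l 0))

lemma lst_perm (γ : List (Fin 4)) : γ.Perm (lst (γ.count 0) (γ.count 1) (γ.count 2) (γ.count 3)) := by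
  rw [List.perm_iff_count]
  intro a
  fin_cases a <;> simp [lst, List.count_replicate]

lemma lst_len (γ : List (Fin 4)) :
    γ.length = γ.count 1 + (γ.count 2 + (γ.count 3 + γ.count 0)) := by
  have := (lst_perm γ).length_eq
  simpa [lst] using this

/-- Square integral of a derivative. -/
def N (b : ℝ) (γ : List (Fin 4)) (f : Pt → ℝ) (t : ℝ) : ℝ := IA b (fun p => ddw γ f p ^ 2) t

lemma N_nonneg (b : ℝ) (γ : List (Fin 4)) (f : Pt → ℝ) (t : ℝ) : 0 ≤ N b γ f t :=
  integral_nonneg fun _ => sq_nonneg _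

lemma Sm_sq {f : Pt → ℝ} (hf : Sm f) : Sm (fun p => f p ^ 2) := hf.comp (g := fun x => x ^ 2) (by fun_prop)

lemma N_cont (b : ℝ) (γ : List (Fin 4)) {f : Pt → ℝ} (hf : Sm f) : Continuous (N b γ f) :=
  continuous_iff_continuousAt.2 fun t => (IA_hasDeriv b (Sm_sq (hf.ddw γ)) t).continuousAt

lemma intOmega_eq {b : ℝ} (hb : 0 < b) {f : Fn4} (hf : Sm (u4 f)) (l : ℕ) (a : ℕ × ℕ × ℕ) (t : ℝ) :
    intOmega b (fun x1 x2 x3 => (sD a (fun x1 x2 x3 => (pt^[l]) f t x1 x2 x3) x1 x2 x3) ^ 2) =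
      N b (lst l a.1 a.2.1 a.2.2) (u4 f) t := by
  have e0 := u4_iter (fun f h => u4_pt h) hf l
  have h0 : Sm (u4 (pt^[l] f)) := e0 ▸ hf.ddw _
  have e3 := u4_iter (fun f h => u4_p3 h) h0 a.2.2
  have h3 : Sm (u4 (p3^[a.2.2] (pt^[l] f))) := e3 ▸ h0.ddw _
  have e2 := u4_iter (fun f h => u4_p2 h) h3 a.2.1
  have h2 : Sm (u4 (p2^[a.2.1] (p3^[a.2.2] (pt^[l] f)))) := e2 ▸ h3.ddw _
  have e1 := u4_iter (fun f h => u4_p1 h) h2 a.1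
  have key : u4 (p1^[a.1] (p2^[a.2.1] (p3^[a.2.2] (pt^[l] f)))) = ddw (lst l a.1 a.2.1 a.2.2) (u4 f) := by
    rw [e1, e2, e3, e0, lst, ddw_append, ddw_append, ddw_append]
  unfold N
  rw [IA_eq hb (Sm_sq (hf.ddw _)).cont, ← key]
  unfold intOmega sD
  change (∫ x1 in (0:ℝ)..1, ∫ x2 in (0:ℝ)..1, ∫ x3 in (-b)..(0:ℝ),
    (s1^[a.1] (s2^[a.2.1] (s3^[a.2.2] ((pt^[l] f) t))) x1 x2 x3) ^ 2) = _
  rw [it3, it2, it1]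
  rfl

lemma uB_tf (f : FnB) (c : ℝ) : tf c (uB f) = uB f := rfl

lemma intSurf_eq {b : ℝ} (hb : 0 < b) {f : FnB} (hf : Sm (uB f)) (l : ℕ) (a : ℕ × ℕ) (t : ℝ) :
    b * intSurf (fun x1 x2 => (dD a (fun x1 x2 => (bt^[l]) f t x1 x2) x1 x2) ^ 2) =
      N b (lst l a.1 a.2 0) (uB f) t := by
  have e0 := uB_iter (fun f h => uB_bt h) hf l
  have h0 : Sm (uB (bt^[l] f)) := e0 ▸ hf.ddw _
  have e2 := uB_iter (fun f h => uB_b2 h) h0 a.2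
  have h2 : Sm (uB (b2^[a.2] (bt^[l] f))) := e2 ▸ h0.ddw _
  have e1 := uB_iter (fun f h => uB_b1 h) h2 a.1
  have key : uB (b1^[a.1] (b2^[a.2] (bt^[l] f))) = ddw (lst l a.1 a.2 0) (uB f) := by
    rw [e1, e2, e0, lst, ddw_append, ddw_append]; rfl
  have h1 : Sm (uB (b1^[a.1] (b2^[a.2] (bt^[l] f)))) := key ▸ hf.ddw _
  unfold N
  rw [← key]
  have := IA_tf hb (Sm_sq h1) 0 t
  rw [show (fun p => uB (b1^[a.1] (b2^[a.2] (bt^[l] f))) p ^ 2) =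
    tf 0 (fun p => uB (b1^[a.1] (b2^[a.2] (bt^[l] f))) p ^ 2) from rfl, this]
  unfold intSurf dD
  change b * (∫ x1 in (0:ℝ)..1, ∫ x2 in (0:ℝ)..1,
    (d1^[a.1] (d2^[a.2] ((bt^[l] f) t)) x1 x2) ^ 2) = _
  rw [jt2, jt1]
  rfl

/-- Index set for bulk norms. -/
def SO (m : ℕ) : Finset (ℕ × ℕ × ℕ) :=
  (Finset.range (m + 1) ×ˢ Finset.range (m + 1) ×ˢ Finset.range (m + 1)).filter
      (fun a => a.1 + a.2.1 + a.2.2 ≤ m)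
/-- Index set for surface norms. -/
def SS (m : ℕ) : Finset (ℕ × ℕ) :=
  (Finset.range (m + 1) ×ˢ Finset.range (m + 1)).filter (fun a => a.1 + a.2 ≤ m)

lemma mem_SO {m : ℕ} {a : ℕ × ℕ × ℕ} : a ∈ SO m ↔ a.1 + a.2.1 + a.2.2 ≤ m := by
  simp only [SO, Finset.mem_filter, Finset.mem_product, Finset.mem_range]; omega
lemma mem_SS {m : ℕ} {a : ℕ × ℕ} : a ∈ SS m ↔ a.1 + a.2 ≤ m := by
  simp only [SS, Finset.mem_filter, Finset.mem_product, Finset.mem_range]; omega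

/-- Bulk part. -/
def NO (b : ℝ) (l : ℕ) (f : Pt → ℝ) (t : ℝ) : ℝ :=
  ∑ a ∈ SO (4 - l), N b (lst l a.1 a.2.1 a.2.2) f t
/-- Surface part. -/
def NS (b : ℝ) (m l : ℕ) (f : Pt → ℝ) (t : ℝ) : ℝ :=
  ∑ a ∈ SS m, N b (lst l a.1 a.2 0) f t / b

lemma NO_nonneg (b : ℝ) (l : ℕ) (f : Pt → ℝ) (t : ℝ) : 0 ≤ NO b l f t :=
  Finset.sum_nonneg fun _ _ => N_nonneg _ _ _ _
lemma NS_nonneg {b : ℝ} (hb : 0 < b) (m l : ℕ) (f : Pt → ℝ) (t : ℝ) : 0 ≤ NS b m l f t :=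
  Finset.sum_nonneg fun _ _ => div_nonneg (N_nonneg _ _ _ _) hb.le
lemma NO_cont (b : ℝ) (l : ℕ) {f : Pt → ℝ} (hf : Sm f) : Continuous (NO b l f) :=
  continuous_finsetSum _ fun _ _ => N_cont _ _ hf
lemma NS_cont (b : ℝ) (m l : ℕ) {f : Pt → ℝ} (hf : Sm f) : Continuous (NS b m l f) :=
  continuous_finsetSum _ fun _ _ => (N_cont _ _ hf).div_const _

/-- The energy in terms of uncurried fields. -/
def En (b σ κ : ℝ) (ψ : FnB) (v : Fin 3 → Fn4) (F : Fin 3 → Fin 3 → Fn4) (l : ℕ) (t : ℝ) : ℝ :=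
  (∑ i : Fin 3, NO b l (u4 (v i)) t) + (∑ j : Fin 3, ∑ i : Fin 3, NO b l (u4 (F j i)) t) +
    σ * NS b (5 - l) l (uB ψ) t + κ * NS b (6 - l) l (uB ψ) t +
    κ * ∫ s in (0:ℝ)..t, NS b (5 - l) (l + 1) (uB ψ) s

lemma HsqOmega_eq {b : ℝ} (hb : 0 < b) {f : Fn4} (hf : Sm (u4 f)) (l : ℕ) (t : ℝ) :
    HsqOmega b (4 - l) (fun x1 x2 x3 => (pt^[l]) f t x1 x2 x3) = NO b l (u4 f) t :=
  Finset.sum_congr rfl fun a _ => intOmega_eq hb hf l a t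

lemma HsqSurf_eq {b : ℝ} (hb : 0 < b) {f : FnB} (hf : Sm (uB f)) (m l : ℕ) (t : ℝ) :
    HsqSurf m (fun x1 x2 => (bt^[l]) f t x1 x2) = NS b m l (uB f) t :=
  Finset.sum_congr rfl fun a _ => by
    rw [eq_div_iff hb.ne', mul_comm]; exact intSurf_eq hb hf l a t

lemma energy_eq {b σ κ : ℝ} (hb : 0 < b) {ψ : FnB} {v : Fin 3 → Fn4} {F : Fin 3 → Fin 3 → Fn4}
    (hψ : Sm (uB ψ)) (hv : ∀ i, Sm (u4 (v i))) (hF : ∀ j i, Sm (u4 (F j i))) (t : ℝ) :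
    energy4 b σ κ ψ v F t = ∑ l ∈ Finset.range 5, En b σ κ ψ v F l t := by
  unfold energy4 En
  refine Finset.sum_congr rfl fun l _ => ?_
  simp only [HsqOmega_eq hb (hv _), HsqOmega_eq hb (hF _ _), HsqSurf_eq hb hψ]

lemma En_nonneg {b σ κ : ℝ} (hb : 0 < b) (hσ : 0 < σ) (hκ : 0 < κ) (ψ : FnB) (v : Fin 3 → Fn4)
    (F : Fin 3 → Fin 3 → Fn4) (l : ℕ) {t : ℝ} (ht : 0 ≤ t) : 0 ≤ En b σ κ ψ v F l t := by
  unfold En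
  have h1 : 0 ≤ ∑ i : Fin 3, NO b l (u4 (v i)) t := Finset.sum_nonneg fun _ _ => NO_nonneg _ _ _ _
  have h2 : 0 ≤ ∑ j : Fin 3, ∑ i : Fin 3, NO b l (u4 (F j i)) t :=
    Finset.sum_nonneg fun _ _ => Finset.sum_nonneg fun _ _ => NO_nonneg _ _ _ _
  have h3 := mul_nonneg hσ.le (NS_nonneg hb (5 - l) l (uB ψ) t)
  have h4 := mul_nonneg hκ.le (NS_nonneg hb (6 - l) l (uB ψ) t)
  have h5 : 0 ≤ κ * ∫ s in (0:ℝ)..t, NS b (5 - l) (l + 1) (uB ψ) s :=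
    mul_nonneg hκ.le (intervalIntegral.integral_nonneg ht fun _ _ => NS_nonneg hb _ _ _ _)
  linarith

lemma energy_cont {b σ κ : ℝ} (hb : 0 < b) {ψ : FnB} {v : Fin 3 → Fn4} {F : Fin 3 → Fin 3 → Fn4}
    (hψ : Sm (uB ψ)) (hv : ∀ i, Sm (u4 (v i))) (hF : ∀ j i, Sm (u4 (F j i))) :
    Continuous (energy4 b σ κ ψ v F) := by
  rw [show energy4 b σ κ ψ v F = fun t => ∑ l ∈ Finset.range 5, En b σ κ ψ v F l t from
    funext fun t => energy_eq hb hψ hv hF t]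
  refine continuous_finsetSum _ fun l _ => ?_
  unfold En
  have h5 : Continuous fun t => ∫ s in (0:ℝ)..t, NS b (5 - l) (l + 1) (uB ψ) s :=
    intervalIntegral.continuous_primitive
      (fun a c => (NS_cont b (5 - l) (l + 1) hψ).intervalIntegrable a c) 0
  have h1 : Continuous fun t => ∑ i : Fin 3, NO b l (u4 (v i)) t :=
    continuous_finsetSum _ fun i _ => NO_cont b l (hv i)
  have h2 : Continuous fun t => ∑ j : Fin 3, ∑ i : Fin 3, NO b l (u4 (F j i)) t :=
    continuous_finsetSum _ fun j _ => continuous_finsetSum _ fun i _ => NO_cont b l (hF j i)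
  have h3 := NS_cont b (5 - l) l hψ
  have h4 := NS_cont b (6 - l) l hψ
  fun_prop

/-- Each piece is controlled by the energy. -/
lemma energy_ge {b σ κ : ℝ} (hb : 0 < b) (hσ : 0 < σ) (hκ : 0 < κ) {ψ : FnB} {v : Fin 3 → Fn4}
    {F : Fin 3 → Fin 3 → Fn4}
    (hψ : Sm (uB ψ)) (hv : ∀ i, Sm (u4 (v i))) (hF : ∀ j i, Sm (u4 (F j i))) {t : ℝ} (ht : 0 ≤ t) :
    (∀ i γ, γ.length ≤ 4 → N b γ (u4 (v i)) t ≤ energy4 b σ κ ψ v F t) ∧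
    (∀ j i γ, γ.length ≤ 4 → N b γ (u4 (F j i)) t ≤ energy4 b σ κ ψ v F t) ∧
    (∀ γ : List (Fin 4), 3 ∉ γ → γ.length ≤ 5 → γ.count 0 ≤ 4 →
      σ * N b γ (uB ψ) t ≤ b * energy4 b σ κ ψ v F t) ∧
    (∀ γ : List (Fin 4), 3 ∉ γ → γ.length ≤ 6 → γ.count 0 ≤ 4 →
      κ * N b γ (uB ψ) t ≤ b * energy4 b σ κ ψ v F t) := by
  have key : ∀ l ∈ Finset.range 5, En b σ κ ψ v F l t ≤ energy4 b σ κ ψ v F t := fun l hl => by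
    rw [energy_eq hb hψ hv hF t]
    exact Finset.single_le_sum (f := fun l => En b σ κ ψ v F l t)
      (fun l _ => En_nonneg hb hσ hκ ψ v F l ht) hl
  have h1 (l : ℕ) : 0 ≤ ∑ i : Fin 3, NO b l (u4 (v i)) t := Finset.sum_nonneg fun _ _ => NO_nonneg _ _ _ _
  have h2 (l : ℕ) : 0 ≤ ∑ j : Fin 3, ∑ i : Fin 3, NO b l (u4 (F j i)) t :=
    Finset.sum_nonneg fun _ _ => Finset.sum_nonneg fun _ _ => NO_nonneg _ _ _ _
  have h3 (l : ℕ) := mul_nonneg hσ.le (NS_nonneg hb (5 - l) l (uB ψ) t)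
  have h4 (l : ℕ) := mul_nonneg hκ.le (NS_nonneg hb (6 - l) l (uB ψ) t)
  have h5 (l : ℕ) : 0 ≤ κ * ∫ s in (0:ℝ)..t, NS b (5 - l) (l + 1) (uB ψ) s :=
    mul_nonneg hκ.le (intervalIntegral.integral_nonneg ht fun _ _ => NS_nonneg hb _ _ _ _)
  have nO (f : Pt → ℝ) (hf : Sm f) (γ : List (Fin 4)) (h : γ.length ≤ 4) :
      N b γ f t ≤ NO b (γ.count 0) f t := by
    have hl := lst_len γ
    have e : N b γ f t = N b (lst (γ.count 0) (γ.count 1) (γ.count 2) (γ.count 3)) f t := by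
      unfold N; rw [ddw_perm hf (lst_perm γ)]
    rw [e]
    exact Finset.single_le_sum (f := fun a : ℕ × ℕ × ℕ => N b (lst (γ.count 0) a.1 a.2.1 a.2.2) f t)
      (a := (γ.count 1, γ.count 2, γ.count 3)) (fun _ _ => N_nonneg _ _ _ _) (mem_SO.2 (by simp only; omega))
  have nS (f : Pt → ℝ) (hf : Sm f) (γ : List (Fin 4)) (m : ℕ) (h : γ.length ≤ m) (h3 : 3 ∉ γ) :
      N b γ f t ≤ b * NS b (m - γ.count 0) (γ.count 0) f t := by
    have hl := lst_len γ
    have h30 : γ.count 3 = 0 := List.count_eq_zero.2 h3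
    have e : N b γ f t = N b (lst (γ.count 0) (γ.count 1) (γ.count 2) 0) f t := by
      unfold N; rw [ddw_perm hf (lst_perm γ), h30]
    rw [e, mul_comm, ← div_le_iff₀ hb]
    exact Finset.single_le_sum (f := fun a : ℕ × ℕ => N b (lst (γ.count 0) a.1 a.2 0) f t / b)
      (a := (γ.count 1, γ.count 2)) (fun _ _ => div_nonneg (N_nonneg _ _ _ _) hb.le)
      (mem_SS.2 (by simp only; omega))
  refine ⟨fun i γ h => ?_, fun j i γ h => ?_, fun γ g3 h h0 => ?_, fun γ g3 h h0 => ?_⟩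
  · have a := nO _ (hv i) γ h
    have c : NO b (γ.count 0) (u4 (v i)) t ≤ ∑ i : Fin 3, NO b (γ.count 0) (u4 (v i)) t :=
      Finset.single_le_sum (f := fun i => NO b (γ.count 0) (u4 (v i)) t)
        (fun _ _ => NO_nonneg _ _ _ _) (Finset.mem_univ i)
    have d := key (γ.count 0) (Finset.mem_range.2 (by have := lst_len γ; omega))
    unfold En at d
    linarith [h1 (γ.count 0), h2 (γ.count 0), h3 (γ.count 0), h4 (γ.count 0), h5 (γ.count 0)]
  · have a := nO _ (hF j i) γ h
    have c : NO b (γ.count 0) (u4 (F j i)) t ≤ ∑ i : Fin 3, NO b (γ.count 0) (u4 (F j i)) t :=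
      Finset.single_le_sum (f := fun i => NO b (γ.count 0) (u4 (F j i)) t)
        (fun _ _ => NO_nonneg _ _ _ _) (Finset.mem_univ i)
    have c' : ∑ i : Fin 3, NO b (γ.count 0) (u4 (F j i)) t ≤
        ∑ j : Fin 3, ∑ i : Fin 3, NO b (γ.count 0) (u4 (F j i)) t :=
      Finset.single_le_sum (f := fun j => ∑ i : Fin 3, NO b (γ.count 0) (u4 (F j i)) t)
        (fun _ _ => Finset.sum_nonneg fun _ _ => NO_nonneg _ _ _ _) (Finset.mem_univ j)
    have d := key (γ.count 0) (Finset.mem_range.2 (by have := lst_len γ; omega))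
    unfold En at d
    linarith [h1 (γ.count 0), h2 (γ.count 0), h3 (γ.count 0), h4 (γ.count 0), h5 (γ.count 0)]
  · have a := nS _ hψ γ 5 h g3
    have d := key (γ.count 0) (Finset.mem_range.2 (by omega))
    unfold En at d
    have e : σ * NS b (5 - γ.count 0) (γ.count 0) (uB ψ) t ≤ energy4 b σ κ ψ v F t := by
      linarith [h1 (γ.count 0), h2 (γ.count 0), h3 (γ.count 0), h4 (γ.count 0), h5 (γ.count 0)]
    calc _ ≤ σ * (b * NS b (5 - γ.count 0) (γ.count 0) (uB ψ) t) := mul_le_mul_of_nonneg_left a hσ.le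
      _ = b * (σ * NS b (5 - γ.count 0) (γ.count 0) (uB ψ) t) := by ring
      _ ≤ _ := mul_le_mul_of_nonneg_left e hb.le
  · have a := nS _ hψ γ 6 h g3
    have d := key (γ.count 0) (Finset.mem_range.2 (by omega))
    unfold En at d
    have e : κ * NS b (6 - γ.count 0) (γ.count 0) (uB ψ) t ≤ energy4 b σ κ ψ v F t := by
      linarith [h1 (γ.count 0), h2 (γ.count 0), h3 (γ.count 0), h4 (γ.count 0), h5 (γ.count 0)]
    calc _ ≤ κ * (b * NS b (6 - γ.count 0) (γ.count 0) (uB ψ) t) := mul_le_mul_of_nonneg_left a hκ.le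
      _ = b * (κ * NS b (6 - γ.count 0) (γ.count 0) (uB ψ) t) := by ring
      _ ≤ _ := mul_le_mul_of_nonneg_left e hb.le

/-- The combinatorial constant. -/
def Cen (b : ℝ) : ℝ := ∑ l ∈ Finset.range 5, ((∑ _i : Fin 3, ∑ _a ∈ SO (4 - l), (1:ℝ)) +
  (∑ _j : Fin 3, ∑ _i : Fin 3, ∑ _a ∈ SO (4 - l), (1:ℝ)) + (∑ _a ∈ SS (5 - l), 1 / b) +
  (∑ _a ∈ SS (6 - l), 1 / b) + (∑ _a ∈ SS (5 - l), 1 / b))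

lemma Cen_nonneg {b : ℝ} (hb : 0 < b) : 0 ≤ Cen b := by unfold Cen; positivity

lemma lst_count0 (l a1 a2 a3 : ℕ) : (lst l a1 a2 a3).count 0 = l := by simp [lst, List.count_replicate]
lemma lst_no3 (l a1 a2 : ℕ) : 3 ∉ lst l a1 a2 0 := by simp [lst]
lemma lst_length (l a1 a2 a3 : ℕ) : (lst l a1 a2 a3).length = a1 + (a2 + (a3 + l)) := by simp [lst]

/-- The energy is controlled by its pieces. -/
lemma energy_le {b σ κ : ℝ} (hb : 0 < b) {ψ : FnB} {v : Fin 3 → Fn4} {F : Fin 3 → Fin 3 → Fn4}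
    (hψ : Sm (uB ψ)) (hv : ∀ i, Sm (u4 (v i))) (hF : ∀ j i, Sm (u4 (F j i))) {t : ℝ} (B : ℝ)
    (H1 : ∀ i γ, γ.length ≤ 4 → N b γ (u4 (v i)) t ≤ B)
    (H2 : ∀ j i γ, γ.length ≤ 4 → N b γ (u4 (F j i)) t ≤ B)
    (H3 : ∀ γ : List (Fin 4), 3 ∉ γ → γ.length ≤ 5 → γ.count 0 ≤ 4 → σ * N b γ (uB ψ) t ≤ B)
    (H4 : ∀ γ : List (Fin 4), 3 ∉ γ → γ.length ≤ 6 → γ.count 0 ≤ 4 → κ * N b γ (uB ψ) t ≤ B)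
    (H5 : ∀ γ : List (Fin 4), 3 ∉ γ → γ.length ≤ 6 → γ.count 0 ≤ 5 → 1 ≤ γ.count 0 →
      κ * ∫ r in (0:ℝ)..t, N b γ (uB ψ) r ≤ B) :
    energy4 b σ κ ψ v F t ≤ Cen b * B := by
  rw [energy_eq hb hψ hv hF t]
  unfold Cen En NO
  simp only [Finset.sum_mul, add_mul, one_mul]
  refine Finset.sum_le_sum fun l hl => ?_
  have hl' := Finset.mem_range.1 hl
  refine add_le_add (add_le_add (add_le_add (add_le_add ?_ ?_) ?_) ?_) ?_
  · refine Finset.sum_le_sum fun i _ => Finset.sum_le_sum fun a ha => H1 i _ ?_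
    have := mem_SO.1 ha; rw [lst_length]; omega
  · refine Finset.sum_le_sum fun j _ => Finset.sum_le_sum fun i _ => Finset.sum_le_sum fun a ha => H2 j i _ ?_
    have := mem_SO.1 ha; rw [lst_length]; omega
  · unfold NS
    rw [Finset.mul_sum]
    refine Finset.sum_le_sum fun a ha => ?_
    have := mem_SS.1 ha
    rw [← mul_div_assoc, div_mul_eq_mul_div, one_mul]
    exact div_le_div_of_nonneg_right (H3 _ (lst_no3 _ _ _) (by rw [lst_length]; omega)
      (by rw [lst_count0]; omega)) hb.le
  · unfold NS
    rw [Finset.mul_sum]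
    refine Finset.sum_le_sum fun a ha => ?_
    have := mem_SS.1 ha
    rw [← mul_div_assoc, div_mul_eq_mul_div, one_mul]
    exact div_le_div_of_nonneg_right (H4 _ (lst_no3 _ _ _) (by rw [lst_length]; omega)
      (by rw [lst_count0]; omega)) hb.le
  · unfold NS
    rw [intervalIntegral.integral_finsetSum
      (fun a _ => ((N_cont b _ hψ).div_const b).intervalIntegrable _ _), Finset.mul_sum]
    refine Finset.sum_le_sum fun a ha => ?_
    have := mem_SS.1 ha
    rw [intervalIntegral.integral_div, ← mul_div_assoc, div_mul_eq_mul_div, one_mul]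
    exact div_le_div_of_nonneg_right (H5 _ (lst_no3 _ _ _) (by rw [lst_length]; omega)
      (by rw [lst_count0]; omega) (by rw [lst_count0]; omega)) hb.le

end EE

namespace EE
open scoped ContDiff
open MeasureTheory Set Filter Topology

/-- Fixed parameters of the problem. -/
structure Par where
  b : ℝ
  hb : 0 < b
  χ : ℝ → ℝ
  hχ : ContDiff ℝ ∞ χ
  hχ0 : χ 0 = 1
  hχb : ∃ δ > 0, ∀ y ∈ Icc (-b) (-b + δ), χ y = 0
  σ : ℝ
  hσ : 0 < σ
  M : ℝ

variable {P : Par}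

/-- The flattening map. -/
def phF (P : Par) (ψ : FnB) : Fn4 := fun t x1 x2 x3 => x3 + P.χ x3 * ψ t x1 x2

/-- Solutions of the regularized problem. -/
structure Sol (P : Par) where
  κ : ℝ
  hκ : κ ∈ Ioc (0:ℝ) 1
  T : ℝ
  hT : 0 < T
  ψ : FnB
  v : Fin 3 → Fn4
  F : Fin 3 → Fin 3 → Fn4
  q : Fn4
  Sψ : Sm (uB ψ)
  Sv : ∀ i, Sm (u4 (v i))
  SF : ∀ j i, Sm (u4 (F j i))
  Sq : Sm (u4 q)
  jac : ∀ t ∈ Icc 0 T, ∀ (x1 x2 : ℝ), ∀ x3 ∈ Icc (-P.b) 0, (1:ℝ) / 2 ≤ p3 (phF P ψ) t x1 x2 x3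
  mom : ∀ i : Fin 3, ∀ t ∈ Icc 0 T, ∀ (x1 x2 : ℝ), ∀ x3 ∈ Ioo (-P.b) 0,
    matD (phF P ψ) v (v i) t x1 x2 x3 + fd (phF P ψ) i q t x1 x2 x3 =
      ∑ k : Fin 3, dirD (phF P ψ) (F k) (F k i) t x1 x2 x3
  divv : ∀ t ∈ Icc 0 T, ∀ (x1 x2 : ℝ), ∀ x3 ∈ Ioo (-P.b) 0,
    ∑ i : Fin 3, fd (phF P ψ) i (v i) t x1 x2 x3 = 0
  trans : ∀ j i : Fin 3, ∀ t ∈ Icc 0 T, ∀ (x1 x2 : ℝ), ∀ x3 ∈ Ioo (-P.b) 0,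
    matD (phF P ψ) v (F j i) t x1 x2 x3 = dirD (phF P ψ) (F j) (v i) t x1 x2 x3
  divF : ∀ j : Fin 3, ∀ t ∈ Icc 0 T, ∀ (x1 x2 : ℝ), ∀ x3 ∈ Ioo (-P.b) 0,
    ∑ i : Fin 3, fd (phF P ψ) i (F j i) t x1 x2 x3 = 0
  kin : ∀ t ∈ Icc 0 T, ∀ x1 x2 : ℝ,
    bt ψ t x1 x2 = v 0 t x1 x2 0 * (-(b1 ψ t x1 x2)) +
      v 1 t x1 x2 0 * (-(b2 ψ t x1 x2)) + v 2 t x1 x2 0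
  press : ∀ t ∈ Icc 0 T, ∀ x1 x2 : ℝ,
    q t x1 x2 0 = -P.σ * meanCurvOp ψ t x1 x2 +
      κ * oneMinusLap (oneMinusLap ψ) t x1 x2 + κ * oneMinusLap (bt ψ) t x1 x2
  tang : ∀ j : Fin 3, ∀ t ∈ Icc 0 T, ∀ x1 x2 : ℝ,
    F j 0 t x1 x2 0 * (-(b1 ψ t x1 x2)) + F j 1 t x1 x2 0 * (-(b2 ψ t x1 x2)) +
      F j 2 t x1 x2 0 = 0
  bot : ∀ t ∈ Icc 0 T, ∀ x1 x2 : ℝ,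
    v 2 t x1 x2 (-P.b) = 0 ∧ ∀ j : Fin 3, F j 2 t x1 x2 (-P.b) = 0

/-- The context of all solutions. -/
def cx (P : Par) : Ctx where
  S := Sol P
  T := Sol.T
  hT := Sol.hT
  b := P.b
  hb := P.hb
  E s := energy4 P.b P.σ s.κ s.ψ s.v s.F
  hE s t ht := by
    rw [energy_eq P.hb s.Sψ s.Sv s.SF t]
    exact Finset.sum_nonneg fun l _ => En_nonneg P.hb P.hσ s.hκ.1 _ _ _ l ht.1
  M := P.M

/-- A field from a family of functions. -/
def fld (f : Sol P → Pt → ℝ) (h : ∀ s, Sm (f s)) : Q (cx P) := mk ⟨f, h⟩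

lemma ev_fld (f : Sol P → Pt → ℝ) (h : ∀ s, Sm (f s)) {s : Sol P} {p : Pt} (hp : p ∈ Box (cx P) s) :
    ev (fld f h) s p = f s p := ev_mk _ hp

lemma D_fld (i : Fin 4) (f : Sol P → Pt → ℝ) (h : ∀ s, Sm (f s)) :
    D i (fld f h) = fld (fun s => dd i (f s)) (fun s => (h s).dd i) := D_mk _ _

lemma Dw_fld (γ : List (Fin 4)) (f : Sol P → Pt → ℝ) (h : ∀ s, Sm (f s)) :
    Dw γ (fld f h) = fld (fun s => ddw γ (f s)) (fun s => (h s).ddw γ) := by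
  induction γ with
  | nil => rfl
  | cons i γ ih => rw [Dw_cons, ih, D_fld]; rfl

lemma I_fld (γ : List (Fin 4)) (f : Sol P → Pt → ℝ) (h : ∀ s, Sm (f s)) {s : Sol P} {t : ℝ}
    (ht : t ∈ Tm (X := cx P) s) :
    I (Dw γ (fld f h) * Dw γ (fld f h)) s t = N P.b γ (f s) t := by
  rw [Dw_fld]
  refine (I_mk (X := cx P) (⟨_, fun s => (h s).ddw γ⟩ * ⟨_, fun s => (h s).ddw γ⟩) ht).trans ?_
  unfold N
  refine congrArg (fun g => IA P.b g t) ?_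
  funext p
  exact (sq _).symm

lemma Q_ext_Ioo {f g : Q (cx P)} (h : ∀ s : Sol P, ∀ p ∈ Box (cx P) s, p.2.2.2 ∈ Ioo (-P.b) 0 →
    ev f s p = ev g s p) : f = g := by
  refine Q_ext fun s p hp => ?_
  obtain ⟨t, x1, x2, x3⟩ := p
  have hc : IsClosed {y : ℝ | ev f s (t, x1, x2, y) = ev g s (t, x1, x2, y)} :=
    isClosed_eq (((rep f).2 s).cont.comp (by fun_prop)) (((rep g).2 s).cont.comp (by fun_prop))
  have hs : Ioo (-P.b) 0 ⊆ {y : ℝ | ev f s (t, x1, x2, y) = ev g s (t, x1, x2, y)} :=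
    fun y hy => h s (t, x1, x2, y) ⟨hp.1, hy.1.le, hy.2.le⟩ hy
  have := closure_minimal hs hc
  rw [closure_Ioo (by linarith [P.hb])] at this
  exact this hp.2

/-- Functions of the vertical variable. -/
def chF (g : ℝ → ℝ) : Pt → ℝ := fun p => g p.2.2.2

lemma chF_Sm {g : ℝ → ℝ} (hg : ContDiff ℝ ∞ g) : Sm (chF g) := by
  refine ⟨hg.comp (by fun_prop), fun p => ?_, fun p => ?_⟩ <;> simp [chF, ee]

lemma chF_d3 {g : ℝ → ℝ} (hg : ContDiff ℝ ∞ g) : dd 3 (chF g) = chF (deriv g) := by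
  funext p
  exact (pt_eq p.1 p.2.1 p.2.2.1 p.2.2.2 _ (chF_Sm hg)).2.2.2.deriv.symm

lemma chF_d {g : ℝ → ℝ} (hg : ContDiff ℝ ∞ g) {i : Fin 4} (hi : i ≠ 3) : dd i (chF g) = 0 := by
  funext p
  have h := pt_eq p.1 p.2.1 p.2.2.1 p.2.2.2 _ (chF_Sm hg)
  have h0 := h.1.deriv.symm
  have h1 := h.2.1.deriv.symm
  have h2 := h.2.2.1.deriv.symm
  simp only [chF, deriv_const] at h0 h1 h2
  fin_cases i
  · exact h0
  · exact h1
  · exact h2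
  · exact absurd rfl hi

lemma chi_form (P : Par) (γ : List (Fin 4)) : ∃ g : ℝ → ℝ, ContDiff ℝ ∞ g ∧
    (∃ δ > 0, ∀ y ∈ Icc (-P.b) (-P.b + δ), g y = 0) ∧ ddw γ (chF P.χ) = chF g := by
  induction γ with
  | nil => exact ⟨P.χ, P.hχ, P.hχb, rfl⟩
  | cons i γ ih =>
    obtain ⟨g, hg, ⟨δ, hδ, h0⟩, e⟩ := ih
    rw [ddw_cons, e]
    by_cases hi : i = 3
    · subst hi
      have hg' : ContDiff ℝ ∞ (deriv g) := by
        have := (contDiff_infty_iff_deriv (𝕜 := ℝ) (f := g)).1 hg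
        exact this.2
      refine ⟨deriv g, hg', ⟨δ, hδ, ?_⟩, chF_d3 hg⟩
      have hc : IsClosed {y : ℝ | deriv g y = 0} := isClosed_eq hg'.continuous continuous_const
      have hs : Ioo (-P.b) (-P.b + δ) ⊆ {y : ℝ | deriv g y = 0} := fun y hy => by
        have : g =ᶠ[𝓝 y] fun _ => 0 := by
          filter_upwards [Ioo_mem_nhds hy.1 hy.2] with z hz
          exact h0 z ⟨hz.1.le, hz.2.le⟩
        simp [this.deriv_eq]
      have := closure_minimal hs hc
      rw [closure_Ioo (by linarith)] at this
      exact this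
    · exact ⟨fun _ => 0, contDiff_const, ⟨δ, hδ, fun _ _ => rfl⟩, chF_d hg hi⟩

/-- A smooth cutoff inverse. -/
def cinv (x : ℝ) : ℝ := Real.smoothTransition (4 * x - 1) / x

lemma cinv_smooth : ContDiff ℝ ∞ cinv := by
  rw [contDiff_iff_contDiffAt]
  intro x
  by_cases hx : x < 1 / 4
  · have : cinv =ᶠ[𝓝 x] fun _ => 0 := by
      filter_upwards [Iio_mem_nhds hx] with y hy
      have hy' : y < 1 / 4 := hy
      simp [cinv, Real.smoothTransition.zero_of_nonpos (show 4 * y - 1 ≤ 0 by linarith)]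
    exact contDiffAt_const.congr_of_eventuallyEq this
  · refine ContDiffAt.div ?_ contDiffAt_id (by rintro rfl; norm_num at hx)
    exact (Real.smoothTransition.contDiff.comp (by fun_prop)).contDiffAt

lemma cinv_eq {x : ℝ} (hx : 1 / 2 ≤ x) : cinv x = 1 / x := by
  simp [cinv, Real.smoothTransition.one_of_one_le (show 1 ≤ 4 * x - 1 by linarith)]

/-- The normalization factor of the normal vector. -/
def nnF (s : Sol P) : Pt → ℝ := fun p => (Real.sqrt (1 + dd 1 (uB s.ψ) p ^ 2 + dd 2 (uB s.ψ) p ^ 2))⁻¹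

lemma nnF_Sm (s : Sol P) : Sm (nnF s) := by
  have h1 := s.Sψ.dd 1
  have h2 := s.Sψ.dd 2
  refine ⟨?_, fun p => ?_, fun p => ?_⟩
  · refine ContDiff.inv (ContDiff.sqrt ((contDiff_const.add (h1.smooth.pow 2)).add (h2.smooth.pow 2)) ?_) ?_
    · intro p; positivity
    · intro p; positivity
  · simp [nnF, h1.per1, h2.per1]
  · simp [nnF, h1.per2, h2.per2]

lemma ph_eq (s : Sol P) : u4 (phF P s.ψ) = chF id + chF P.χ * uB s.ψ := rfl
lemma ph_Sm (s : Sol P) : Sm (u4 (phF P s.ψ)) := by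
  rw [ph_eq]
  exact (chF_Sm contDiff_id).add ((chF_Sm P.hχ).mul s.Sψ)

/-- The fields. -/
def pre (P : Par) : Pre (cx P) where
  v i := fld (fun s => u4 (s.v i)) (fun s => s.Sv i)
  F j i := fld (fun s => u4 (s.F j i)) (fun s => s.SF j i)
  q := fld (fun s => u4 s.q) (fun s => s.Sq)
  psi := fld (fun s => uB s.ψ) (fun s => s.Sψ)
  chi := fld (fun _ => chF P.χ) (fun _ => chF_Sm P.hχ)
  iJ := fld (fun s p => cinv (dd 3 (u4 (phF P s.ψ)) p)) (fun s => ((ph_Sm s).dd 3).comp cinv_smooth)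
  nn := fld nnF nnF_Sm
  σ := P.σ
  κ := Sol.κ

lemma phi_eq : (pre P).phi = fld (fun s => u4 (phF P s.ψ)) ph_Sm := by
  refine Q_ext fun s p hp => ?_
  rw [Pre.phi, ev_add _ _ hp, ev_mul _ _ hp, ev_x3 hp, pre]
  simp only
  rw [ev_fld _ _ hp, ev_fld _ _ hp, ev_fld _ _ hp]
  rfl

lemma J_eq : (pre P).J = fld (fun s => dd 3 (u4 (phF P s.ψ))) (fun s => (ph_Sm s).dd 3) := by
  rw [Pre.J, phi_eq, D_fld]

lemma jac' (s : Sol P) {p : Pt} (hp : p ∈ Box (cx P) s) : 1 / 2 ≤ dd 3 (u4 (phF P s.ψ)) p := by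
  rw [← u4_p3 (ph_Sm s)]
  exact s.jac _ hp.1 _ _ _ hp.2

end EE

namespace EE
open scoped ContDiff
open MeasureTheory Set Filter Topology

variable {P : Par}

lemma pt_dd {f : Fn4} (hf : Sm (u4 f)) (t x1 x2 x3 : ℝ) : pt f t x1 x2 x3 = dd 0 (u4 f) (t, x1, x2, x3) :=
  congrFun (u4_pt hf) (t, x1, x2, x3)
lemma p1_dd {f : Fn4} (hf : Sm (u4 f)) (t x1 x2 x3 : ℝ) : p1 f t x1 x2 x3 = dd 1 (u4 f) (t, x1, x2, x3) :=
  congrFun (u4_p1 hf) (t, x1, x2, x3)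
lemma p2_dd {f : Fn4} (hf : Sm (u4 f)) (t x1 x2 x3 : ℝ) : p2 f t x1 x2 x3 = dd 2 (u4 f) (t, x1, x2, x3) :=
  congrFun (u4_p2 hf) (t, x1, x2, x3)
lemma p3_dd {f : Fn4} (hf : Sm (u4 f)) (t x1 x2 x3 : ℝ) : p3 f t x1 x2 x3 = dd 3 (u4 f) (t, x1, x2, x3) :=
  congrFun (u4_p3 hf) (t, x1, x2, x3)

lemma ev_Op (a : Fin 4 → Q (cx P)) (f : Sol P → Pt → ℝ) (h : ∀ s, Sm (f s)) {s : Sol P} {p : Pt}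
    (hp : p ∈ Box (cx P) s) : ev (Op a (fld f h)) s p = ev (a 0) s p * dd 0 (f s) p +
      ev (a 1) s p * dd 1 (f s) p + ev (a 2) s p * dd 2 (f s) p + ev (a 3) s p * dd 3 (f s) p := by
  simp only [Op, D_fld, ev_add _ _ hp, ev_mul _ _ hp, ev_fld _ _ hp]

lemma ev_Xv (f : Sol P → Pt → ℝ) (h : ∀ s, Sm (f s)) {s : Sol P} {p : Pt}
    (hp : p ∈ Box (cx P) s) : ev (Op (pre P).Xv (fld f h)) s p =
      dd 3 (u4 (phF P s.ψ)) p * dd 0 (f s) p +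
      dd 3 (u4 (phF P s.ψ)) p * u4 (s.v 0) p * dd 1 (f s) p +
      dd 3 (u4 (phF P s.ψ)) p * u4 (s.v 1) p * dd 2 (f s) p +
      (u4 (s.v 2) p - u4 (s.v 0) p * dd 1 (u4 (phF P s.ψ)) p - u4 (s.v 1) p * dd 2 (u4 (phF P s.ψ)) p
        - dd 0 (u4 (phF P s.ψ)) p) * dd 3 (f s) p := by
  rw [ev_Op _ _ _ hp]
  simp only [Pre.Xv, J_eq, phi_eq, D_fld, Matrix.cons_val]
  simp only [pre, ev_sub _ _ hp, ev_mul _ _ hp, ev_fld _ _ hp]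

lemma ev_Xk (k : Fin 3) (f : Sol P → Pt → ℝ) (h : ∀ s, Sm (f s)) {s : Sol P} {p : Pt}
    (hp : p ∈ Box (cx P) s) : ev (Op ((pre P).Xk k) (fld f h)) s p =
      dd 3 (u4 (phF P s.ψ)) p * u4 (s.F k 0) p * dd 1 (f s) p +
      dd 3 (u4 (phF P s.ψ)) p * u4 (s.F k 1) p * dd 2 (f s) p +
      (u4 (s.F k 2) p - u4 (s.F k 0) p * dd 1 (u4 (phF P s.ψ)) p
        - u4 (s.F k 1) p * dd 2 (u4 (phF P s.ψ)) p) * dd 3 (f s) p := by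
  rw [ev_Op _ _ _ hp]
  simp only [Pre.Xk, J_eq, phi_eq, D_fld, Matrix.cons_val]
  simp only [pre, ev_sub _ _ hp, ev_mul _ _ hp, ev_fld _ _ hp, ev_zero hp, zero_mul, zero_add]

lemma ev_B0 (f : Sol P → Pt → ℝ) (h : ∀ s, Sm (f s)) {s : Sol P} {p : Pt}
    (hp : p ∈ Box (cx P) s) : ev (Op ((pre P).Bm 0) (fld f h)) s p =
      dd 3 (u4 (phF P s.ψ)) p * dd 1 (f s) p - dd 1 (u4 (phF P s.ψ)) p * dd 3 (f s) p := by
  rw [ev_Op _ _ _ hp]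
  simp only [Pre.Bm, J_eq, phi_eq, D_fld, Matrix.cons_val]
  simp only [ev_neg _ hp, ev_fld _ _ hp, ev_zero hp, zero_mul, zero_add]
  ring
lemma ev_B1 (f : Sol P → Pt → ℝ) (h : ∀ s, Sm (f s)) {s : Sol P} {p : Pt}
    (hp : p ∈ Box (cx P) s) : ev (Op ((pre P).Bm 1) (fld f h)) s p =
      dd 3 (u4 (phF P s.ψ)) p * dd 2 (f s) p - dd 2 (u4 (phF P s.ψ)) p * dd 3 (f s) p := by
  rw [ev_Op _ _ _ hp]
  simp only [Pre.Bm, J_eq, phi_eq, D_fld, Matrix.cons_val]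
  simp only [ev_neg _ hp, ev_fld _ _ hp, ev_zero hp, zero_mul, zero_add]
  ring
lemma ev_B2 (f : Sol P → Pt → ℝ) (h : ∀ s, Sm (f s)) {s : Sol P} {p : Pt}
    (hp : p ∈ Box (cx P) s) : ev (Op ((pre P).Bm 2) (fld f h)) s p = dd 3 (f s) p := by
  rw [ev_Op _ _ _ hp]
  simp only [Pre.Bm, J_eq, phi_eq, D_fld, Matrix.cons_val]
  simp only [ev_one hp, ev_zero hp, zero_mul, zero_add, one_mul]

lemma matD_eq {s : Sol P} {f : Fn4} (hf : Sm (u4 f)) {p : Pt} (hp : p ∈ Box (cx P) s) :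
    dd 3 (u4 (phF P s.ψ)) p * matD (phF P s.ψ) s.v f p.1 p.2.1 p.2.2.1 p.2.2.2 =
      dd 3 (u4 (phF P s.ψ)) p * dd 0 (u4 f) p +
      dd 3 (u4 (phF P s.ψ)) p * u4 (s.v 0) p * dd 1 (u4 f) p +
      dd 3 (u4 (phF P s.ψ)) p * u4 (s.v 1) p * dd 2 (u4 f) p +
      (u4 (s.v 2) p - u4 (s.v 0) p * dd 1 (u4 (phF P s.ψ)) p - u4 (s.v 1) p * dd 2 (u4 (phF P s.ψ)) p
        - dd 0 (u4 (phF P s.ψ)) p) * dd 3 (u4 f) p := by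
  have h := jac' s hp
  have h0 : dd 3 (u4 (phF P s.ψ)) p ≠ 0 := by intro e; rw [e] at h; norm_num at h
  simp only [matD, pt_dd hf, p1_dd hf, p2_dd hf, p3_dd hf, pt_dd (ph_Sm s), p1_dd (ph_Sm s),
    p2_dd (ph_Sm s), p3_dd (ph_Sm s), u4]
  field_simp
  ring

lemma fd0_eq {s : Sol P} {f : Fn4} (hf : Sm (u4 f)) {p : Pt} (hp : p ∈ Box (cx P) s) :
    dd 3 (u4 (phF P s.ψ)) p * fd (phF P s.ψ) 0 f p.1 p.2.1 p.2.2.1 p.2.2.2 =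
      dd 3 (u4 (phF P s.ψ)) p * dd 1 (u4 f) p - dd 1 (u4 (phF P s.ψ)) p * dd 3 (u4 f) p := by
  have h := jac' s hp
  have h0 : dd 3 (u4 (phF P s.ψ)) p ≠ 0 := by intro e; rw [e] at h; norm_num at h
  simp only [fd, Matrix.cons_val, p1_dd hf, p3_dd hf, p1_dd (ph_Sm s), p3_dd (ph_Sm s)]
  field_simp
lemma fd1_eq {s : Sol P} {f : Fn4} (hf : Sm (u4 f)) {p : Pt} (hp : p ∈ Box (cx P) s) :
    dd 3 (u4 (phF P s.ψ)) p * fd (phF P s.ψ) 1 f p.1 p.2.1 p.2.2.1 p.2.2.2 =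
      dd 3 (u4 (phF P s.ψ)) p * dd 2 (u4 f) p - dd 2 (u4 (phF P s.ψ)) p * dd 3 (u4 f) p := by
  have h := jac' s hp
  have h0 : dd 3 (u4 (phF P s.ψ)) p ≠ 0 := by intro e; rw [e] at h; norm_num at h
  simp only [fd, Matrix.cons_val, p2_dd hf, p3_dd hf, p2_dd (ph_Sm s), p3_dd (ph_Sm s)]
  field_simp
lemma fd2_eq {s : Sol P} {f : Fn4} (hf : Sm (u4 f)) {p : Pt} (hp : p ∈ Box (cx P) s) :
    dd 3 (u4 (phF P s.ψ)) p * fd (phF P s.ψ) 2 f p.1 p.2.1 p.2.2.1 p.2.2.2 = dd 3 (u4 f) p := by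
  have h := jac' s hp
  have h0 : dd 3 (u4 (phF P s.ψ)) p ≠ 0 := by intro e; rw [e] at h; norm_num at h
  simp only [fd, Matrix.cons_val, p3_dd hf, p3_dd (ph_Sm s)]
  field_simp

lemma dirD_eq {s : Sol P} {f : Fn4} (hf : Sm (u4 f)) (k : Fin 3) {p : Pt} (hp : p ∈ Box (cx P) s) :
    dd 3 (u4 (phF P s.ψ)) p * dirD (phF P s.ψ) (s.F k) f p.1 p.2.1 p.2.2.1 p.2.2.2 =
      dd 3 (u4 (phF P s.ψ)) p * u4 (s.F k 0) p * dd 1 (u4 f) p +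
      dd 3 (u4 (phF P s.ψ)) p * u4 (s.F k 1) p * dd 2 (u4 f) p +
      (u4 (s.F k 2) p - u4 (s.F k 0) p * dd 1 (u4 (phF P s.ψ)) p
        - u4 (s.F k 1) p * dd 2 (u4 (phF P s.ψ)) p) * dd 3 (u4 f) p := by
  have e0 := fd0_eq hf hp
  have e1 := fd1_eq hf hp
  have e2 := fd2_eq hf hp
  rw [dirD, Fin.sum_univ_three]
  have u0 : s.F k 0 p.1 p.2.1 p.2.2.1 p.2.2.2 = u4 (s.F k 0) p := rfl
  have u1 : s.F k 1 p.1 p.2.1 p.2.2.1 p.2.2.2 = u4 (s.F k 1) p := rfl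
  have u2 : s.F k 2 p.1 p.2.1 p.2.2.1 p.2.2.2 = u4 (s.F k 2) p := rfl
  rw [u0, u1, u2]
  linear_combination u4 (s.F k 0) p * e0 + u4 (s.F k 1) p * e1 + u4 (s.F k 2) p * e2

lemma fd_eq (i : Fin 3) (f : Sol P → Fn4) (hf : ∀ s, Sm (u4 (f s))) {s : Sol P} {p : Pt}
    (hp : p ∈ Box (cx P) s) :
    ev (Op ((pre P).Bm i) (fld (fun s => u4 (f s)) hf)) s p =
      dd 3 (u4 (phF P s.ψ)) p * fd (phF P s.ψ) i (f s) p.1 p.2.1 p.2.2.1 p.2.2.2 := by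
  fin_cases i
  · exact (ev_B0 _ _ hp).trans (fd0_eq (hf s) hp).symm
  · exact (ev_B1 _ _ hp).trans (fd1_eq (hf s) hp).symm
  · exact (ev_B2 _ _ hp).trans (fd2_eq (hf s) hp).symm

lemma Xv_eq (f : Sol P → Fn4) (hf : ∀ s, Sm (u4 (f s))) {s : Sol P} {p : Pt}
    (hp : p ∈ Box (cx P) s) :
    ev (Op (pre P).Xv (fld (fun s => u4 (f s)) hf)) s p =
      dd 3 (u4 (phF P s.ψ)) p * matD (phF P s.ψ) s.v (f s) p.1 p.2.1 p.2.2.1 p.2.2.2 :=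
  (ev_Xv _ _ hp).trans (matD_eq (hf s) hp).symm

lemma Xk_eq (k : Fin 3) (f : Sol P → Fn4) (hf : ∀ s, Sm (u4 (f s))) {s : Sol P} {p : Pt}
    (hp : p ∈ Box (cx P) s) :
    ev (Op ((pre P).Xk k) (fld (fun s => u4 (f s)) hf)) s p =
      dd 3 (u4 (phF P s.ψ)) p * dirD (phF P s.ψ) (s.F k) (f s) p.1 p.2.1 p.2.2.1 p.2.2.2 :=
  (ev_Xk k _ _ hp).trans (dirD_eq (hf s) k hp).symm

lemma pmom (i : Fin 3) : Op (pre P).Xv ((pre P).v i) + Op ((pre P).Bm i) (pre P).q =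
    Op ((pre P).Xk 0) ((pre P).F 0 i) + Op ((pre P).Xk 1) ((pre P).F 1 i) +
      Op ((pre P).Xk 2) ((pre P).F 2 i) := by
  refine Q_ext_Ioo fun s p hp h => ?_
  have := s.mom i p.1 hp.1 p.2.1 p.2.2.1 p.2.2.2 h
  rw [Fin.sum_univ_three] at this
  have a := Xv_eq (fun s => s.v i) (fun s => s.Sv i) hp
  have b := fd_eq i (fun s => s.q) (fun s => s.Sq) hp
  have c := fun k => Xk_eq k (fun s => s.F k i) (fun s => s.SF k i) hp
  rw [ev_add _ _ hp, ev_add _ _ hp, ev_add _ _ hp]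
  refine (congrArg₂ (· + ·) a b).trans (Eq.trans ?_
    (congrArg₂ (· + ·) (congrArg₂ (· + ·) (c 0) (c 1)) (c 2)).symm)
  simp only [← mul_add, this]

lemma ptrans (k i : Fin 3) : Op (pre P).Xv ((pre P).F k i) = Op ((pre P).Xk k) ((pre P).v i) := by
  refine Q_ext_Ioo fun s p hp h => ?_
  have := s.trans k i p.1 hp.1 p.2.1 p.2.2.1 p.2.2.2 h
  have a := Xv_eq (fun s => s.F k i) (fun s => s.SF k i) hp
  have c := Xk_eq k (fun s => s.v i) (fun s => s.Sv i) hp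
  refine a.trans (Eq.trans ?_ c.symm)
  simp only [this]

lemma pdivv : Op ((pre P).Bm 0) ((pre P).v 0) + Op ((pre P).Bm 1) ((pre P).v 1) +
    Op ((pre P).Bm 2) ((pre P).v 2) = 0 := by
  refine Q_ext_Ioo fun s p hp h => ?_
  have := s.divv p.1 hp.1 p.2.1 p.2.2.1 p.2.2.2 h
  rw [Fin.sum_univ_three] at this
  have a := fun i => fd_eq i (fun s => s.v i) (fun s => s.Sv i) hp
  rw [ev_add _ _ hp, ev_add _ _ hp, ev_zero hp]
  refine (congrArg₂ (· + ·) (congrArg₂ (· + ·) (a 0) (a 1)) (a 2)).trans ?_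
  simp only [← mul_add, this, mul_zero]

lemma pdivF (k : Fin 3) : Op ((pre P).Bm 0) ((pre P).F k 0) + Op ((pre P).Bm 1) ((pre P).F k 1) +
    Op ((pre P).Bm 2) ((pre P).F k 2) = 0 := by
  refine Q_ext_Ioo fun s p hp h => ?_
  have := s.divF k p.1 hp.1 p.2.1 p.2.2.1 p.2.2.2 h
  rw [Fin.sum_univ_three] at this
  have a := fun i => fd_eq i (fun s => s.F k i) (fun s => s.SF k i) hp
  rw [ev_add _ _ hp, ev_add _ _ hp, ev_zero hp]
  refine (congrArg₂ (· + ·) (congrArg₂ (· + ·) (a 0) (a 1)) (a 2)).trans ?_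
  simp only [← mul_add, this, mul_zero]

lemma dB_flat {f : FnB} (hf : Sm (uB f)) (p : Pt) : bt f p.1 p.2.1 p.2.2.1 = dd 0 (uB f) p ∧
    b1 f p.1 p.2.1 p.2.2.1 = dd 1 (uB f) p ∧ b2 f p.1 p.2.1 p.2.2.1 = dd 2 (uB f) p :=
  ⟨congrFun (uB_bt hf) p, congrFun (uB_b1 hf) p, congrFun (uB_b2 hf) p⟩

lemma pkin : D 0 (pre P).psi = tr ((pre P).v 2) - tr ((pre P).v 0) * D 1 (pre P).psi -
    tr ((pre P).v 1) * D 2 (pre P).psi := by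
  refine Q_ext fun s p hp => ?_
  have h := s.kin p.1 hp.1 p.2.1 p.2.2.1
  obtain ⟨h0, h1, h2⟩ := dB_flat s.Sψ p
  rw [h0, h1, h2] at h
  rw [ev_sub _ _ hp, ev_sub _ _ hp, ev_mul _ _ hp, ev_mul _ _ hp, ev_tr _ hp, ev_tr _ hp, ev_tr _ hp]
  simp only [pre, D_fld, ev_fld _ _ hp, ev_fld _ _ (box_tr hp), u4]
  linarith

lemma ptang (k : Fin 3) : tr ((pre P).F k 2) - tr ((pre P).F k 0) * D 1 (pre P).psi -
    tr ((pre P).F k 1) * D 2 (pre P).psi = 0 := by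
  refine Q_ext fun s p hp => ?_
  have h := s.tang k p.1 hp.1 p.2.1 p.2.2.1
  obtain ⟨h0, h1, h2⟩ := dB_flat s.Sψ p
  rw [h1, h2] at h
  rw [ev_sub _ _ hp, ev_sub _ _ hp, ev_mul _ _ hp, ev_mul _ _ hp, ev_tr _ hp, ev_tr _ hp, ev_tr _ hp,
    ev_zero hp]
  simp only [pre, D_fld, ev_fld _ _ hp, ev_fld _ _ (box_tr hp), u4]
  linarith

lemma pbotv : trb ((pre P).v 2) = 0 := by
  refine Q_ext fun s p hp => ?_
  rw [ev_trb _ hp, ev_zero hp]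
  exact (ev_fld _ _ (box_trb hp)).trans (s.bot p.1 hp.1 p.2.1 p.2.2.1).1
lemma pbotF (k : Fin 3) : trb ((pre P).F k 2) = 0 := by
  refine Q_ext fun s p hp => ?_
  rw [ev_trb _ hp, ev_zero hp]
  exact (ev_fld _ _ (box_trb hp)).trans ((s.bot p.1 hp.1 p.2.1 p.2.2.1).2 k)

lemma uB_oml {f : FnB} (hf : Sm (uB f)) :
    uB (oneMinusLap f) = fun p => uB f p - dd 1 (dd 1 (uB f)) p - dd 2 (dd 2 (uB f)) p := by
  have e1 : uB (b1 (b1 f)) = dd 1 (dd 1 (uB f)) := by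
    rw [uB_b1 (uB_b1 hf ▸ hf.dd 1), uB_b1 hf]
  have e2 : uB (b2 (b2 f)) = dd 2 (dd 2 (uB f)) := by
    rw [uB_b2 (uB_b2 hf ▸ hf.dd 2), uB_b2 hf]
  funext p
  have a1 := congrFun e1 p
  have a2 := congrFun e2 p
  change f p.1 p.2.1 p.2.2.1 - (uB (b1 (b1 f)) p + uB (b2 (b2 f)) p) = _
  rw [a1, a2]
  simp only [uB]; ring

lemma Sm_oml {f : Pt → ℝ} (hf : Sm f) : Sm (fun p => f p - dd 1 (dd 1 f) p - dd 2 (dd 2 f) p) := by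
  have h1 := (hf.dd 1).dd 1
  have h2 := (hf.dd 2).dd 2
  refine ⟨(hf.smooth.sub h1.smooth).sub h2.smooth, fun p => ?_, fun p => ?_⟩
  · simp only [hf.per1, h1.per1, h2.per1]
  · simp only [hf.per2, h1.per2, h2.per2]

lemma Lp_fld (f : Sol P → Pt → ℝ) (h : ∀ s, Sm (f s)) : Lp (fld f h) =
    fld (fun s p => f s p - dd 1 (dd 1 (f s)) p - dd 2 (dd 2 (f s)) p) (fun s => Sm_oml (h s)) := by
  refine Q_ext fun s p hp => ?_
  simp only [Lp, D_fld, ev_sub _ _ hp, ev_fld _ _ hp]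

lemma mul_fld (f g : Sol P → Pt → ℝ) (hf : ∀ s, Sm (f s)) (hg : ∀ s, Sm (g s)) :
    fld f hf * fld g hg = fld (fun s => f s * g s) (fun s => (hf s).mul (hg s)) := rfl

lemma mc_eq (s : Sol P) (p : Pt) : meanCurvOp s.ψ p.1 p.2.1 p.2.2.1 =
    dd 1 (nnF s * dd 1 (uB s.ψ)) p + dd 2 (nnF s * dd 2 (uB s.ψ)) p := by
  have e1 : uB (fun t y1 y2 => b1 s.ψ t y1 y2 / Real.sqrt (1 + (b1 s.ψ t y1 y2) ^ 2 + (b2 s.ψ t y1 y2) ^ 2))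
      = nnF s * dd 1 (uB s.ψ) := by
    funext p
    obtain ⟨_, h1, h2⟩ := dB_flat s.Sψ p
    simp only [uB, h1, h2, Pi.mul_apply, nnF, div_eq_inv_mul]
  have e2 : uB (fun t y1 y2 => b2 s.ψ t y1 y2 / Real.sqrt (1 + (b1 s.ψ t y1 y2) ^ 2 + (b2 s.ψ t y1 y2) ^ 2))
      = nnF s * dd 2 (uB s.ψ) := by
    funext p
    obtain ⟨_, h1, h2⟩ := dB_flat s.Sψ p
    simp only [uB, h1, h2, Pi.mul_apply, nnF, div_eq_inv_mul]
  have S1 := (nnF_Sm s).mul (s.Sψ.dd 1)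
  have S2 := (nnF_Sm s).mul (s.Sψ.dd 2)
  unfold meanCurvOp
  rw [(dB_flat (e1 ▸ S1) p).2.1, (dB_flat (e2 ▸ S2) p).2.2, e1, e2]

lemma ppress : tr (pre P).q = - (pre P).sg * (D 1 ((pre P).nn * D 1 (pre P).psi) +
      D 2 ((pre P).nn * D 2 (pre P).psi)) +
    (pre P).sk * (pre P).sk * Lp (Lp (pre P).psi) + (pre P).sk * (pre P).sk * Lp (D 0 (pre P).psi) := by
  refine Q_ext fun s p hp => ?_
  have h := s.press p.1 hp.1 p.2.1 p.2.2.1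
  rw [mc_eq (P := P) s p] at h
  have a1 := congrFun (uB_oml (f := oneMinusLap s.ψ) (uB_oml s.Sψ ▸ Sm_oml s.Sψ)) p
  rw [uB_oml s.Sψ] at a1
  have S0 : Sm (uB (bt s.ψ)) := uB_bt s.Sψ ▸ s.Sψ.dd 0
  have a2 := congrFun (uB_oml S0) p
  rw [uB_bt s.Sψ] at a2
  change s.q p.1 p.2.1 p.2.2.1 0 = -P.σ * _ + s.κ * uB (oneMinusLap (oneMinusLap s.ψ)) p +
    s.κ * uB (oneMinusLap (bt s.ψ)) p at h
  rw [a1, a2] at h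
  have esk : ev (pre P).sk s p * ev (pre P).sk s p = s.κ := by
    rw [Pre.sk, ev_cst _ hp]
    exact Real.mul_self_sqrt s.hκ.1.le
  have esg : ev (pre P).sg s p = P.σ := by rw [Pre.sg, ev_cst _ hp]; rfl
  rw [ev_tr _ hp, ev_add _ _ hp, ev_add _ _ hp, ev_mul _ _ hp, ev_mul _ _ hp, ev_mul _ _ hp,
    ev_mul _ _ hp, ev_mul _ _ hp, ev_neg _ hp, esk, esg, ev_add _ _ hp]
  simp only [pre, D_fld, mul_fld, Lp_fld, ev_fld _ _ hp, ev_fld _ _ (box_tr hp)]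
  exact h

end EE

namespace EE
open scoped ContDiff
open MeasureTheory Set Filter Topology

variable {P : Par}

lemma pD_chi (i : Fin 4) (hi : i ≠ 3) : D i (pre P).chi = 0 := by
  refine Q_ext fun s p hp => ?_
  simp only [pre, D_fld, ev_fld _ _ hp, ev_zero hp, chF_d P.hχ hi, Pi.zero_apply]

lemma pchi_Li (γ : List (Fin 4)) : Dw γ (pre P).chi ∈ Li (X := cx P) := by
  intro K
  obtain ⟨g, hg, _, e⟩ := chi_form P γ
  obtain ⟨C, hC⟩ := (isCompact_Icc (a := -P.b) (b := 0)).exists_bound_of_continuousOn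
    hg.continuous.continuousOn
  refine ⟨C, fun s t ht _ x hx => ?_⟩
  have hp : (t, x) ∈ Box (cx P) s := ⟨ht, hx⟩
  simp only [pre, Dw_fld, ev_fld _ _ hp, e]
  exact hC _ hx

lemma ptr_chi : tr (pre P).chi = 1 := by
  refine Q_ext fun s p hp => ?_
  rw [ev_tr _ hp, ev_one hp]
  exact (ev_fld _ _ (box_tr hp)).trans P.hχ0

lemma ptrb_chi (γ : List (Fin 4)) : trb (Dw γ (pre P).chi) = 0 := by
  refine Q_ext fun s p hp => ?_
  obtain ⟨g, hg, ⟨δ, hδ, h0⟩, e⟩ := chi_form P γ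
  rw [ev_trb _ hp, ev_zero hp]
  simp only [pre, Dw_fld, ev_fld _ _ (box_trb hp), e]
  exact h0 _ ⟨le_rfl, by change -P.b ≤ _; linarith⟩

lemma pD3_psi : D 3 (pre P).psi = 0 := by
  refine Q_ext fun s p hp => ?_
  simp only [pre, D_fld, ev_fld _ _ hp, ev_zero hp, uB_d3 (Sol.Sψ s), Pi.zero_apply]

lemma ptr_psi : tr (pre P).psi = (pre P).psi := by
  refine Q_ext fun s p hp => ?_
  rw [ev_tr _ hp]
  simp only [pre, ev_fld _ _ hp, ev_fld _ _ (box_tr hp)]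
  rfl

lemma piJ_J : (pre P).iJ * (pre P).J = 1 := by
  refine Q_ext fun s p hp => ?_
  have h := jac' s hp
  rw [ev_mul _ _ hp, J_eq, ev_one hp]
  simp only [pre, ev_fld _ _ hp]
  rw [cinv_eq h, one_div_mul_cancel (by linarith)]

lemma piJ_Li : (pre P).iJ ∈ Li (X := cx P) := by
  intro K
  refine ⟨2, fun s t ht _ x hx => ?_⟩
  have hp : (t, x) ∈ Box (cx P) s := ⟨ht, hx⟩
  have h := jac' s hp
  simp only [pre, ev_fld _ _ hp]
  rw [cinv_eq h, abs_of_nonneg (one_div_nonneg.2 (by linarith)), div_le_iff₀ (by linarith)]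
  linarith

lemma pJ_pos (s : Sol P) (p : Pt) (hp : p ∈ Box (cx P) s) : 1 / 2 ≤ ev (pre P).J s p := by
  rw [J_eq, ev_fld _ _ hp]; exact jac' s hp

lemma pnn_eq : (pre P).nn * (pre P).nn * (1 + D 1 (pre P).psi * D 1 (pre P).psi +
    D 2 (pre P).psi * D 2 (pre P).psi) = 1 := by
  refine Q_ext fun s p hp => ?_
  rw [ev_mul _ _ hp, ev_mul _ _ hp, ev_add _ _ hp, ev_add _ _ hp, ev_mul _ _ hp, ev_mul _ _ hp, ev_one hp]
  simp only [pre, D_fld, ev_fld _ _ hp, nnF]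
  have h0 : 0 < 1 + dd 1 (uB (Sol.ψ s)) p ^ 2 + dd 2 (uB (Sol.ψ s)) p ^ 2 := by positivity
  rw [← mul_inv, Real.mul_self_sqrt h0.le, ← sq, ← sq, inv_mul_cancel₀ h0.ne']

lemma pnn_pos (s : Sol P) (p : Pt) (hp : p ∈ Box (cx P) s) :
    0 < ev (pre P).nn s p ∧ ev (pre P).nn s p ≤ 1 := by
  simp only [pre, ev_fld _ _ hp, nnF]
  have h0 : 0 < 1 + dd 1 (uB (Sol.ψ s)) p ^ 2 + dd 2 (uB (Sol.ψ s)) p ^ 2 := by positivity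
  refine ⟨inv_pos.2 (Real.sqrt_pos.2 h0), inv_le_one_of_one_le₀ (Real.one_le_sqrt.2 ?_)⟩
  linarith [sq_nonneg (dd 1 (uB (Sol.ψ s)) p), sq_nonneg (dd 2 (uB (Sol.ψ s)) p)]

/-- The system of all solutions. -/
def sys (P : Par) : Sys (cx P) where
  toPre := pre P
  hσ := P.hσ
  hκ := Sol.hκ
  D_chi := pD_chi
  chi_Li := pchi_Li
  tr_chi := ptr_chi
  trb_chi := ptrb_chi
  D3_psi := pD3_psi
  tr_psi := ptr_psi
  iJ_J := piJ_J
  iJ_Li := piJ_Li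
  J_pos := pJ_pos
  nn_eq := pnn_eq
  nn_pos := pnn_pos
  mom := pmom
  trans := ptrans
  divv := pdivv
  divF := pdivF
  kin := pkin
  tang := ptang
  botv := pbotv
  botF := pbotF
  press := ppress
  Ev i γ h s t ht := by
    refine (I_fld γ _ _ ht).le.trans ?_
    exact (energy_ge P.hb P.hσ (Sol.hκ s).1 (Sol.Sψ s) (Sol.Sv s) (Sol.SF s) ht.1).1 i γ h
  EF k i γ h s t ht := by
    refine (I_fld γ _ _ ht).le.trans ?_
    exact (energy_ge P.hb P.hσ (Sol.hκ s).1 (Sol.Sψ s) (Sol.Sv s) (Sol.SF s) ht.1).2.1 k i γ h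
  Es γ h3 h h0 s t ht := by
    refine (congrArg (P.σ * ·) (I_fld γ _ _ ht)).le.trans ?_
    exact (energy_ge P.hb P.hσ (Sol.hκ s).1 (Sol.Sψ s) (Sol.Sv s) (Sol.SF s) ht.1).2.2.1 γ h3 h h0
  Ek γ h3 h h0 s t ht := by
    refine (congrArg (Sol.κ s * ·) (I_fld γ _ _ ht)).le.trans ?_
    exact (energy_ge P.hb P.hσ (Sol.hκ s).1 (Sol.Sψ s) (Sol.Sv s) (Sol.SF s) ht.1).2.2.2 γ h3 h h0
  Ec := by
    refine ⟨Cen P.b, Cen_nonneg P.hb, fun s t ht B H1 H2 H3 H4 H5 => ?_⟩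
    refine energy_le P.hb (Sol.Sψ s) (Sol.Sv s) (Sol.SF s) B ?_ ?_ ?_ ?_ ?_
    · exact fun i γ h => (I_fld γ _ _ ht).ge.trans (H1 i γ h)
    · exact fun k i γ h => (I_fld γ _ _ ht).ge.trans (H2 k i γ h)
    · exact fun γ a b c => (congrArg (P.σ * ·) (I_fld γ _ _ ht)).ge.trans (H3 γ a b c)
    · exact fun γ a b c => (congrArg (Sol.κ s * ·) (I_fld γ _ _ ht)).ge.trans (H4 γ a b c)
    · intro γ a b c d
      refine le_trans (le_of_eq ?_) (H5 γ a b c d)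
      refine congrArg (Sol.κ s * ·) (intervalIntegral.integral_congr fun r hr => ?_)
      rw [uIcc_of_le ht.1] at hr
      have hr2 : r ∈ Tm (X := cx P) s := ⟨hr.1, hr.2.trans ht.2⟩
      have key := (I_fld γ (fun s : Sol P => uB s.ψ) (fun s => s.Sψ) hr2).symm
      exact key

/-- Restriction of a solution to a shorter time interval. -/
def Sol.res (s : Sol P) (T1 : ℝ) (h0 : 0 < T1) (h1 : T1 ≤ s.T) : Sol P :=
  have sub : ∀ t ∈ Icc 0 T1, t ∈ Icc 0 s.T := fun _ ht => ⟨ht.1, ht.2.trans h1⟩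
  { s with
    T := T1
    hT := h0
    jac := fun t ht => s.jac t (sub t ht)
    mom := fun i t ht => s.mom i t (sub t ht)
    divv := fun t ht => s.divv t (sub t ht)
    trans := fun j i t ht => s.trans j i t (sub t ht)
    divF := fun j t ht => s.divF j t (sub t ht)
    kin := fun t ht => s.kin t (sub t ht)
    press := fun t ht => s.press t (sub t ht)
    tang := fun j t ht => s.tang j t (sub t ht)
    bot := fun t ht => s.bot t (sub t ht) }

/-- The uniform bound for all solutions. -/
theorem uniform (P : Par) : ∃ T > (0:ℝ), ∃ C > (0:ℝ), ∀ s : Sol P, s.T ≤ T →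
    energy4 P.b P.σ s.κ s.ψ s.v s.F 0 ≤ P.M →
    ∀ t ∈ Icc 0 s.T, energy4 P.b P.σ s.κ s.ψ s.v s.F t ≤ C := by
  obtain ⟨C0, h⟩ := (sys P).main
  obtain ⟨τ, hτ, H⟩ := h (max (max C0 P.M) 0 + 1)
  have k1 : C0 < max (max C0 P.M) 0 + 1 :=
    lt_of_le_of_lt ((le_max_left _ _).trans (le_max_left _ _)) (lt_add_one _)
  have k2 : P.M < max (max C0 P.M) 0 + 1 :=
    lt_of_le_of_lt ((le_max_right _ _).trans (le_max_left _ _)) (lt_add_one _)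
  have k3 : 0 < max (max C0 P.M) 0 + 1 := lt_of_le_of_lt (le_max_right _ _) (lt_add_one _)
  generalize max (max C0 P.M) 0 + 1 = K at *
  refine ⟨τ, hτ, K, k3, fun s hs h0 t ht => ?_⟩
  by_contra hcon
  rw [not_le] at hcon
  have hc : Continuous (energy4 P.b P.σ s.κ s.ψ s.v s.F) := energy_cont P.hb s.Sψ s.Sv s.SF
  -- the first time at which the energy reaches `K`
  let Z : Set ℝ := {r | r ∈ Icc 0 t ∧ K ≤ energy4 P.b P.σ s.κ s.ψ s.v s.F r}
  have hZc : IsCompact Z := by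
    refine (isCompact_Icc (a := (0:ℝ)) (b := t)).of_isClosed_subset ?_ fun r hr => hr.1
    exact isClosed_Icc.inter (isClosed_le continuous_const hc)
  have hZn : Z.Nonempty := ⟨t, ⟨ht.1, le_rfl⟩, hcon.le⟩
  obtain ⟨T1, hT1, hmin⟩ := hZc.exists_isLeast hZn
  have hpos : 0 < T1 := by
    rcases eq_or_lt_of_le hT1.1.1 with e | e
    · have := hT1.2; rw [← e] at this; linarith
    · exact e
  have hle : T1 ≤ s.T := hT1.1.2.trans ht.2
  have hbelow : ∀ r ∈ Ico 0 T1, energy4 P.b P.σ s.κ s.ψ s.v s.F r ≤ K := fun r hr => by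
    by_contra hh
    rw [not_le] at hh
    exact absurd (hmin ⟨⟨hr.1, hr.2.le.trans hT1.1.2⟩, hh.le⟩) (not_le.2 hr.2)
  have hall : ∀ r ∈ Icc 0 T1, energy4 P.b P.σ s.κ s.ψ s.v s.F r ≤ K := by
    have hcl : IsClosed {r | energy4 P.b P.σ s.κ s.ψ s.v s.F r ≤ K} := isClosed_le hc continuous_const
    have := closure_minimal hbelow hcl
    rw [closure_Ico hpos.ne] at this
    exact this
  have := H (s.res T1 hpos hle) ⟨hle.trans hs, h0, hall⟩ T1 ⟨hpos.le, le_rfl⟩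
  change energy4 P.b P.σ s.κ s.ψ s.v s.F T1 ≤ C0 at this
  linarith [hT1.2]

lemma Sm_u4 {f : Fn4} (h : Smooth4 f) (hp : Periodic4 f) : Sm (u4 f) := by
  refine ⟨h, fun p => ?_, fun p => ?_⟩
  · have := hp.1 p.1 p.2.1 p.2.2.1 p.2.2.2
    simpa [u4, ee] using this
  · have := hp.2 p.1 p.2.1 p.2.2.1 p.2.2.2
    simpa [u4, ee] using this

lemma Sm_uB {f : FnB} (h : ContDiff ℝ (⊤ : ℕ∞) (fun p : ℝ × ℝ × ℝ => f p.1 p.2.1 p.2.2))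
    (hp : (∀ t x1 x2 : ℝ, f t (x1 + 1) x2 = f t x1 x2) ∧ ∀ t x1 x2 : ℝ, f t x1 (x2 + 1) = f t x1 x2) :
    Sm (uB f) := by
  refine ⟨?_, fun p => ?_, fun p => ?_⟩
  · exact h.comp (g := fun p : ℝ × ℝ × ℝ => f p.1 p.2.1 p.2.2)
      (f := fun p : Pt => (p.1, p.2.1, p.2.2.1)) (by fun_prop)
  · have := hp.1 p.1 p.2.1 p.2.2.1
    simpa [uB, ee] using this
  · have := hp.2 p.1 p.2.1 p.2.2.1
    simpa [uB, ee] using this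

end EE

/-- **Uniform-in-κ a priori estimate for the κ-regularized flattened elastodynamic
system with surface tension.** For every `σ > 0` and `M > 0` there exist `T > 0` and
`C > 0`, independent of `κ`, such that every smooth periodic solution on `[0,T₀]`
(`0 < T₀ ≤ T`, `0 < κ ≤ 1`) with `∂₃φ ≥ 1/2` and initial energy `E₄^κ(0) ≤ M`
satisfies `E₄^κ(t) ≤ C` on `[0,T₀]`. -/
theorem uniform_in_kappa_energy_estimate (b : ℝ) (hb : 0 < b)
    (χ : ℝ → ℝ) (hχ : ContDiff ℝ (⊤ : ℕ∞) χ) (hχ0 : χ 0 = 1)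
    (hχb : ∃ δ > 0, ∀ y ∈ Set.Icc (-b) (-b + δ), χ y = 0)
    (σ M : ℝ) (hσ : 0 < σ) (hM : 0 < M) :
    ∃ T > (0:ℝ), ∃ C > (0:ℝ), ∀ κ ∈ Set.Ioc (0:ℝ) 1, ∀ T₀ ∈ Set.Ioc (0:ℝ) T,
      ∀ (ψ : FnB) (v : Fin 3 → Fn4) (F : Fin 3 → Fin 3 → Fn4) (q : Fn4) (φ : Fn4),
        ContDiff ℝ (⊤ : ℕ∞) (fun p : ℝ × ℝ × ℝ => ψ p.1 p.2.1 p.2.2) →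
        ((∀ t x1 x2 : ℝ, ψ t (x1 + 1) x2 = ψ t x1 x2) ∧
          ∀ t x1 x2 : ℝ, ψ t x1 (x2 + 1) = ψ t x1 x2) →
        (∀ i, Smooth4 (v i)) → (∀ j i, Smooth4 (F j i)) → Smooth4 q →
        (∀ i, Periodic4 (v i)) → (∀ j i, Periodic4 (F j i)) → Periodic4 q →
        (∀ t x1 x2 x3 : ℝ, φ t x1 x2 x3 = x3 + χ x3 * ψ t x1 x2) →
        -- Jacobian bound `∂₃φ ≥ 1/2`
        (∀ t ∈ Set.Icc 0 T₀, ∀ (x1 x2 : ℝ), ∀ x3 ∈ Set.Icc (-b) 0,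
          (1:ℝ) / 2 ≤ p3 φ t x1 x2 x3) →
        -- momentum equation `D_t^φ v + ∇^φ q = Σₖ (Fₖ·∇^φ)Fₖ` in `Ω`
        (∀ i : Fin 3, ∀ t ∈ Set.Icc 0 T₀, ∀ (x1 x2 : ℝ), ∀ x3 ∈ Set.Ioo (-b) 0,
          matD φ v (v i) t x1 x2 x3 + fd φ i q t x1 x2 x3 =
            ∑ k : Fin 3, dirD φ (F k) (F k i) t x1 x2 x3) →
        -- incompressibility `∇^φ·v = 0` in `Ω`
        (∀ t ∈ Set.Icc 0 T₀, ∀ (x1 x2 : ℝ), ∀ x3 ∈ Set.Ioo (-b) 0,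
          ∑ i : Fin 3, fd φ i (v i) t x1 x2 x3 = 0) →
        -- transport `D_t^φ Fⱼ = (Fⱼ·∇^φ)v` in `Ω`
        (∀ j i : Fin 3, ∀ t ∈ Set.Icc 0 T₀, ∀ (x1 x2 : ℝ), ∀ x3 ∈ Set.Ioo (-b) 0,
          matD φ v (F j i) t x1 x2 x3 = dirD φ (F j) (v i) t x1 x2 x3) →
        -- divergence constraint `∇^φ·Fⱼ = 0` in `Ω`
        (∀ j : Fin 3, ∀ t ∈ Set.Icc 0 T₀, ∀ (x1 x2 : ℝ), ∀ x3 ∈ Set.Ioo (-b) 0,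
          ∑ i : Fin 3, fd φ i (F j i) t x1 x2 x3 = 0) →
        -- kinematic boundary condition `∂ₜψ = v·N` on `Σ`
        (∀ t ∈ Set.Icc 0 T₀, ∀ x1 x2 : ℝ,
          bt ψ t x1 x2 = v 0 t x1 x2 0 * (-(b1 ψ t x1 x2)) +
            v 1 t x1 x2 0 * (-(b2 ψ t x1 x2)) + v 2 t x1 x2 0) →
        -- regularized pressure boundary condition on `Σ`
        (∀ t ∈ Set.Icc 0 T₀, ∀ x1 x2 : ℝ,
          q t x1 x2 0 = -σ * meanCurvOp ψ t x1 x2 +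
            κ * oneMinusLap (oneMinusLap ψ) t x1 x2 + κ * oneMinusLap (bt ψ) t x1 x2) →
        -- tangency `Fⱼ·N = 0` on `Σ`
        (∀ j : Fin 3, ∀ t ∈ Set.Icc 0 T₀, ∀ x1 x2 : ℝ,
          F j 0 t x1 x2 0 * (-(b1 ψ t x1 x2)) + F j 1 t x1 x2 0 * (-(b2 ψ t x1 x2)) +
            F j 2 t x1 x2 0 = 0) →
        -- slip conditions `v₃ = F_{3j} = 0` on `Σ_b`
        (∀ t ∈ Set.Icc 0 T₀, ∀ x1 x2 : ℝ,
          v 2 t x1 x2 (-b) = 0 ∧ ∀ j : Fin 3, F j 2 t x1 x2 (-b) = 0) →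
        -- initial energy bound
        energy4 b σ κ ψ v F 0 ≤ M →
        ∀ t ∈ Set.Icc 0 T₀, energy4 b σ κ ψ v F t ≤ C := by
  obtain ⟨T, hT, C, hC, H⟩ := EE.uniform ⟨b, hb, χ, hχ, hχ0, hχb, σ, hσ, M⟩
  refine ⟨T, hT, C, hC, ?_⟩
  intro κ hκ T₀ hT₀ ψ v F q φ sψ pψ sv sF sq pv pF pq hφ jac mom divv trans divF kin press tang bot h0
  have e : φ = EE.phF ⟨b, hb, χ, hχ, hχ0, hχb, σ, hσ, M⟩ ψ := by
    funext t x1 x2 x3; exact hφ t x1 x2 x3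
  subst e
  exact H ⟨κ, hκ, T₀, hT₀.1, ψ, v, F, q, EE.Sm_uB sψ pψ, fun i => EE.Sm_u4 (sv i) (pv i),
    fun j i => EE.Sm_u4 (sF j i) (pF j i), EE.Sm_u4 sq pq, jac, mom, divv, trans, divF, kin, press,
    tang, bot⟩ hT₀.2 h0
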